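/- Let ℋ(τ) := Σ_{n≥0} H(n) e^{2πinτ} + (1/(4√π)) Σ_{n≥1} n Γ(−1/2, 4πn²v) e^{−2πin²τ} + 1/(8π√v) for τ = u+iv in the upper half-plane ℍ, where H(n) is the Hurwitz class number. Then for every matrix (a b; c d) ∈ Γ₀(4) one has ℋ((aτ+b)/(cτ+d)) = (c/d) ε_d^{−3} (cτ+d)^{3/2} ℋ(τ), where (c/d) is the extended Jacobi (Kronecker) symbol and the power (cτ+d)^{3/2} is the principal branch. -/

import Mathlib

open Complex MeasureTheory

noncomputable section

/-- ε_d for odd d: 1 if d ≡ 1 (mod 4), i if d ≡ 3 (mod 4). -/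
def eps (d : ℤ) : ℂ := if d % 4 = 1 then 1 else Complex.I

/-- Extended Jacobi (Kronecker) symbol (c/d) for odd d ≠ 0: the Jacobi symbol (c/|d|),
multiplied by −1 if both c < 0 and d < 0. -/
def kron (c d : ℤ) : ℤ := (if c < 0 ∧ d < 0 then -1 else 1) * jacobiSym c d.natAbs

/-- The action of a matrix (p q; r s) on a binary quadratic form (a, b, c) ↔ ax²+bxy+cy²,
given by substituting (x, y) ↦ (px + qy, rx + sy). -/
def actForm (p q r s : ℤ) (f : ℤ × ℤ × ℤ) : ℤ × ℤ × ℤ :=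
  (f.1 * p ^ 2 + f.2.1 * p * r + f.2.2 * r ^ 2,
   2 * f.1 * p * q + f.2.1 * (p * s + q * r) + 2 * f.2.2 * r * s,
   f.1 * q ^ 2 + f.2.1 * q * s + f.2.2 * s ^ 2)

/-- Positive definite integral binary quadratic forms of discriminant −N. -/
def PosDefForm (N : ℕ) : Type :=
  {f : ℤ × ℤ × ℤ // 0 < f.1 ∧ f.2.1 ^ 2 - 4 * f.1 * f.2.2 = -(N : ℤ)}

/-- SL(2,ℤ)-equivalence of binary quadratic forms. -/
def formRel (N : ℕ) (f g : PosDefForm N) : Prop :=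
  ∃ p q r s : ℤ, p * s - q * r = 1 ∧ g.val = actForm p q r s f.val

/-- SL(2,ℤ)-equivalence classes of positive definite forms of discriminant −N. -/
def FormClass (N : ℕ) : Type := Quot (formRel N)

open scoped Classical in
/-- The weight of a class: 1/2 if it contains a multiple of x²+y², 1/3 if it contains a
multiple of x²+xy+y², and 1 otherwise. -/
def classWeight (N : ℕ) (Q : FormClass N) : ℝ :=
  if ∃ f : PosDefForm N, Quot.mk (formRel N) f = Q ∧ ∃ lam : ℤ, f.val = (lam, 0, lam) then 1/2
  else if ∃ f : PosDefForm N, Quot.mk (formRel N) f = Q ∧ ∃ lam : ℤ, f.val = (lam, lam, lam) then 1/3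
  else 1

/-- The Hurwitz class number H(N). -/
def hurwitzH (N : ℕ) : ℝ :=
  if N = 0 then -1/12
  else if N % 4 = 1 ∨ N % 4 = 2 then 0
  else ∑' Q : FormClass N, classWeight N Q

/-- The incomplete Gamma value Γ(−1/2, x) = ∫ₓ^∞ e^{−t} t^{−3/2} dt. -/
def incGammaNegHalf (x : ℝ) : ℝ := ∫ t in Set.Ioi x, Real.exp (-t) * t ^ (-(3:ℝ)/2)

/-- Zagier's function ℋ(τ). -/
def zagierH (z : ℂ) : ℂ :=
  (∑' n : ℕ, (hurwitzH n : ℂ) * Complex.exp (2 * Real.pi * Complex.I * n * z))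
  + (1 / (4 * Real.sqrt Real.pi)) *
      ∑' n : ℕ, ((n : ℂ) + 1) * (incGammaNegHalf (4 * Real.pi * ((n : ℝ) + 1)^2 * z.im) : ℂ) *
        Complex.exp (-2 * Real.pi * Complex.I * ((n : ℂ) + 1)^2 * z)
  + 1 / (8 * Real.pi * Real.sqrt z.im)

theorem jacobiSym_four_mul (a : ℤ) {m : ℕ} (hm : Odd m) : jacobiSym (4 * a) m = jacobiSym a m := by
  rw [jacobiSym.mul_left]
  have : jacobiSym 4 m = 1 := by
    have h2 : (4 : ℤ) = 2 ^ 2 := by norm_num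
    rw [h2]
    apply jacobiSym.sq_one'
    rw [Int.gcd_eq_natAbs]
    simpa using hm.coprime_two_left
  rw [this, one_mul]

theorem jacobiSym_reflect {a m n : ℕ} (ha : 0 < a) (hm : Odd m) (hn : Odd n)
    (h : 4 * a ∣ m + n) : jacobiSym a m = jacobiSym a n := by
  have hodd : Odd (4 * a - 1) := ⟨2 * a - 1, by omega⟩
  have h1 : jacobiSym a (4 * a - 1) = 1 := by
    rw [← jacobiSym_four_mul _ hodd, jacobiSym.mod_left]
    have : ((4 * a - 1 : ℕ) : ℤ) = 4 * a - 1 := by omega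
    rw [this]
    have h3 : (4 * (a : ℤ)) % (4 * a - 1) = 1 := by
      have : (4 * (a : ℤ)) % (4 * a - 1) = (1 + (4 * a - 1) * 1) % (4 * a - 1) := by
        congr 1; ring
      rw [this, Int.add_mul_emod_self_left]
      apply Int.emod_eq_of_lt <;> omega
    rw [h3, jacobiSym.one_left]
  have h2 : jacobiSym a (m * (4 * a - 1)) = jacobiSym a m := by
    have : NeZero m := ⟨by rintro rfl; simp at hm⟩
    have : NeZero (4 * a - 1) := ⟨by omega⟩
    rw [jacobiSym.mul_right, h1, mul_one]
  rw [← h2, jacobiSym.mod_right' a (hm.mul hodd), jacobiSym.mod_right' a hn]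
  congr 1
  have h5 : (m * (4 * a - 1) + (m + n)) ≡ n + 0 [MOD 4 * a] := by
    have : m * (4 * a - 1) + (m + n) = n + (4 * a) * m := by
      obtain ⟨k, hk⟩ : ∃ k, 4 * a = k + 1 := ⟨4 * a - 1, by omega⟩
      rw [hk]; simp; ring
    rw [this]
    exact Nat.ModEq.add_left _ ((Nat.modEq_zero_iff_dvd).2 (dvd_mul_right _ _))
  exact Nat.ModEq.add_right_cancel ((Nat.modEq_zero_iff_dvd).2 h) h5

theorem jacobiSym_natAbs_of_neg {a : ℤ} (ha : a < 0) {m : ℕ} (hm : Odd m) :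
    jacobiSym a m = ZMod.χ₄ m * jacobiSym a.natAbs m := by
  rw [← jacobiSym.at_neg_one hm, ← jacobiSym.mul_left]
  congr 1; omega

theorem chi_neg {m n : ℕ} (hm : Odd m) (h : 4 ∣ m + n) : ZMod.χ₄ m = - ZMod.χ₄ n := by
  rw [ZMod.χ₄_nat_eq_if_mod_four, ZMod.χ₄_nat_eq_if_mod_four]
  have := Nat.odd_iff.1 hm
  have h1 : m % 2 ≠ 0 := by omega
  have h2 : n % 2 ≠ 0 := by omega
  have h3 : m % 4 = 1 ∨ m % 4 = 3 := by omega
  rcases h3 with h3 | h3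
  · have : n % 4 ≠ 1 := by omega
    simp [h1, h2, h3, this]
  · have : n % 4 = 1 := by omega
    simp [h1, h2, h3, this]

theorem kron_add_aux {c d e : ℤ} (hc0 : c ≠ 0) (hc : 4 ∣ c) (hd : Odd d) (he : Odd e)
    (h : c ∣ e - d) (hd0 : 0 < d) : kron c d = kron c e := by
  obtain ⟨a, rfl⟩ := hc
  have hd' : Odd d.natAbs := hd.natAbs
  have he' : Odd e.natAbs := he.natAbs
  have ha0 : a ≠ 0 := by rintro rfl; simp at hc0
  have he0 : e ≠ 0 := by rintro rfl; simp at he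
  unfold kron
  rw [jacobiSym_four_mul _ hd', jacobiSym_four_mul _ he']
  rcases lt_or_gt_of_ne he0 with hlt | hgt
  · have hdv : 4 * a.natAbs ∣ d.natAbs + e.natAbs := by
      have : ((4 * a.natAbs : ℕ) : ℤ) ∣ ((d.natAbs + e.natAbs : ℕ) : ℤ) := by
        have h1 : ((d.natAbs + e.natAbs : ℕ) : ℤ) = -(e - d) := by omega
        rw [h1, dvd_neg, show ((4 * a.natAbs : ℕ) : ℤ) = ((4 * a).natAbs : ℤ) by
          rw [Int.natAbs_mul]; rfl, Int.natAbs_dvd]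
        exact h
      exact_mod_cast this
    have hr := jacobiSym_reflect (a := a.natAbs) (by omega) hd' he' hdv
    rcases lt_or_gt_of_ne ha0 with hal | hag
    · rw [jacobiSym_natAbs_of_neg hal hd', jacobiSym_natAbs_of_neg hal he', hr,
        chi_neg hd' (dvd_trans (dvd_mul_right _ _) hdv), if_neg (by omega), if_pos (by omega)]
      ring
    · rw [if_neg (by omega), if_neg (by omega)]
      have : (a.natAbs : ℤ) = a := by omega
      rw [this] at hr
      rw [hr]
  · rw [if_neg (by omega), if_neg (by omega), jacobiSym.mod_right a hd',
      jacobiSym.mod_right a he']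
    congr 2
    have : (d.natAbs : ℤ) ≡ e.natAbs [ZMOD ((4 * a.natAbs : ℕ) : ℤ)] := by
      apply Int.modEq_of_dvd
      have h1 : (e.natAbs : ℤ) - d.natAbs = e - d := by omega
      rw [h1, show ((4 * a.natAbs : ℕ) : ℤ) = ((4 * a).natAbs : ℤ) by
          rw [Int.natAbs_mul]; rfl, Int.natAbs_dvd]
      exact h
    exact (Int.natCast_modEq_iff.1 this)

theorem kron_mod_left {c c' d : ℤ} (hd0 : 0 < d) (h : d ∣ c' - c) : kron c d = kron c' d := by
  unfold kron
  rw [if_neg (by omega), if_neg (by omega), jacobiSym.mod_left c, jacobiSym.mod_left c']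
  congr 2
  have : (d.natAbs : ℤ) = d := by omega
  rw [this]
  exact Int.modEq_of_dvd h

theorem kron_neg_neg {c d : ℤ} (hd0 : 0 < d) (hd : Odd d) :
    kron (-c) (-d) = (if 0 < c then -1 else 1) * (if d % 4 = 1 then 1 else -1) * kron c d := by
  unfold kron
  have hd' : Odd d.natAbs := hd.natAbs
  rw [Int.natAbs_neg, ← neg_one_mul, jacobiSym.mul_left, jacobiSym.at_neg_one hd',
    ZMod.χ₄_nat_eq_if_mod_four]
  have := Int.odd_iff.1 hd
  have h1 : d.natAbs % 2 ≠ 0 := by omega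
  have h2 : (d.natAbs % 4 = 1) = (d % 4 = 1) := by apply propext; omega
  have h3 : (c < 0 ∧ d < 0) = False := by apply propext; simp; omega
  have h4 : ((-1 * c) < 0 ∧ -d < 0) = (0 < c) := by apply propext; omega
  simp only [h1, h2, h3, h4, if_false]
  ring

theorem neg_cpow_three_half {w : ℂ} (hw : 0 < w.im) :
    (-w) ^ ((3 : ℂ) / 2) = I * w ^ ((3 : ℂ) / 2) := by
  have hw0 : w ≠ 0 := by rintro rfl; simp at hw
  rw [cpow_def_of_ne_zero hw0, cpow_def_of_ne_zero (neg_ne_zero.2 hw0)]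
  have : log (-w) = log w - Real.pi * I := by
    unfold log
    rw [norm_neg, arg_neg_eq_arg_sub_pi_of_im_pos hw]
    push_cast; ring
  rw [this, sub_mul, sub_eq_add_neg, Complex.exp_add, mul_comm]
  congr 1
  have : -((Real.pi : ℂ) * I * (3 / 2)) = (Real.pi / 2 : ℂ) * I - 2 * Real.pi * I := by ring
  rw [this, Complex.exp_periodic.sub_eq, Complex.exp_pi_div_two_mul_I]

theorem cpow_mul_of_pos {X Y : ℂ} (hY : 0 < Y.im) (hXY : 0 < (X * Y).im) (s : ℂ) :
    (X * Y) ^ s = X ^ s * Y ^ s := by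
  have hX0 : X ≠ 0 := by rintro rfl; simp at hXY
  have hY0 : Y ≠ 0 := by rintro rfl; simp at hY
  have hsin : 0 < Real.sin (arg X + arg Y) := by
    have h1 := (X * Y).norm_mul_sin_arg
    have : (X * Y).im = ‖X‖ * ‖Y‖ * Real.sin (arg X + arg Y) := by
      rw [Real.sin_add, mul_im]
      nth_rw 1 [← norm_mul_cos_arg X, ← norm_mul_sin_arg X]
      nth_rw 1 [← norm_mul_cos_arg Y, ← norm_mul_sin_arg Y]
      ring
    rw [this] at hXY
    have : 0 < ‖X‖ * ‖Y‖ := mul_pos (norm_pos_iff.2 hX0) (norm_pos_iff.2 hY0)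
    exact (pos_iff_pos_of_mul_pos hXY).1 this
  have hYp : 0 < arg Y := by
    rcases (arg_nonneg_iff.2 hY.le).lt_or_eq with h | h
    · exact h
    · exact absurd (arg_eq_zero_iff.1 h.symm).2 hY.ne'
  have h1 := neg_pi_lt_arg X
  have h2 := arg_le_pi X
  have h3 := arg_le_pi Y
  have hlt : arg X + arg Y < Real.pi := by
    by_contra! h
    have := Real.sin_nonneg_of_nonneg_of_le_pi (x := arg X + arg Y - Real.pi) (by linarith)
      (by linarith)
    rw [Real.sin_sub_pi] at this
    linarith
  rw [cpow_def_of_ne_zero hX0, cpow_def_of_ne_zero hY0, cpow_def_of_ne_zero (mul_ne_zero hX0 hY0),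
    log_mul hX0 hY0 ⟨by linarith, hlt.le⟩, add_mul, Complex.exp_add]

theorem cpow_mul_of_neg {X Y : ℂ} (hY : Y.im < 0) (hXY : (X * Y).im < 0) (s : ℂ) :
    (X * Y) ^ s = X ^ s * Y ^ s := by
  have hX0 : X ≠ 0 := by rintro rfl; simp at hXY
  have hY0 : Y ≠ 0 := by rintro rfl; simp at hY
  have hsin : Real.sin (arg X + arg Y) < 0 := by
    have : (X * Y).im = ‖X‖ * ‖Y‖ * Real.sin (arg X + arg Y) := by
      rw [Real.sin_add, mul_im]
      nth_rw 1 [← norm_mul_cos_arg X, ← norm_mul_sin_arg X]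
      nth_rw 1 [← norm_mul_cos_arg Y, ← norm_mul_sin_arg Y]
      ring
    rw [this] at hXY
    have : 0 < ‖X‖ * ‖Y‖ := mul_pos (norm_pos_iff.2 hX0) (norm_pos_iff.2 hY0)
    exact (pos_iff_neg_of_mul_neg hXY).1 this
  have hYp : arg Y < 0 := arg_neg_iff.2 hY
  have h1 := neg_pi_lt_arg X
  have h2 := arg_le_pi X
  have h3 := neg_pi_lt_arg Y
  have hlt : -Real.pi < arg X + arg Y := by
    by_contra! h
    have := Real.sin_nonneg_of_nonneg_of_le_pi (x := arg X + arg Y + 2 * Real.pi) (by linarith)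
      (by linarith)
    rw [Real.sin_add_two_pi] at this
    linarith
  rw [cpow_def_of_ne_zero hX0, cpow_def_of_ne_zero hY0, cpow_def_of_ne_zero (mul_ne_zero hX0 hY0),
    log_mul hX0 hY0 ⟨hlt, by linarith⟩, add_mul, Complex.exp_add]

/-- The automorphy factor of weight `3/2`. -/
def autFactor (c d : ℤ) (z : ℂ) : ℂ :=
  (kron c d : ℂ) * (eps d) ^ (-3 : ℤ) * ((c : ℂ) * z + d) ^ ((3 : ℂ) / 2)

theorem I_zpow_neg_three : (I : ℂ) ^ (-3 : ℤ) = I := by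
  rw [zpow_neg, show (3 : ℤ) = ((3 : ℕ) : ℤ) from rfl, zpow_natCast, I_pow_three, inv_neg, inv_I]
  simp

theorem autFactor_neg_neg {c d : ℤ} (hc0 : c ≠ 0) (hd0 : 0 < d) (hd : Odd d) {z : ℂ}
    (hz : 0 < z.im) : autFactor (-c) (-d) z = autFactor c d z := by
  unfold autFactor
  rw [kron_neg_neg hd0 hd]
  have hw : ((-c : ℤ) : ℂ) * z + ((-d : ℤ) : ℂ) = -((c : ℂ) * z + d) := by push_cast; ring
  rw [hw]
  have him : ((c : ℂ) * z + d).im = c * z.im := by simp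
  have hp : (-((c : ℂ) * z + d)) ^ ((3 : ℂ) / 2) =
      (if 0 < c then I else -I) * ((c : ℂ) * z + d) ^ ((3 : ℂ) / 2) := by
    split_ifs with h
    · apply neg_cpow_three_half
      rw [him]
      have : (0 : ℝ) < c := by exact_mod_cast h
      positivity
    · have h' : 0 < (-((c : ℂ) * z + d)).im := by
        rw [neg_im, him]
        have : (c : ℝ) < 0 := by exact_mod_cast (lt_of_le_of_ne (not_lt.1 h) hc0)
        nlinarith
      have := neg_cpow_three_half h'
      rw [neg_neg] at this
      rw [this, ← mul_assoc]
      simp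
  rw [hp]
  have := Int.odd_iff.1 hd
  have h4 : d % 4 = 1 ∨ d % 4 = 3 := by omega
  unfold eps
  rcases h4 with h4 | h4
  · have h5 : ¬ (-d) % 4 = 1 := by omega
    simp only [h4, h5, if_true, if_false, one_zpow, I_zpow_neg_three]
    split_ifs <;> push_cast <;> ring_nf <;> simp
  · have h5 : (-d) % 4 = 1 := by omega
    simp only [h4, h5, if_true, show ¬ ((3 : ℤ) = 1) by norm_num, if_false, one_zpow,
      I_zpow_neg_three]
    split_ifs <;> push_cast <;> ring

theorem autFactor_translate {c d n : ℤ} (hc0 : c ≠ 0) (hc : 4 ∣ c) (hd0 : 0 < d) (hd : Odd d)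
    (z : ℂ) : autFactor c (d - n * c) (z + n) = autFactor c d z := by
  unfold autFactor
  have he : Odd (d - n * c) := by
    obtain ⟨a, rfl⟩ := hc
    rw [Int.odd_iff] at hd ⊢
    have : n * (4 * a) = 4 * (n * a) := by ring
    omega
  rw [← kron_add_aux hc0 hc hd he ⟨-n, by ring⟩ hd0]
  have : eps (d - n * c) = eps d := by
    unfold eps
    obtain ⟨a, rfl⟩ := hc
    have : (d - n * (4 * a)) % 4 = d % 4 := by
      have : n * (4 * a) = 4 * (n * a) := by ring
      omega
    rw [this]
  rw [this]
  congr 2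
  push_cast; ring

theorem denom_ne_zero {c d : ℤ} (hc0 : c ≠ 0) {z : ℂ} (hz : 0 < z.im) : (c : ℂ) * z + d ≠ 0 := by
  intro h
  have : ((c : ℂ) * z + d).im = c * z.im := by simp
  rw [h, zero_im] at this
  have h2 : (c : ℝ) ≠ 0 := by exact_mod_cast hc0
  exact (mul_ne_zero h2 hz.ne') this.symm

theorem im_div_denom_pos {m : ℤ} {z : ℂ} (hz : 0 < z.im) : 0 < (z / ((m : ℂ) * z + 1)).im := by
  by_cases hm : m = 0
  · simpa [hm] using hz
  have h0 : (m : ℂ) * z + 1 ≠ 0 := by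
    have := denom_ne_zero (d := 1) hm hz
    simpa using this
  have hn : 0 < normSq ((m : ℂ) * z + 1) := normSq_pos.2 h0
  rw [div_im]
  have : z.im * ((m : ℂ) * z + 1).re / normSq ((m : ℂ) * z + 1)
      - z.re * ((m : ℂ) * z + 1).im / normSq ((m : ℂ) * z + 1)
      = z.im / normSq ((m : ℂ) * z + 1) := by
    simp; ring
  rw [this]
  positivity

theorem transform_of_generators (F : ℂ → ℂ) (hT : ∀ z : ℂ, 0 < z.im → F (z + 1) = F z)
    (hV : ∀ z : ℂ, 0 < z.im → F (z / (4 * z + 1)) = (4 * z + 1) ^ ((3 : ℂ) / 2) * F z)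
    (a b c d : ℤ) (hdet : a * d - b * c = 1) (hc : (4 : ℤ) ∣ c) (z : ℂ) (hz : 0 < z.im) :
    F (((a : ℂ) * z + b) / ((c : ℂ) * z + d)) = autFactor c d z * F z := by
  have hTn : ∀ n : ℕ, ∀ z : ℂ, 0 < z.im → F (z + n) = F z := by
    intro n
    induction n with
    | zero => intro z hz; simp
    | succ k ih =>
      intro z hz
      rw [Nat.cast_succ, ← add_assoc, hT _ (by simpa using hz), ih z hz]
  have hTz : ∀ n : ℤ, ∀ z : ℂ, 0 < z.im → F (z + n) = F z := by
    intro n z hz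
    obtain ⟨k, rfl | rfl⟩ := n.eq_nat_or_neg
    · exact_mod_cast hTn k z hz
    · have := hTn k (z + ((-(k : ℤ) : ℤ) : ℂ)) (by simpa using hz)
      rw [← this]; congr 1; push_cast; ring
  have hVn : ∀ z : ℂ, 0 < z.im →
      F (z / (((-4 : ℤ) : ℂ) * z + 1)) = (((-4 : ℤ) : ℂ) * z + 1) ^ ((3 : ℂ) / 2) * F z := by
    intro z hz
    have h0 : ((-4 : ℤ) : ℂ) * z + 1 ≠ 0 := by
      simpa using denom_ne_zero (c := -4) (d := 1) (by norm_num) hz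
    have hw := im_div_denom_pos (m := -4) hz
    have := hV _ hw
    set Y := ((-4 : ℤ) : ℂ) * z + 1 with hY
    have e1 : 4 * (z / Y) + 1 = Y⁻¹ := by
      field_simp; rw [hY]; push_cast; ring
    rw [e1] at this
    have e2 : z / Y / Y⁻¹ = z := by field_simp
    rw [e2] at this
    rw [this, ← mul_assoc]
    have hYim : Y.im < 0 := by rw [hY]; simp [hz]
    have harg : Y.arg ≠ Real.pi := by
      intro h
      have := arg_neg_iff.2 hYim
      linarith [Real.pi_pos]
    rw [inv_cpow _ _ harg, mul_inv_cancel₀, one_mul]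
    rw [cpow_def_of_ne_zero h0]; exact exp_ne_zero _
  have key : ∀ k : ℕ, ∀ a b c d : ℤ, c.natAbs + d.natAbs = k → a * d - b * c = 1 → 4 ∣ c →
      ∀ z : ℂ, 0 < z.im → F (((a : ℂ) * z + b) / ((c : ℂ) * z + d)) = autFactor c d z * F z := by
    intro k
    induction k using Nat.strong_induction_on with
    | _ k ih =>
    have pos : ∀ a b c d : ℤ, c.natAbs + d.natAbs = k → a * d - b * c = 1 → 4 ∣ c → c ≠ 0 →
        Odd d → 0 < d →
      ∀ z : ℂ, 0 < z.im → F (((a : ℂ) * z + b) / ((c : ℂ) * z + d)) = autFactor c d z * F z := by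
      intro a b c d hk hdet hc hc0 hdo hd z hz
      obtain ⟨n, hn, hnc⟩ : ∃ n : ℤ, (n = 1 ∨ n = -1) ∧ n * c = c.natAbs := by
        rcases lt_or_gt_of_ne hc0 with h | h
        · exact ⟨-1, Or.inr rfl, by omega⟩
        · exact ⟨1, Or.inl rfl, by omega⟩
      have hne : (c.natAbs : ℤ) ≠ 2 * d := by
        intro h
        obtain ⟨m, hm⟩ := hdo
        omega
      rcases lt_or_gt_of_ne hne with hlt | hgt
      · have h1 := ih (c.natAbs + (d - n * c).natAbs) (by rw [hnc]; omega) a (b - n * a) c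
          (d - n * c) rfl (by linear_combination hdet) hc (z + n) (by simpa using hz)
        rw [autFactor_translate hc0 hc hd hdo, hTz _ _ hz] at h1
        rw [← h1]
        congr 1
        push_cast
        congr 1 <;> ring
      · set w := z / (((4 * n : ℤ) : ℂ) * z + 1) with hw
        have hwim : 0 < w.im := im_div_denom_pos hz
        have hsz : (c - 4 * n * d).natAbs < c.natAbs := by
          rcases hn with rfl | rfl <;> omega
        have h1 := ih ((c - 4 * n * d).natAbs + d.natAbs) (by omega) (a - 4 * n * b) b
          (c - 4 * n * d) d rfl (by linear_combination hdet)
          (dvd_sub hc ⟨n * d, by ring⟩) w hwim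
        have h4n : 4 * n ≠ 0 := by rcases hn with rfl | rfl <;> norm_num
        have hY0 : ((4 * n : ℤ) : ℂ) * z + 1 ≠ 0 := by
          simpa using denom_ne_zero (d := 1) h4n hz
        have hFw : F w = (((4 * n : ℤ) : ℂ) * z + 1) ^ ((3 : ℂ) / 2) * F z := by
          rcases hn with rfl | rfl
          · rw [hw]; simpa using hV z hz
          · rw [hw]; simpa using hVn z hz
        set Y := ((4 * n : ℤ) : ℂ) * z + 1 with hY
        have hXY : (((c - 4 * n * d : ℤ) : ℂ) * w + d) * Y = (c : ℂ) * z + d := by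
          rw [hw, add_mul, mul_assoc, div_mul_cancel₀ _ hY0, hY]; push_cast; ring
        have hnum : (((a - 4 * n * b : ℤ) : ℂ) * w + b) * Y = (a : ℂ) * z + b := by
          rw [hw, add_mul, mul_assoc, div_mul_cancel₀ _ hY0, hY]; push_cast; ring
        rw [← hXY, ← hnum, mul_div_mul_right _ _ hY0, h1, hFw]
        unfold autFactor
        rw [← hXY, kron_mod_left (c := c - 4 * n * d) (c' := c) hd ⟨4 * n, by ring⟩]
        have : ((((c - 4 * n * d : ℤ) : ℂ) * w + d) * Y) ^ ((3 : ℂ) / 2) =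
            (((c - 4 * n * d : ℤ) : ℂ) * w + d) ^ ((3 : ℂ) / 2) * Y ^ ((3 : ℂ) / 2) := by
          have him : (((c - 4 * n * d : ℤ) : ℂ) * w + d) * Y = (c : ℂ) * z + d := hXY
          have him' : ((c : ℂ) * z + d).im = c * z.im := by simp
          have hYim : Y.im = 4 * n * z.im := by rw [hY]; simp
          rcases hn with rfl | rfl
          · apply cpow_mul_of_pos
            · rw [hYim]; push_cast; linarith
            · rw [him, him']
              have : (0 : ℝ) < c := by
                have : 0 < c := by omega
                exact_mod_cast this
              positivity
          · apply cpow_mul_of_neg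
            · rw [hYim]; push_cast; linarith
            · rw [him, him']
              have : (c : ℝ) < 0 := by
                have : c < 0 := by omega
                exact_mod_cast this
              nlinarith
        rw [this]; ring
    intro a b c d hk hdet hc z hz
    have hdo : Odd d := by
      by_contra h
      rw [Int.not_odd_iff_even] at h
      obtain ⟨m, rfl⟩ := h
      obtain ⟨e, rfl⟩ := hc
      have : a * (m + m) - b * (4 * e) = 2 * (a * m - 2 * b * e) := by ring
      omega
    by_cases hc0 : c = 0
    · subst hc0
      simp only [mul_zero, sub_zero] at hdet
      rcases Int.eq_one_or_neg_one_of_mul_eq_one' hdet with ⟨rfl, rfl⟩ | ⟨rfl, rfl⟩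
      · have := hTz b z hz
        simpa [autFactor, kron, eps] using this
      · have := hTz (-b) z hz
        have e1 : ((-1 : ℤ) * z + b) / (((0 : ℤ) : ℂ) * z + (-1 : ℤ)) = z + ((-b : ℤ) : ℂ) := by
          push_cast; ring
        rw [e1, this]
        have e2 : autFactor 0 (-1) z = 1 := by
          have h3 : ((-1 : ℂ)) ^ ((3 : ℂ) / 2) = -I := by
            rw [cpow_def_of_ne_zero (by norm_num), log_neg_one]
            have : (Real.pi : ℂ) * I * (3 / 2) = -(Real.pi / 2 : ℂ) * I + 2 * Real.pi * I := by
              ring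
            rw [this, Complex.exp_periodic, neg_mul, Complex.exp_neg, exp_pi_div_two_mul_I]
            simp
          have h5 : ((0 : ℤ) : ℂ) * z + ((-1 : ℤ) : ℂ) = -1 := by simp
          unfold autFactor kron eps
          rw [h5, h3]
          simp
        rw [e2, one_mul]
    rcases lt_or_gt_of_ne (show d ≠ 0 by rintro rfl; simp at hdo) with hd | hd
    · have h1 := pos (-a) (-b) (-c) (-d) (by simpa using hk) (by linear_combination hdet)
        (by simpa using hc) (by simpa using hc0) hdo.neg (by omega) z hz
      have h2 := autFactor_neg_neg (c := -c) (d := -d) (by simpa using hc0) (by omega) hdo.neg hz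
      rw [neg_neg, neg_neg] at h2
      rw [h2, ← h1]
      congr 1
      push_cast
      rw [← neg_div_neg_eq]
      congr 1 <;> ring
    · exact pos a b c d hk hdet hc hc0 hdo hd z hz
  exact key _ a b c d rfl hdet hc z hz

theorem actForm_comp (p q r s p' q' r' s' : ℤ) (f : ℤ × ℤ × ℤ) :
    actForm p' q' r' s' (actForm p q r s f) =
      actForm (p * p' + q * r') (p * q' + q * s') (r * p' + s * r') (r * q' + s * s') f := by
  unfold actForm
  ext <;> simp <;> ring

theorem actForm_one (f : ℤ × ℤ × ℤ) : actForm 1 0 0 1 f = f := by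
  unfold actForm; ext <;> simp

theorem formRel_equivalence (N : ℕ) : Equivalence (formRel N) where
  refl f := ⟨1, 0, 0, 1, by norm_num, (actForm_one _).symm⟩
  symm := by
    rintro f g ⟨p, q, r, s, h, hg⟩
    refine ⟨s, -q, -r, p, by linear_combination h, ?_⟩
    rw [hg, actForm_comp]
    have e1 : p * s + q * -r = 1 := by linear_combination h
    have e2 : p * -q + q * p = 0 := by ring
    have e3 : r * s + s * -r = 0 := by ring
    have e4 : r * -q + s * p = 1 := by linear_combination h
    rw [e1, e2, e3, e4, actForm_one]
  trans := by
    rintro f g k ⟨p, q, r, s, h, hg⟩ ⟨p', q', r', s', h', hk⟩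
    refine ⟨_, _, _, _, ?_, by rw [hk, hg, actForm_comp]⟩
    linear_combination h * (p' * s' - q' * r') + h'

theorem formClass_eq_iff {N : ℕ} {f g : PosDefForm N} :
    Quot.mk (formRel N) f = Quot.mk (formRel N) g ↔ formRel N f g := by
  rw [Quot.eq, (formRel_equivalence N).eqvGen_iff]

/-- Reduced binary quadratic forms. -/
def IsReducedForm (f : ℤ × ℤ × ℤ) : Prop := |f.2.1| ≤ f.1 ∧ f.1 ≤ f.2.2

theorem PosDefForm.c_pos {N : ℕ} (hN : N ≠ 0) (f : PosDefForm N) : 0 < f.val.2.2 := by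
  obtain ⟨⟨a, b, c⟩, ha, hd⟩ := f
  simp only at ha hd ⊢
  by_contra! h
  have : (0 : ℤ) < N := by omega
  nlinarith [mul_nonneg ha.le (neg_nonneg.2 h), sq_nonneg b]

/-- Move a form by a matrix of determinant one. -/
theorem exists_act {N : ℕ} (f : PosDefForm N) (p q r s : ℤ) (h : p * s - q * r = 1)
    (hpos : 0 < (actForm p q r s f.val).1) :
    ∃ g : PosDefForm N, g.val = actForm p q r s f.val ∧ formRel N f g := by
  refine ⟨⟨actForm p q r s f.val, hpos, ?_⟩, rfl, p, q, r, s, h, rfl⟩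
  have := f.property.2
  unfold actForm
  simp only
  linear_combination (p * s - q * r) ^ 2 * this - (N : ℤ) * (p * s - q * r + 1) * h

theorem exists_reduced {N : ℕ} (hN : N ≠ 0) (f : PosDefForm N) :
    ∃ g : PosDefForm N, formRel N f g ∧ IsReducedForm g.val := by
  have hE := formRel_equivalence N
  obtain ⟨g, hg, hmin⟩ := WellFounded.has_min
    (InvImage.wf (fun g : PosDefForm N => g.val.1.toNat) Nat.lt_wfRel.wf)
    {g | formRel N f g} ⟨f, hE.refl f⟩
  have hmin' : ∀ k : PosDefForm N, formRel N f k → g.val.1 ≤ k.val.1 := by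
    intro k hk
    have h1 := hmin k hk
    have h2 := g.property.1
    have h3 := k.property.1
    have h4 : ¬ (k.val.1.toNat < g.val.1.toNat) := h1
    omega
  have ha := g.property.1
  set a := g.val.1 with ha'
  set b := g.val.2.1 with hb'
  set q := -((b + a) / (2 * a)) with hq
  have hdm := Int.emod_add_mul_ediv (b + a) (2 * a)
  have hm0 := Int.emod_nonneg (b + a) (show 2 * a ≠ 0 by omega)
  have hm1 := Int.emod_lt_of_pos (b + a) (show 0 < 2 * a by omega)
  obtain ⟨k, hk, hgk⟩ := exists_act g 1 q 0 1 (by ring) (by simpa [actForm] using ha)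
  have hka : k.val.1 = a := by rw [hk]; simp [actForm, ha']
  have hkb : k.val.2.1 = b + 2 * a * q := by rw [hk]; simp [actForm, ha', hb']; ring
  have hkr := hE.trans hg hgk
  refine ⟨k, hkr, ?_, ?_⟩
  · rw [hka, hkb, abs_le]
    have : b + 2 * a * q = (b + a) % (2 * a) - a := by
      rw [hq]; linear_combination -hdm
    rw [this]; constructor <;> omega
  · have hc := k.c_pos hN
    obtain ⟨l, hl, hkl⟩ := exists_act k 0 (-1) 1 0 (by ring) (by simpa [actForm] using hc)
    have := hmin' l (hE.trans hkr hkl)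
    rw [hl] at this
    rw [hka]
    simpa [actForm] using this

theorem reduced_value_ge {a b c p r : ℤ} (ha : 0 < a) (hb : |b| ≤ a) (hc : a ≤ c)
    (h : p ≠ 0 ∨ r ≠ 0) : a ≤ a * p ^ 2 + b * p * r + c * r ^ 2 := by
  have h1 : -(a * |p * r|) ≤ b * p * r := by
    have : |b * (p * r)| ≤ a * |p * r| := by
      rw [abs_mul]; exact mul_le_mul_of_nonneg_right hb (abs_nonneg _)
    have := (abs_le.1 this).1
    linarith [mul_assoc b p r]
  have h2 : a * r ^ 2 ≤ c * r ^ 2 := mul_le_mul_of_nonneg_right hc (sq_nonneg r)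
  have h3 : 1 ≤ p ^ 2 - |p * r| + r ^ 2 := by
    rw [abs_mul, ← sq_abs p, ← sq_abs r]
    have hp := abs_nonneg p
    have hr := abs_nonneg r
    have : 0 < |p| ∨ 0 < |r| := h.imp abs_pos.2 abs_pos.2
    have hh : 0 < |p| ^ 2 - |p| * |r| + |r| ^ 2 := by
      rcases this with h | h
      · nlinarith [sq_nonneg (|p| - 2 * |r|), pow_pos h 2]
      · nlinarith [sq_nonneg (2 * |p| - |r|), pow_pos h 2]
    linarith
  nlinarith

theorem PosDefForm.ext_of {N : ℕ} {f g : PosDefForm N} (h1 : g.val.1 = f.val.1)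
    (h2 : g.val.2.1 = f.val.2.1) (h3 : g.val.2.2 = f.val.2.2) : g = f :=
  Subtype.ext (Prod.ext h1 (Prod.ext h2 h3))

theorem reduced_unique_aux {N : ℕ} {f g : PosDefForm N} (hf : IsReducedForm f.val) (h : formRel N f g) : f.val.1 ≤ g.val.1 := by
  obtain ⟨p, q, r, s, hdet, hact⟩ := h
  rw [hact]
  apply reduced_value_ge f.property.1 hf.1 hf.2
  by_contra! h0
  rw [h0.1, h0.2] at hdet
  simp at hdet

theorem reduced_unique {N : ℕ} {f g : PosDefForm N} (hf : IsReducedForm f.val)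
    (hg : IsReducedForm g.val) (h : formRel N f g) :
    g.val.1 = f.val.1 ∧ g.val.2.2 = f.val.2.2 ∧ (g.val.2.1 = f.val.2.1 ∨
      (g.val.2.1 = -f.val.2.1 ∧ (|f.val.2.1| = f.val.1 ∨ f.val.1 = f.val.2.2))) := by
  have haa : g.val.1 = f.val.1 := le_antisymm
    (reduced_unique_aux hg ((formRel_equivalence N).symm h)) (reduced_unique_aux hf h)
  obtain ⟨p, q, r, s, hdet, hact⟩ := h
  obtain ⟨⟨a, b, c⟩, ha, hd⟩ := f
  obtain ⟨⟨a', b', c'⟩, ha', hd'⟩ := g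
  obtain ⟨hb, hac⟩ := hf
  obtain ⟨hb', hac'⟩ := hg
  simp only [actForm, Prod.mk.injEq] at *
  subst haa
  obtain ⟨e1, e2, e3⟩ := hact
  rw [abs_le] at hb hb'
  have main : b' = b ∨ (b' = -b ∧ (|b| = a' ∨ a' = c)) := by
    by_cases hr : r = 0
    · subst hr
      have hps : p * s = 1 := by linarith
      have e4 : b' = b + 2 * a' * (p * q) := by rw [e2]; linear_combination b * hps
      generalize p * q = t at e4
      have ht1 : -1 ≤ t := by nlinarith
      have ht2 : t ≤ 1 := by nlinarith
      have : t = -1 ∨ t = 0 ∨ t = 1 := by omega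
      rcases this with rfl | rfl | rfl
      · right
        refine ⟨by linarith, Or.inl ?_⟩
        rw [abs_eq (by linarith)]; left; linarith
      · left; linarith
      · right
        refine ⟨by linarith, Or.inl ?_⟩
        rw [abs_eq (by linarith)]; right; linarith
    by_cases hp : p = 0
    · subst hp
      have hqr : q * r = -1 := by linarith
      have hr2 : r ^ 2 = 1 := by
        have : r ∣ 1 := ⟨-q, by linarith⟩
        rcases Int.isUnit_iff.1 (isUnit_of_dvd_one this) with h | h <;> rw [h] <;> norm_num
      have hca : c = a' := by rw [hr2] at e1; linarith
      have e4 : b' = -b + 2 * a' * (r * s) := by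
        rw [e2, hca]; linear_combination b * hqr
      generalize r * s = t at e4
      have ht1 : -1 ≤ t := by nlinarith
      have ht2 : t ≤ 1 := by nlinarith
      have : t = -1 ∨ t = 0 ∨ t = 1 := by omega
      rcases this with rfl | rfl | rfl
      · left; linarith
      · right; exact ⟨by linarith, Or.inr hca.symm⟩
      · left; linarith
    · -- here equality forces `|b| = a = c`
      have hr1 : 1 ≤ |r| := Int.one_le_abs hr
      have hp1 : 1 ≤ |p| := Int.one_le_abs hp
      have hbb : |b| ≤ a' := abs_le.2 hb
      have h1 : -(|b| * (|p| * |r|)) ≤ b * p * r := by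
        have := neg_abs_le (b * p * r)
        rwa [abs_mul, abs_mul, mul_assoc] at this
      have hpr : 1 ≤ |p| * |r| := by nlinarith
      have h2 : |p| * |r| ≤ |p| ^ 2 + |r| ^ 2 - 1 := by nlinarith [sq_nonneg (|p| - |r|)]
      rw [← sq_abs p, ← sq_abs r] at e1
      have hca : c = a' := by
        by_contra hne
        have : a' + 1 ≤ c := by omega
        nlinarith [mul_le_mul_of_nonneg_right hbb (show 0 ≤ |p| * |r| by positivity)]
      have hba : |b| = a' := by
        by_contra hne
        have : |b| + 1 ≤ a' := by omega
        nlinarith [mul_le_mul_of_nonneg_right this (show 0 ≤ |p| * |r| by positivity)]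
      have hb2 : b ^ 2 = a' ^ 2 := by rw [← sq_abs, hba]
      have hN : (N : ℤ) = 3 * a' ^ 2 := by rw [hca] at hd; linarith
      have : a' ^ 2 ≤ b' ^ 2 := by nlinarith
      have hb'2 : b' ^ 2 = b ^ 2 := by
        apply le_antisymm _ (by linarith)
        rw [hb2]; exact sq_le_sq' (by linarith) (by linarith)
      rcases sq_eq_sq_iff_eq_or_eq_neg.1 hb'2 with h | h
      · exact Or.inl h
      · exact Or.inr ⟨h, Or.inl hba⟩
  refine ⟨rfl, ?_, main⟩
  have hbb : b' ^ 2 = b ^ 2 := by rcases main with h | ⟨h, -⟩ <;> rw [h]; ring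
  have : a' * c' = a' * c := by linarith
  exact mul_left_cancel₀ ha'.ne' this

/-- The opposite form. -/
def PosDefForm.opp {N : ℕ} (f : PosDefForm N) : PosDefForm N :=
  ⟨(f.val.1, -f.val.2.1, f.val.2.2), f.property.1, by simpa using f.property.2⟩

theorem formRel_opp {N : ℕ} {f : PosDefForm N}
    (h : |f.val.2.1| = f.val.1 ∨ f.val.1 = f.val.2.2) : formRel N f f.opp := by
  rcases h with h | h
  · rcases (abs_eq f.property.1.le).1 h with h | h
    · refine ⟨1, -1, 0, 1, by norm_num, ?_⟩
      unfold PosDefForm.opp actForm; simp only [h]; ext <;> simp; ring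
    · refine ⟨1, 1, 0, 1, by norm_num, ?_⟩
      unfold PosDefForm.opp actForm; simp only [h]; ext <;> simp; ring
  · refine ⟨0, -1, 1, 0, by norm_num, ?_⟩
    unfold PosDefForm.opp actForm; simp only [h]; ext <;> simp

/-- The number of permutations divided by the order of the stabilizer of a sorted triple,
and zero on unsorted triples. -/
def sortWt (p r s : ℤ) : ℝ :=
  if p ≤ r ∧ r ≤ s then
    (if p = r then (if r = s then 1 else 3) else (if r = s then 3 else 6))
  else 0

/-- The weight of a form attached to the triple `(|b|, 2 a - |b|, 2 c - |b|)`. -/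
def formWt (f : ℤ × ℤ × ℤ) : ℝ := sortWt |f.2.1| (2 * f.1 - |f.2.1|) (2 * f.2.2 - |f.2.1|)

theorem formWt_eq_zero {f : ℤ × ℤ × ℤ} (h : ¬ IsReducedForm f) : formWt f = 0 := by
  unfold formWt sortWt
  rw [if_neg]
  unfold IsReducedForm at h
  omega

theorem formWt_eq_of_reduced {f : ℤ × ℤ × ℤ} (h : IsReducedForm f) : formWt f =
    if |f.2.1| = f.1 then (if f.1 = f.2.2 then 1 else 3) else (if f.1 = f.2.2 then 3 else 6) := by
  unfold formWt sortWt
  unfold IsReducedForm at h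
  rw [if_pos (by omega)]
  have e1 : (|f.2.1| = 2 * f.1 - |f.2.1|) = (|f.2.1| = f.1) := by apply propext; omega
  have e2 : (2 * f.1 - |f.2.1| = 2 * f.2.2 - |f.2.1|) = (f.1 = f.2.2) := by apply propext; omega
  simp only [e1, e2]

theorem finite_reduced (N : ℕ) : {f : PosDefForm N | IsReducedForm f.val}.Finite := by
  apply Set.Finite.of_finite_image (f := fun f => f.val) _ Subtype.val_injective.injOn
  apply Set.Finite.subset (Set.Finite.prod (Set.finite_Icc (-(N : ℤ)) N)
    (Set.Finite.prod (Set.finite_Icc (-(N : ℤ)) N) (Set.finite_Icc (-(N : ℤ)) N)))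
  rintro _ ⟨⟨⟨a, b, c⟩, ha, hd⟩, ⟨hb, hac⟩, rfl⟩
  simp only [Set.mem_prod, Set.mem_Icc] at *
  have hb2 : b ^ 2 ≤ a ^ 2 := by rw [← sq_abs]; exact pow_le_pow_left₀ (abs_nonneg b) hb 2
  rw [abs_le] at hb
  have h1 : 3 * (a * c) ≤ N := by nlinarith
  have h2 : c ≤ a * c := by nlinarith
  refine ⟨⟨?_, ?_⟩, ⟨?_, ?_⟩, ?_, ?_⟩ <;> nlinarith

open scoped Classical in
theorem classWeight_eq_sum {N : ℕ} (hN : N ≠ 0) (Q : FormClass N) :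
    6 * classWeight N Q =
      ∑ f ∈ (finite_reduced N).toFinset with Quot.mk (formRel N) f = Q, formWt f.val := by
  have hE := formRel_equivalence N
  obtain ⟨f, rfl, hf⟩ : ∃ f : PosDefForm N, Quot.mk (formRel N) f = Q ∧ IsReducedForm f.val := by
    induction Q using Quot.ind with
    | _ f =>
      obtain ⟨g, hg, hr⟩ := exists_reduced hN f
      exact ⟨g, (formClass_eq_iff.2 hg).symm, hr⟩
  have hfa := f.property.1
  have hw1 : (∃ k : PosDefForm N, Quot.mk (formRel N) k = Quot.mk (formRel N) f ∧
      ∃ lam : ℤ, k.val = (lam, 0, lam)) ↔ f.val.2.1 = 0 ∧ f.val.1 = f.val.2.2 := by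
    constructor
    · rintro ⟨k, hk, lam, hl⟩
      have hk0 := k.property.1
      rw [hl] at hk0
      have hkr : IsReducedForm k.val := by rw [hl]; simpa [IsReducedForm] using hk0.le
      have := reduced_unique hkr hf (formClass_eq_iff.1 hk)
      rw [hl] at this
      simp at this
      omega
    · rintro ⟨h1, h2⟩
      exact ⟨f, rfl, f.val.1, Prod.ext rfl (Prod.ext h1 h2.symm)⟩
  have hw2 : (∃ k : PosDefForm N, Quot.mk (formRel N) k = Quot.mk (formRel N) f ∧
      ∃ lam : ℤ, k.val = (lam, lam, lam)) ↔ |f.val.2.1| = f.val.1 ∧ f.val.1 = f.val.2.2 := by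
    constructor
    · rintro ⟨k, hk, lam, hl⟩
      have hk0 := k.property.1
      rw [hl] at hk0
      have hkr : IsReducedForm k.val := by
        rw [hl]; simpa [IsReducedForm] using (abs_of_pos hk0).le
      have := reduced_unique hkr hf (formClass_eq_iff.1 hk)
      rw [hl] at this
      simp only at this hk0
      obtain ⟨h1, h2, h3⟩ := this
      refine ⟨?_, by omega⟩
      rw [abs_eq hfa.le]
      omega
    · rintro ⟨h1, h2⟩
      rcases (abs_eq hfa.le).1 h1 with h | h
      · exact ⟨f, rfl, f.val.1, Prod.ext rfl (Prod.ext h h2.symm)⟩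
      · refine ⟨f.opp, (formClass_eq_iff.2 (formRel_opp (Or.inl h1))).symm, f.val.1,
          Prod.ext rfl (Prod.ext ?_ h2.symm)⟩
        simp [PosDefForm.opp, h]
  by_cases hface : |f.val.2.1| = f.val.1 ∨ f.val.1 = f.val.2.2
  · have hset : (finite_reduced N).toFinset.filter
        (fun g => Quot.mk (formRel N) g = Quot.mk (formRel N) f) = {f, f.opp} := by
      ext g
      simp only [Finset.mem_filter, Set.Finite.mem_toFinset, Set.mem_ofPred_eq, Finset.mem_insert,
        Finset.mem_singleton]
      constructor
      · rintro ⟨hg, hgf⟩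
        obtain ⟨h1, h2, h3⟩ := reduced_unique hf hg (hE.symm (formClass_eq_iff.1 hgf))
        rcases h3 with h3 | ⟨h3, -⟩
        · exact Or.inl (PosDefForm.ext_of h1 h3 h2)
        · exact Or.inr (PosDefForm.ext_of h1 h3 h2)
      · rintro (rfl | rfl)
        · exact ⟨hf, rfl⟩
        · refine ⟨?_, (formClass_eq_iff.2 (formRel_opp hface)).symm⟩
          simpa [IsReducedForm, PosDefForm.opp] using hf
    rw [hset]
    have hwo : formWt f.opp.val = formWt f.val := by simp [formWt, PosDefForm.opp]
    unfold classWeight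
    simp only [hw1, hw2]
    by_cases hb : f.val.2.1 = 0
    · have hopp : f.opp = f := PosDefForm.ext_of rfl (by simp [PosDefForm.opp, hb]) rfl
      have : ¬ |f.val.2.1| = f.val.1 := by rw [hb, abs_zero]; exact hfa.ne
      have hac := hface.resolve_left this
      rw [if_pos ⟨hb, hac⟩, hopp, Finset.pair_eq_singleton, Finset.sum_singleton,
        formWt_eq_of_reduced hf, if_neg this, if_pos hac]
      norm_num
    · have hopp : f ≠ f.opp := by
        intro h
        have := congrArg (fun k : PosDefForm N => k.val.2.1) h
        simp [PosDefForm.opp] at this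
        omega
      rw [if_neg (fun h => hb h.1), Finset.sum_pair hopp, hwo, formWt_eq_of_reduced hf]
      split_ifs <;> first | tauto | norm_num
  · push Not at hface
    have hset : (finite_reduced N).toFinset.filter
        (fun g => Quot.mk (formRel N) g = Quot.mk (formRel N) f) = {f} := by
      ext g
      simp only [Finset.mem_filter, Set.Finite.mem_toFinset, Set.mem_ofPred_eq,
        Finset.mem_singleton]
      constructor
      · rintro ⟨hg, hgf⟩
        obtain ⟨h1, h2, h3⟩ := reduced_unique hf hg (hE.symm (formClass_eq_iff.1 hgf))
        exact PosDefForm.ext_of h1 (by tauto) h2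
      · rintro rfl
        exact ⟨hf, rfl⟩
    rw [hset, Finset.sum_singleton, formWt_eq_of_reduced hf]
    unfold classWeight
    simp only [hw1, hw2]
    simp [hface.1, hface.2]

theorem six_mul_hurwitzH {N : ℕ} (hN : N ≠ 0) :
    HasSum (fun f : PosDefForm N => formWt f.val) (6 * hurwitzH N) := by
  classical
  have hsum : HasSum (fun f : PosDefForm N => formWt f.val)
      (∑ f ∈ (finite_reduced N).toFinset, formWt f.val) := by
    apply hasSum_sum_of_ne_finset_zero
    intro f hf
    apply formWt_eq_zero
    simpa using hf
  convert hsum using 1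
  unfold hurwitzH
  rw [if_neg hN]
  split_ifs with h
  · have : IsEmpty (PosDefForm N) := by
      constructor
      rintro ⟨⟨a, b, c⟩, ha, hd⟩
      simp only at hd
      rcases Int.even_or_odd' b with ⟨k, rfl | rfl⟩
      · have : (2 * k) ^ 2 - 4 * a * c = 4 * (k ^ 2 - a * c) := by ring
        omega
      · have : (2 * k + 1) ^ 2 - 4 * a * c = 4 * (k ^ 2 + k - a * c) + 1 := by ring
        omega
    rw [mul_zero, Finset.eq_empty_of_isEmpty (finite_reduced N).toFinset, Finset.sum_empty]
  · have hfin : Finite (FormClass N) := by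
      have : Finite {f : PosDefForm N | IsReducedForm f.val} := (finite_reduced N)
      apply Finite.of_surjective
        (fun f : {f : PosDefForm N | IsReducedForm f.val} => (Quot.mk (formRel N) f.val))
      intro Q
      induction Q using Quot.ind with
      | _ f =>
        obtain ⟨g, hg, hr⟩ := exists_reduced hN f
        exact ⟨⟨g, hr⟩, (formClass_eq_iff.2 hg).symm⟩
    have := Fintype.ofFinite (FormClass N)
    rw [tsum_fintype, Finset.mul_sum]
    have hfib := Finset.sum_fiberwise (finite_reduced N).toFinset
      (fun f => (id (Quot.mk (formRel N) f) : FormClass N)) (fun f => formWt f.val)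
    rw [← hfib]
    exact Finset.sum_congr rfl fun Q _ => classWeight_eq_sum hN Q

/-- Minus the discriminant of a form, as a natural number. -/
def negDisc (f : ℤ × ℤ × ℤ) : ℕ := (4 * f.1 * f.2.2 - f.2.1 ^ 2).toNat

/-- The cone of forms with `|b| < 2 min(a, c)`. -/
def inCone (f : ℤ × ℤ × ℤ) : Prop := |f.2.1| < 2 * f.1 ∧ |f.2.1| < 2 * f.2.2

instance : DecidablePred inCone := fun f => by unfold inCone; infer_instance

theorem negDisc_bound {f : ℤ × ℤ × ℤ} (h : inCone f) :
    |f.1| + |f.2.1| + |f.2.2| ≤ 2 * (4 * f.1 * f.2.2 - f.2.1 ^ 2) := by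
  obtain ⟨a, b, c⟩ := f
  obtain ⟨h1, h2⟩ := h
  simp only at *
  have hb := abs_nonneg b
  rw [abs_of_pos (show 0 < a by omega), abs_of_pos (show 0 < c by omega), ← sq_abs b]
  generalize |b| = p at *
  obtain ⟨r, hr⟩ : ∃ r, r = 2 * a - p := ⟨_, rfl⟩
  obtain ⟨s, hs⟩ : ∃ s, s = 2 * c - p := ⟨_, rfl⟩
  have hr1 : 1 ≤ r := by omega
  have hs1 : 1 ≤ s := by omega
  have : 4 * a * c - p ^ 2 = p * r + p * s + r * s := by rw [hr, hs]; ring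
  nlinarith [mul_nonneg hb (sub_nonneg.2 hr1), mul_nonneg hb (sub_nonneg.2 hs1),
    mul_nonneg (sub_nonneg.2 hr1) (sub_nonneg.2 hs1)]

theorem negDisc_cast {f : ℤ × ℤ × ℤ} (h : inCone f) :
    (negDisc f : ℤ) = 4 * f.1 * f.2.2 - f.2.1 ^ 2 := by
  have := negDisc_bound h
  have h1 := abs_nonneg f.1
  have h2 := abs_nonneg f.2.1
  have h3 := abs_nonneg f.2.2
  unfold negDisc
  rw [Int.toNat_of_nonneg (by linarith)]

theorem negDisc_pos {f : ℤ × ℤ × ℤ} (h : inCone f) : 0 < negDisc f := by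
  have := negDisc_bound h
  have h1 : 0 < f.1 := by have := h.1; have := abs_nonneg f.2.1; omega
  have h1 := abs_pos_of_pos h1
  have h2 := abs_nonneg f.2.1
  have h3 := abs_nonneg f.2.2
  have := negDisc_cast h
  omega

theorem summable_pow_natAbs {y : ℝ} (h0 : 0 ≤ y) (h1 : y < 1) :
    Summable fun n : ℤ => y ^ n.natAbs := by
  apply Summable.of_nat_of_neg
  · simpa using summable_geometric_of_lt_one h0 h1
  · simpa using summable_geometric_of_lt_one h0 h1

theorem summable_cone {h : ℕ → ℝ} {x : ℝ} (hx0 : 0 ≤ x) (hx1 : x < 1)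
    (hh : ∀ N, |h N| ≤ x ^ N) :
    Summable fun f : ℤ × ℤ × ℤ => if inCone f then h (negDisc f) else 0 := by
  set y := Real.sqrt x with hy
  have hy0 : 0 ≤ y := Real.sqrt_nonneg x
  have hy1 : y < 1 := by rw [hy, Real.sqrt_lt' one_pos]; simpa using hx1
  have hs := summable_pow_natAbs hy0 hy1
  have hnn : (0 : ℤ → ℝ) ≤ fun n : ℤ => y ^ n.natAbs := fun n => by positivity
  have hs2 := hs.mul_of_nonneg hs hnn hnn
  have hs3 := hs.mul_of_nonneg hs2 hnn (fun n => by simp only [Pi.zero_apply]; positivity)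
  apply Summable.of_norm_bounded hs3
  intro f
  split_ifs with hf
  · rw [Real.norm_eq_abs]
    refine (hh _).trans ?_
    have : x = y ^ 2 := (Real.sq_sqrt hx0).symm
    rw [this, ← pow_mul, ← pow_add, ← pow_add]
    apply pow_le_pow_of_le_one hy0 hy1.le
    have h1 := negDisc_bound hf
    have h2 := negDisc_cast hf
    rw [← h2, Int.abs_eq_natAbs, Int.abs_eq_natAbs, Int.abs_eq_natAbs] at h1
    omega
  · simp only [norm_zero]; positivity

theorem sortWt_nonneg (p r s : ℤ) : 0 ≤ sortWt p r s := by
  unfold sortWt; split_ifs <;> norm_num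

theorem sortWt_le (p r s : ℤ) : sortWt p r s ≤ 6 := by
  unfold sortWt; split_ifs <;> norm_num

theorem sortWt_sum (p r s : ℤ) : sortWt p r s + sortWt p s r + sortWt r p s + sortWt r s p +
    sortWt s p r + sortWt s r p = 6 := by
  unfold sortWt
  rcases lt_trichotomy p r with h1 | h1 | h1 <;> rcases lt_trichotomy r s with h2 | h2 | h2 <;>
    rcases lt_trichotomy p s with h3 | h3 | h3 <;> first
    | omega
    | simp [h1.le, h2.le, h3.le, h1.not_ge, h2.not_ge, h3.not_ge, h1.ne, h2.ne, h3.ne]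
    | (subst h1; simp [h2.le, h2.not_ge, h2.ne]; norm_num)
    | (subst h2; simp [h1.le, h1.not_ge, h1.ne]; norm_num)
    | (subst h3; simp [h1.le, h1.not_ge, h1.ne]; norm_num)
    | (subst h1; subst h2; simp; norm_num)

/-- Exchange of `a` and `c`. -/
def swapOuter : Equiv.Perm (ℤ × ℤ × ℤ) :=
  Function.Involutive.toPerm (fun f => (f.2.2, f.2.1, f.1)) (fun _ => rfl)

/-- Exchange of `p = b` and `r = 2 a - b`. -/
def swapInner : Equiv.Perm (ℤ × ℤ × ℤ) :=
  Function.Involutive.toPerm (fun f => (f.1, 2 * f.1 - f.2.1, f.1 + f.2.2 - f.2.1))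
    (fun f => by ext <;> (simp; try ring))

/-- Change of sign of `b`. -/
def negMiddle : Equiv.Perm (ℤ × ℤ × ℤ) :=
  Function.Involutive.toPerm (fun f => (f.1, -f.2.1, f.2.2)) (fun f => by ext <;> simp)

theorem tsum_sortWt_symm (A : ℤ × ℤ × ℤ → ℝ) (hA : Summable A)
    (h1 : ∀ f, A (swapOuter f) = A f) (h2 : ∀ f, A (swapInner f) = A f) :
    ∑' f : ℤ × ℤ × ℤ, A f * sortWt f.2.1 (2 * f.1 - f.2.1) (2 * f.2.2 - f.2.1) = ∑' f, A f := by
  set W : (ℤ → ℤ → ℤ → ℝ) → ℝ := fun w =>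
    ∑' f : ℤ × ℤ × ℤ, A f * w f.2.1 (2 * f.1 - f.2.1) (2 * f.2.2 - f.2.1) with hW
  have e1 : ∀ w, W w = W (fun p r s => w p s r) := by
    intro w
    rw [hW]; simp only
    rw [← swapOuter.tsum_eq]
    refine tsum_congr fun f => ?_
    rw [h1]; rfl
  have e2 : ∀ w, W w = W (fun p r s => w r p s) := by
    intro w
    rw [hW]; simp only
    rw [← swapInner.tsum_eq]
    refine tsum_congr fun f => ?_
    rw [h2]
    have : (swapInner f) = (f.1, 2 * f.1 - f.2.1, f.1 + f.2.2 - f.2.1) := rfl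
    rw [this]
    simp only
    congr 2 <;> ring
  have hs : ∀ w : ℤ × ℤ × ℤ → ℤ × ℤ × ℤ, Summable fun f : ℤ × ℤ × ℤ =>
      A f * sortWt (w f).1 (w f).2.1 (w f).2.2 := by
    intro w
    apply Summable.of_norm_bounded (hA.norm.mul_right 6)
    intro f
    rw [norm_mul]
    apply mul_le_mul_of_nonneg_left _ (norm_nonneg _)
    rw [Real.norm_eq_abs, abs_of_nonneg (sortWt_nonneg _ _ _)]
    exact sortWt_le _ _ _
  have hsum : W sortWt + W (fun p r s => sortWt p s r) + W (fun p r s => sortWt r p s) +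
      W (fun p r s => sortWt r s p) + W (fun p r s => sortWt s p r) +
      W (fun p r s => sortWt s r p) = 6 * ∑' f, A f := by
    rw [hW]; simp only
    have t1 := hs fun f => (f.2.1, (2 * f.1 - f.2.1), (2 * f.2.2 - f.2.1))
    have t2 := hs fun f => (f.2.1, (2 * f.2.2 - f.2.1), (2 * f.1 - f.2.1))
    have t3 := hs fun f => ((2 * f.1 - f.2.1), f.2.1, (2 * f.2.2 - f.2.1))
    have t4 := hs fun f => ((2 * f.1 - f.2.1), (2 * f.2.2 - f.2.1), f.2.1)
    have t5 := hs fun f => ((2 * f.2.2 - f.2.1), f.2.1, (2 * f.1 - f.2.1))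
    have t6 := hs fun f => ((2 * f.2.2 - f.2.1), (2 * f.1 - f.2.1), f.2.1)
    simp only at t1 t2 t3 t4 t5 t6
    rw [← t1.tsum_add t2, ← (t1.add t2).tsum_add t3, ← ((t1.add t2).add t3).tsum_add t4,
      ← (((t1.add t2).add t3).add t4).tsum_add t5,
      ← ((((t1.add t2).add t3).add t4).add t5).tsum_add t6, ← tsum_mul_left]
    refine tsum_congr fun f => ?_
    rw [← mul_add, ← mul_add, ← mul_add, ← mul_add, ← mul_add, sortWt_sum, mul_comm]
  have a1 := e1 sortWt
  have a2 := e2 sortWt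
  have a3 := e2 (fun p r s => sortWt p s r)
  have a4 := e1 (fun p r s => sortWt r p s)
  have a5 := e1 (fun p r s => sortWt r s p)
  linarith

/-- The part of the cone with `b > 0`. -/
def inConePos (f : ℤ × ℤ × ℤ) : Prop := 0 < f.2.1 ∧ f.2.1 < 2 * f.1 ∧ f.2.1 < 2 * f.2.2

instance : DecidablePred inConePos := fun f => by unfold inConePos; infer_instance

theorem tsum_split_cone (g : ℤ × ℤ × ℤ → ℝ) (hg : ∀ f, g (negMiddle f) = g f)
    (hs : Summable fun f => if inCone f then g f else 0) :
    ∑' f, (if inCone f then g f else 0) = ∑' f, (if inCone f ∧ f.2.1 = 0 then g f else 0)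
      + 2 * ∑' f, (if inConePos f then g f else 0) := by
  have hsub : ∀ p : ℤ × ℤ × ℤ → Prop, ∀ [DecidablePred p], (∀ f, p f → inCone f) →
      Summable fun f => if p f then g f else 0 := by
    intro p _ hp
    apply Summable.of_norm_bounded hs.norm
    intro f
    by_cases h : p f
    · rw [if_pos h, if_pos (hp f h)]
    · rw [if_neg h]; simp
  have hp : ∀ f, inConePos f → inCone f := by
    rintro f ⟨h1, h2, h3⟩
    unfold inCone; rw [abs_of_pos h1]; exact ⟨h2, h3⟩
  have s1 := hsub (fun f => inCone f ∧ f.2.1 = 0) (fun f h => h.1)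
  have s2 := hsub inConePos hp
  have s3 : Summable fun f => if inConePos (negMiddle f) then g f else 0 := by
    have := negMiddle.summable_iff.2 s2
    refine this.congr fun f => ?_
    simp [hg]
  have e3 : ∑' f, (if inConePos (negMiddle f) then g f else 0) =
      ∑' f, if inConePos f then g f else 0 := by
    rw [← negMiddle.tsum_eq fun f => if inConePos f then g f else 0]
    refine tsum_congr fun f => ?_
    rw [hg]
  rw [two_mul]
  nth_rw 2 [← e3]
  rw [← s2.tsum_add s3, ← s1.tsum_add (s2.add s3)]
  refine tsum_congr fun f => ?_
  have hn : negMiddle f = (f.1, -f.2.1, f.2.2) := rfl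
  rw [hn]
  unfold inCone inConePos
  simp only [abs_lt]
  rcases lt_trichotomy f.2.1 0 with h | h | h
  · have h' : ¬ 0 < f.2.1 := by omega
    have e : (((-(2 * f.1) < f.2.1 ∧ f.2.1 < 2 * f.1) ∧ -(2 * f.2.2) < f.2.1 ∧
      f.2.1 < 2 * f.2.2)) = (-f.2.1 < 2 * f.1 ∧ -f.2.1 < 2 * f.2.2) := by
      apply propext; omega
    simp [h.ne, h', h, e]
  · simp [h]
  · have h' : ¬ f.2.1 < 0 := by omega
    have e : (((-(2 * f.1) < f.2.1 ∧ f.2.1 < 2 * f.1) ∧ -(2 * f.2.2) < f.2.1 ∧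
      f.2.1 < 2 * f.2.2)) = (f.2.1 < 2 * f.1 ∧ f.2.1 < 2 * f.2.2) := by
      apply propext; omega
    simp [h.ne', h', h, e]

theorem tsum_formWt_cone {h : ℕ → ℝ} {x : ℝ} (hx0 : 0 ≤ x) (hx1 : x < 1)
    (hh : ∀ N, |h N| ≤ x ^ N) :
    ∑' f, (if inCone f then formWt f * h (negDisc f) else 0) =
      ∑' f, (if inCone f then h (negDisc f) else 0) +
      2 * ∑' f, (if inCone f ∧ f.2.1 = 0 then h (negDisc f) else 0) := by
  have hs := summable_cone hx0 hx1 hh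
  have hs' : Summable fun f => if inCone f then formWt f * h (negDisc f) else 0 := by
    apply Summable.of_norm_bounded (hs.norm.mul_right 6)
    intro f
    split_ifs
    · rw [norm_mul, mul_comm]
      apply mul_le_mul_of_nonneg_left _ (norm_nonneg _)
      unfold formWt
      rw [Real.norm_eq_abs, abs_of_nonneg (sortWt_nonneg _ _ _)]
      exact sortWt_le _ _ _
    · simp
  have hN : ∀ f, negDisc (negMiddle f) = negDisc f := by
    intro f
    have hn : negMiddle f = (f.1, -f.2.1, f.2.2) := rfl
    rw [hn]; simp [negDisc]
  have hOu : ∀ f, swapOuter f = (f.2.2, f.2.1, f.1) := fun f => rfl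
  have hIn : ∀ f, swapInner f = (f.1, 2 * f.1 - f.2.1, f.1 + f.2.2 - f.2.1) := fun f => rfl
  have hNo : ∀ f, negDisc (swapOuter f) = negDisc f := by
    intro f
    rw [hOu]; unfold negDisc; simp only; congr 1; ring
  have hNi : ∀ f, negDisc (swapInner f) = negDisc f := by
    intro f
    rw [hIn]; unfold negDisc; simp only; congr 1; ring
  rw [tsum_split_cone (fun f => formWt f * h (negDisc f)) _ hs',
    tsum_split_cone (fun f => h (negDisc f)) _ hs]
  rotate_left
  · intro f; rw [hN]
  · intro f
    rw [hN]
    congr 1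
    have hn : negMiddle f = (f.1, -f.2.1, f.2.2) := rfl
    rw [hn]; simp [formWt]
  have hsub : ∀ p : ℤ × ℤ × ℤ → Prop, ∀ [DecidablePred p], (∀ f, p f → inCone f) →
      Summable fun f => if p f then h (negDisc f) else 0 := by
    intro p _ hp
    apply Summable.of_norm_bounded hs.norm
    intro f
    by_cases h : p f
    · rw [if_pos h, if_pos (hp f h)]
    · rw [if_neg h]; simp
  have hp : ∀ f, inConePos f → inCone f := by
    rintro f ⟨h1, h2, h3⟩
    unfold inCone; rw [abs_of_pos h1]; exact ⟨h2, h3⟩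
  have main : ∑' f, (if inConePos f then formWt f * h (negDisc f) else 0) =
      ∑' f, (if inConePos f then h (negDisc f) else 0) := by
    rw [← tsum_sortWt_symm (fun f => if inConePos f then h (negDisc f) else 0)
      (hsub _ hp)]
    · refine tsum_congr fun f => ?_
      split_ifs with hf
      · rw [mul_comm]; unfold formWt; rw [abs_of_pos hf.1]
      · simp
    · intro f
      rw [hNo, hOu]
      have : inConePos (f.2.2, f.2.1, f.1) = inConePos f := by
        unfold inConePos; apply propext; simp only; omega
      simp only [this]
    · intro f
      rw [hNi, hIn]
      have : inConePos (f.1, 2 * f.1 - f.2.1, f.1 + f.2.2 - f.2.1) = inConePos f := by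
        unfold inConePos; apply propext; simp only; omega
      simp only [this]
  have main0 : ∑' f, (if inCone f ∧ f.2.1 = 0 then formWt f * h (negDisc f) else 0) =
      3 * ∑' f, (if inCone f ∧ f.2.1 = 0 then h (negDisc f) else 0) := by
    have hb : ∀ f, ‖(if inCone f ∧ f.2.1 = 0 then formWt f * h (negDisc f) else 0)‖ ≤
        ‖if inCone f then formWt f * h (negDisc f) else 0‖ := by
      intro f
      by_cases hc : inCone f
      · by_cases hf : f.2.1 = 0
        · simp [hc, hf]
        · simp [hf]
      · simp [hc]
    have s1 : Summable fun f => if inCone f ∧ f.2.1 = 0 then formWt f * h (negDisc f) else 0 :=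
      Summable.of_norm_bounded hs'.norm hb
    have s2 := swapOuter.summable_iff.2 s1
    have e := swapOuter.tsum_eq
      (fun f => if inCone f ∧ f.2.1 = 0 then formWt f * h (negDisc f) else 0)
    have : ∑' f, (if inCone f ∧ f.2.1 = 0 then formWt f * h (negDisc f) else 0) +
      ∑' f, (if inCone f ∧ f.2.1 = 0 then formWt f * h (negDisc f) else 0) =
      6 * ∑' f, (if inCone f ∧ f.2.1 = 0 then h (negDisc f) else 0) := by
      nth_rw 2 [← e]
      have e2 := s1.tsum_add s2
      simp only [Function.comp] at e2
      rw [← e2, ← tsum_mul_left]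
      refine tsum_congr fun f => ?_
      rw [hNo, hOu]
      have : inCone (f.2.2, f.2.1, f.1) = inCone f := by
        unfold inCone; apply propext; simp only; omega
      simp only [this]
      split_ifs with hf
      · rw [← add_mul]
        congr 1
        unfold formWt sortWt
        obtain ⟨⟨h1, h2⟩, h3⟩ := hf
        simp only [h3, abs_zero] at *
        split_ifs <;> first | omega | norm_num
      · simp
    linarith
  rw [main, main0]; ring

theorem hasSum_hurwitzH {h : ℕ → ℝ} {x : ℝ} (hx0 : 0 ≤ x) (hx1 : x < 1)
    (hh : ∀ N, |h N| ≤ x ^ N) :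
    HasSum (fun N => 6 * hurwitzH N * h N) (-h 0 / 2 +
      (∑' f, (if inCone f then h (negDisc f) else 0) +
      2 * ∑' f, (if inCone f ∧ f.2.1 = 0 then h (negDisc f) else 0))) := by
  have hs := summable_cone hx0 hx1 hh
  have hs' : Summable fun f => if inCone f then formWt f * h (negDisc f) else 0 := by
    apply Summable.of_norm_bounded (hs.norm.mul_right 6)
    intro f
    split_ifs
    · rw [norm_mul, mul_comm]
      apply mul_le_mul_of_nonneg_left _ (norm_nonneg _)
      unfold formWt
      rw [Real.norm_eq_abs, abs_of_nonneg (sortWt_nonneg _ _ _)]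
      exact sortWt_le _ _ _
    · simp
  rw [← tsum_formWt_cone hx0 hx1 hh]
  have h1 := hs'.hasSum.tsum_fiberwise negDisc
  have h0 : HasSum (fun N : ℕ => if N = 0 then -h 0 / 2 else 0) (-h 0 / 2) := hasSum_ite_eq 0 _
  convert h0.add h1 using 2 with N
  by_cases hN : N = 0
  · subst hN
    have : ∑' f : negDisc ⁻¹' {0}, (if inCone f.val then formWt f.val * h (negDisc f.val) else 0)
        = 0 := by
      refine (tsum_congr fun f => ?_).trans tsum_zero
      rw [if_neg]
      intro hc
      have h1 := negDisc_pos hc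
      have h2 : negDisc f.val = 0 := f.property
      omega
    rw [this]
    simp [hurwitzH]; ring
  · rw [if_neg hN, zero_add]
    symm
    apply HasSum.tsum_eq
    have h2 := (six_mul_hurwitzH hN).mul_right (h N)
    let ι : PosDefForm N → negDisc ⁻¹' {N} := fun f => ⟨f.val, by
      have := f.property.2
      simp only [Set.mem_preimage, Set.mem_singleton_iff, negDisc]
      omega⟩
    have hι : Function.Injective ι := by
      intro f g hfg
      exact Subtype.ext (congrArg (fun k => k.val) hfg)
    rw [← hι.hasSum_iff]
    · refine (congrArg (fun g => HasSum g (6 * hurwitzH N * h N)) (funext fun f => ?_)).mpr h2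
      change (if inCone (ι f).val then formWt f.val * h (negDisc (ι f).val) else 0) = _
      have hd : negDisc (ι f).val = N := (ι f).property
      rw [hd]
      split_ifs with hc
      · rfl
      · rw [formWt_eq_zero, zero_mul]
        intro hr
        apply hc
        have := f.property.1
        unfold IsReducedForm at hr
        unfold inCone
        change |f.val.2.1| < 2 * f.val.1 ∧ |f.val.2.1| < 2 * f.val.2.2
        omega
    · intro f hf
      rw [if_neg]
      intro hc
      apply hf
      have hd : negDisc f.val = N := f.property
      have h3 := negDisc_cast hc
      rw [hd] at h3
      have h4 : 0 < f.val.1 := by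
        have := hc.1; have := abs_nonneg f.val.2.1; omega
      exact ⟨⟨f.val, h4, by linarith⟩, rfl⟩

theorem hasSum_geometric_two_sided {y : ℝ} (hy0 : 0 ≤ y) (hy1 : y < 1) :
    HasSum (fun j : ℕ => (if j = 0 then 1 else 2) * y ^ j) ((1 + y) / (1 - y)) := by
  have h1 := (hasSum_geometric_of_lt_one hy0 hy1).mul_left 2
  have h2 : HasSum (fun j : ℕ => if j = 0 then (-1 : ℝ) else 0) (-1) := hasSum_ite_eq 0 _
  convert h1.add h2 using 1
  · rfl
  · funext j
    split_ifs with h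
    · subst h; norm_num
    · simp
  · have : 1 - y ≠ 0 := by linarith
    field_simp; ring

/-- The partial theta sum attached to the forms `(k, m, k)` with `|m| < 2 k`. -/
def middleSum (x : ℝ) (k : ℕ) : ℝ :=
  ∑ m ∈ Finset.Ioo (-(2 * (k : ℤ) + 2)) (2 * k + 2), x ^ (4 * ((k : ℤ) + 1) ^ 2 - m ^ 2).toNat

/-- The factor `(1 + x^(4 * k)) / (1 - x^(4 * k))`. -/
def geomFactor (x : ℝ) (k : ℕ) : ℝ := (1 + x ^ (4 * (k + 1))) / (1 - x ^ (4 * (k + 1)))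

theorem hasSum_cone {x : ℝ} (hx : |x| < 1) :
    HasSum (fun k => geomFactor x k * middleSum x k)
      (∑' f, (if inCone f then x ^ (negDisc f) else 0)) := by
  have hs : Summable fun f : ℤ × ℤ × ℤ => if inCone f then x ^ negDisc f else 0 :=
    summable_cone (abs_nonneg x) hx (fun N => (abs_pow x N).le)
  have hsub : ∀ p : ℤ × ℤ × ℤ → Prop, ∀ [DecidablePred p], (∀ f, p f → inCone f) →
      Summable fun f => if p f then x ^ negDisc f else 0 := by
    intro p _ hp
    apply Summable.of_norm_bounded hs.norm
    intro f
    by_cases h : p f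
    · rw [if_pos h, if_pos (hp f h)]
    · rw [if_neg h]; simp
  have s1 := hsub (fun f => inCone f ∧ f.1 ≤ f.2.2) (fun f h => h.1)
  have s2 := hsub (fun f => inCone f ∧ f.1 < f.2.2) (fun f h => h.1)
  have s3 := hsub (fun f => inCone f ∧ f.2.2 < f.1) (fun f h => h.1)
  have hOu : ∀ f, swapOuter f = (f.2.2, f.2.1, f.1) := fun f => rfl
  have e23 : ∑' f, (if inCone f ∧ f.2.2 < f.1 then x ^ negDisc f else 0) =
      ∑' f, (if inCone f ∧ f.1 < f.2.2 then x ^ negDisc f else 0) := by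
    rw [← swapOuter.tsum_eq]
    refine tsum_congr fun f => ?_
    rw [hOu]
    have h1 : inCone (f.2.2, f.2.1, f.1) = inCone f := by
      unfold inCone; apply propext; simp only; omega
    have h2 : negDisc (f.2.2, f.2.1, f.1) = negDisc f := by
      unfold negDisc; simp only; congr 1; ring
    simp only [h1, h2]
  have e1 : ∑' f, (if inCone f then x ^ (negDisc f) else 0) =
      ∑' f, ((if inCone f ∧ f.1 ≤ f.2.2 then x ^ negDisc f else 0) +
        if inCone f ∧ f.1 < f.2.2 then x ^ negDisc f else 0) := by
    rw [s1.tsum_add s2, ← e23, ← s1.tsum_add s3]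
    refine tsum_congr fun f => ?_
    by_cases hf : inCone f
    · by_cases h : f.1 ≤ f.2.2
      · simp [hf, h, not_lt.2 h]
      · simp [hf, h, not_le.1 h]
    · simp [hf]
  rw [e1]
  have hS := (s1.add s2).hasSum
  let ι : (ℕ × ℕ) × ℤ → ℤ × ℤ × ℤ := fun t => ((t.1.1 : ℤ) + 1, t.2, (t.1.1 : ℤ) + 1 + t.1.2)
  have hι : Function.Injective ι := by
    rintro ⟨⟨k, j⟩, m⟩ ⟨⟨k', j'⟩, m'⟩ h
    simp only [ι, Prod.mk.injEq] at h ⊢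
    omega
  rw [← hι.hasSum_iff] at hS
  · have hg : ∀ kj : ℕ × ℕ, HasSum (fun m : ℤ => ((if inCone (ι (kj, m)) ∧ (ι (kj, m)).1 ≤
        (ι (kj, m)).2.2 then x ^ negDisc (ι (kj, m)) else 0) +
        if inCone (ι (kj, m)) ∧ (ι (kj, m)).1 < (ι (kj, m)).2.2
          then x ^ negDisc (ι (kj, m)) else 0))
        ((if kj.2 = 0 then 1 else 2) * (x ^ (4 * (kj.1 + 1))) ^ kj.2 * middleSum x kj.1) := by
      rintro ⟨k, j⟩
      unfold middleSum
      rw [Finset.mul_sum]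
      have hval : ∀ m ∈ Finset.Ioo (-(2 * (k : ℤ) + 2)) (2 * k + 2),
          (if j = 0 then 1 else 2) * (x ^ (4 * (k + 1))) ^ j *
            x ^ (4 * ((k : ℤ) + 1) ^ 2 - m ^ 2).toNat =
          ((if inCone (ι ((k, j), m)) ∧ (ι ((k, j), m)).1 ≤
        (ι ((k, j), m)).2.2 then x ^ negDisc (ι ((k, j), m)) else 0) +
        if inCone (ι ((k, j), m)) ∧ (ι ((k, j), m)).1 < (ι ((k, j), m)).2.2
          then x ^ negDisc (ι ((k, j), m)) else 0) := by
        intro m hm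
        rw [Finset.mem_Ioo] at hm
        have hc : inCone (ι ((k, j), m)) := by
          unfold inCone; simp only [ι, abs_lt]; omega
        have hd : negDisc (ι ((k, j), m)) =
            4 * (k + 1) * j + (4 * ((k : ℤ) + 1) ^ 2 - m ^ 2).toNat := by
          have h1 := negDisc_cast hc
          have h2 : 0 ≤ 4 * ((k : ℤ) + 1) ^ 2 - m ^ 2 := by nlinarith
          have h3 := Int.toNat_of_nonneg h2
          zify
          rw [h1, h3]; simp only [ι]; ring
        rw [hd, pow_add, pow_mul]
        have h4 : (ι ((k, j), m)).1 ≤ (ι ((k, j), m)).2.2 := by simp [ι]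
        have h5 : (ι ((k, j), m)).1 < (ι ((k, j), m)).2.2 ↔ ¬ j = 0 := by simp [ι]; omega
        simp only [hc, h4, h5, true_and, if_true]
        by_cases hj : j = 0
        · simp [hj]
        · simp [hj]; ring
      rw [Finset.sum_congr rfl hval]
      apply hasSum_sum_of_ne_finset_zero
      intro m hm
      have hc : ¬ inCone (ι ((k, j), m)) := by
        intro hc
        apply hm
        rw [Finset.mem_Ioo]
        unfold inCone at hc; simp only [ι, abs_lt] at hc; omega
      simp [hc]
    have h2 := hS.prod_fiberwise hg
    refine h2.prod_fiberwise (fun k => ?_)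
    simp only
    unfold geomFactor
    refine HasSum.mul_right _ (hasSum_geometric_two_sided ?_ ?_)
    · rw [pow_mul]; positivity
    · rw [pow_mul]
      apply pow_lt_one₀ (by positivity) _ (by omega)
      rw [show x ^ 4 = |x| ^ 4 by rw [Even.pow_abs ⟨2, rfl⟩]]
      exact pow_lt_one₀ (abs_nonneg x) hx (by norm_num)
  · intro f hf
    have : ¬ (inCone f ∧ f.1 ≤ f.2.2) := by
      rintro ⟨hc, hl⟩
      apply hf
      have h0 : 0 < f.1 := by have := hc.1; have := abs_nonneg f.2.1; omega
      refine ⟨((f.1.toNat - 1, (f.2.2 - f.1).toNat), f.2.1), ?_⟩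
      simp only [ι]
      ext <;> simp <;> omega
    have h2 : ¬ (inCone f ∧ f.1 < f.2.2) := fun h => this ⟨h.1, h.2.le⟩
    simp only [this, h2, if_false, add_zero]

theorem hasSum_cone_zero {x : ℝ} (hx : |x| < 1) :
    HasSum (fun k : ℕ => x ^ (4 * (k + 1)) / (1 - x ^ (4 * (k + 1))))
      (∑' f, (if inCone f ∧ f.2.1 = 0 then x ^ (negDisc f) else 0)) := by
  have hs : Summable fun f : ℤ × ℤ × ℤ => if inCone f then x ^ negDisc f else 0 :=
    summable_cone (abs_nonneg x) hx (fun N => (abs_pow x N).le)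
  have s1 : Summable fun f => if inCone f ∧ f.2.1 = 0 then x ^ negDisc f else 0 := by
    apply Summable.of_norm_bounded hs.norm
    intro f
    by_cases h : inCone f
    · by_cases h' : f.2.1 = 0 <;> simp [h, h']
    · simp [h]
  have hS := s1.hasSum
  let ι : ℕ × ℕ → ℤ × ℤ × ℤ := fun t => ((t.1 : ℤ) + 1, 0, (t.2 : ℤ) + 1)
  have hι : Function.Injective ι := by
    rintro ⟨k, j⟩ ⟨k', j'⟩ h
    simp only [ι, Prod.mk.injEq] at h ⊢
    omega
  rw [← hι.hasSum_iff] at hS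
  · refine hS.prod_fiberwise (fun k => ?_)
    have hy0 : 0 ≤ x ^ (4 * (k + 1)) := by rw [pow_mul]; positivity
    have hy1 : x ^ (4 * (k + 1)) < 1 := by
      rw [pow_mul]
      apply pow_lt_one₀ (by positivity) _ (by omega)
      rw [show x ^ 4 = |x| ^ 4 by rw [Even.pow_abs ⟨2, rfl⟩]]
      exact pow_lt_one₀ (abs_nonneg x) hx (by norm_num)
    have h3 := (hasSum_geometric_of_lt_one hy0 hy1).mul_left (x ^ (4 * (k + 1)))
    rw [← div_eq_mul_inv] at h3
    refine (congrArg (fun g => HasSum g (x ^ (4 * (k + 1)) / (1 - x ^ (4 * (k + 1)))))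
      (funext fun j => ?_)).mpr h3
    have hc : inCone (ι (k, j)) := by unfold inCone; simp [ι]
    have hd : negDisc (ι (k, j)) = 4 * (k + 1) * (j + 1) := by
      have h1 := negDisc_cast hc
      zify; rw [h1]; simp [ι]
    change (if inCone (ι (k, j)) ∧ (ι (k, j)).2.1 = 0 then x ^ negDisc (ι (k, j)) else 0) = _
    rw [if_pos ⟨hc, rfl⟩, hd, pow_mul, pow_succ, mul_comm]
  · intro f hf
    rw [if_neg]
    rintro ⟨hc, hb⟩
    apply hf
    have h0 := hc.1
    have h1 := hc.2
    rw [hb, abs_zero] at h0 h1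
    refine ⟨(f.1.toNat - 1, f.2.2.toNat - 1), ?_⟩
    simp only [ι]
    ext <;> simp <;> omega

/-- The generating function of the Hurwitz class numbers as a Lambert series. -/
theorem hasSum_hurwitzH_lambert {x : ℝ} (hx : |x| < 1) :
    ∃ T : ℝ, HasSum (fun N => 6 * hurwitzH N * x ^ N) T ∧
      HasSum (fun k => geomFactor x k * middleSum x k + (geomFactor x k - 1)) (T + 1 / 2) := by
  refine ⟨_, hasSum_hurwitzH (h := fun N => x ^ N) (abs_nonneg x) hx (fun N => (abs_pow x N).le),
    ?_⟩
  convert (hasSum_cone hx).add ((hasSum_cone_zero hx).mul_left 2) using 1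
  · funext k
    congr 1
    unfold geomFactor
    have : 1 - x ^ (4 * (k + 1)) ≠ 0 := by
      have hy1 : x ^ (4 * (k + 1)) < 1 := by
        rw [pow_mul]
        apply pow_lt_one₀ (by positivity) _ (by omega)
        rw [show x ^ 4 = |x| ^ 4 by rw [Even.pow_abs ⟨2, rfl⟩]]
        exact pow_lt_one₀ (abs_nonneg x) hx (by norm_num)
      linarith
    field_simp; ring
  · simp; ring

theorem summable_hurwitzH {x : ℝ} (hx : |x| < 1) : Summable fun N => hurwitzH N * x ^ N := by
  obtain ⟨T, hT, -⟩ := hasSum_hurwitzH_lambert hx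
  have := (hT.mul_left (1 / 6)).summable
  refine this.congr fun N => ?_
  ring

/-- The coefficients `H(N)`, `N ≡ 3 (mod 4)`. -/
def hurwitzOdd (N : ℕ) : ℝ := if N % 4 = 3 then hurwitzH N else 0

theorem hasSum_hurwitzOdd {x : ℝ} (hx0 : 0 ≤ x) (hx : x < 1) :
    ∃ T : ℝ, HasSum (fun N => hurwitzOdd N * x ^ N) T ∧
      HasSum (fun t : ℕ × ℕ × ℕ => x ^ ((2 * t.1 + 1) * (2 * t.2.1 + 1) +
        (2 * t.1 + 1) * (2 * t.2.2 + 1) + (2 * t.2.1 + 1) * (2 * t.2.2 + 1))) (3 * T) := by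
  set h : ℕ → ℝ := fun N => if N % 4 = 3 then x ^ N else 0 with hh
  have hb : ∀ N, |h N| ≤ x ^ N := by
    intro N
    simp only [hh]
    split_ifs
    · rw [abs_of_nonneg (by positivity)]
    · simp only [abs_zero]; positivity
  have h1 := hasSum_hurwitzH hx0 hx hb
  have hs := summable_cone hx0 hx hb
  have z0 : h 0 = 0 := by simp [hh]
  have hmod : ∀ f, inCone f → (negDisc f % 4 = 3 ↔ ¬ (2 ∣ f.2.1)) := by
    intro f hf
    have h2 := negDisc_cast hf
    rcases Int.even_or_odd' f.2.1 with ⟨k, hk | hk⟩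
    · have : (4 * f.1 * f.2.2 - f.2.1 ^ 2) = 4 * (f.1 * f.2.2 - k ^ 2) := by rw [hk]; ring
      omega
    · have : (4 * f.1 * f.2.2 - f.2.1 ^ 2) = 4 * (f.1 * f.2.2 - k ^ 2 - k - 1) + 3 := by
        rw [hk]; ring
      omega
  have z1 : ∑' f, (if inCone f ∧ f.2.1 = 0 then h (negDisc f) else 0) = 0 := by
    refine (tsum_congr fun f => ?_).trans tsum_zero
    split_ifs with hf
    · have := (hmod f hf.1).not
      simp only [hh]
      rw [if_neg]
      rw [this, hf.2]; simp
    · rfl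
  have hN : ∀ f, negDisc (negMiddle f) = negDisc f := by
    intro f
    have hn : negMiddle f = (f.1, -f.2.1, f.2.2) := rfl
    rw [hn]; simp [negDisc]
  rw [tsum_split_cone (fun f => h (negDisc f)) (fun f => by rw [hN]) hs, z0, z1] at h1
  have s2 : Summable fun f => if inConePos f then h (negDisc f) else 0 := by
    apply Summable.of_norm_bounded hs.norm
    intro f
    by_cases hf : inConePos f
    · have : inCone f := by
        unfold inCone; rw [abs_of_pos hf.1]; exact hf.2
      rw [if_pos hf, if_pos this]
    · rw [if_neg hf]; simp
  refine ⟨(∑' f, (if inConePos f then h (negDisc f) else 0)) / 3, ?_, ?_⟩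
  · convert h1.mul_left (1 / 6) using 1
    · rfl
    · funext N
      simp only [hh, hurwitzOdd]
      split_ifs
      · ring
      · ring
    · ring
  · rw [mul_div_cancel₀ _ (by norm_num : (3 : ℝ) ≠ 0)]
    have hS := s2.hasSum
    let ι : ℕ × ℕ × ℕ → ℤ × ℤ × ℤ := fun t =>
      ((t.1 : ℤ) + t.2.1 + 1, 2 * t.1 + 1, (t.1 : ℤ) + t.2.2 + 1)
    have hι : Function.Injective ι := by
      rintro ⟨k, j, l⟩ ⟨k', j', l'⟩ h
      simp only [ι, Prod.mk.injEq] at h ⊢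
      omega
    rw [← hι.hasSum_iff] at hS
    · refine (congrArg (fun g => HasSum g _) (funext fun t => ?_)).mpr hS
      have hp : inConePos (ι t) := by unfold inConePos; simp only [ι]; omega
      have hc : inCone (ι t) := by
        unfold inCone; rw [abs_of_pos hp.1]; exact hp.2
      have hm := (hmod _ hc).2 (by simp only [ι]; omega)
      change _ = (if inConePos (ι t) then h (negDisc (ι t)) else 0)
      simp only [hp, if_true, hh, hm]
      congr 1
      have h1 := negDisc_cast hc
      zify; rw [h1]; simp only [ι]; ring
    · intro f hf
      by_cases hp : inConePos f
      · have hc : inCone f := by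
          unfold inCone; rw [abs_of_pos hp.1]; exact hp.2
        rw [if_pos hp]
        simp only [hh]
        rw [if_neg]
        rw [hmod f hc, not_not]
        by_contra hodd
        apply hf
        obtain ⟨h1, h2, h3⟩ := hp
        refine ⟨(((f.2.1 - 1) / 2).toNat, (f.1 - 1 - (f.2.1 - 1) / 2).toNat,
          (f.2.2 - 1 - (f.2.1 - 1) / 2).toNat), ?_⟩
        simp only [ι]
        ext <;> simp <;> omega
      · rw [if_neg hp]

theorem hasSum_tanh {x : ℝ} (hx : 0 < x) :
    HasSum (fun j : ℕ => 8 * x / ((2 * (j : ℝ) + 1) ^ 2 + 4 * x ^ 2))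
      (Real.pi * Real.tanh (Real.pi * x)) := by
  have hmem : ∀ y : ℝ, 0 < y → (y : ℂ) * I ∈ Complex.integerComplement := by
    intro y hy ⟨n, hn⟩
    have := congrArg Complex.im hn
    simp at this
    linarith
  have h1 := hmem x hx
  have h2 := hmem (2 * x) (by linarith)
  have s1 := summable_cotTerm h1
  have s2 := summable_cotTerm h2
  have c1 := cot_series_rep' h1
  have c2 := cot_series_rep' h2
  change _ = ∑' n, cotTerm _ n at c1 c2
  have hval : ∀ (y : ℝ), 0 < y → ∀ n : ℕ, cotTerm ((y : ℂ) * I) n =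
      ((-2 * y / (((n : ℝ) + 1) ^ 2 + y ^ 2) : ℝ) : ℂ) * I := by
    intro y hy n
    rw [cotTerm_identity (hmem y hy)]
    have h3 : ((y : ℂ) * I + (n + 1)) * ((y : ℂ) * I - (n + 1)) =
        ((-(((n : ℝ) + 1) ^ 2 + y ^ 2) : ℝ) : ℂ) := by
      push_cast
      linear_combination (y : ℂ) ^ 2 * I_sq
    rw [h3]
    push_cast
    have h4 : ((n : ℂ) + 1) ^ 2 + (y : ℂ) ^ 2 ≠ 0 := by
      have : ((((n : ℝ) + 1) ^ 2 + y ^ 2 : ℝ) : ℂ) ≠ 0 := by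
        rw [Ne, ofReal_eq_zero]; positivity
      push_cast at this; exact this
    rw [div_mul_eq_mul_div, mul_one_div, div_eq_div_iff (neg_ne_zero.2 h4) h4]
    ring
  have se := s2.comp_injective (i := fun k : ℕ => 2 * k) (fun a b h => by simpa using h)
  have so := s2.comp_injective (i := fun k : ℕ => 2 * k + 1) (fun a b h => by simpa using h)
  have hsplit := tsum_even_add_odd se so
  have hodd : ∀ k : ℕ, 2 * cotTerm (((2 * x : ℝ) : ℂ) * I) (2 * k + 1) =
      cotTerm ((x : ℂ) * I) k := by
    intro k
    rw [hval _ (by linarith), hval _ hx, ← mul_assoc]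
    congr 1
    norm_cast
    have : ((k : ℝ) + 1) ^ 2 + x ^ 2 ≠ 0 := by positivity
    have : (2 * (k : ℝ) + 1 + 1) ^ 2 + (2 * x) ^ 2 ≠ 0 := by positivity
    push_cast
    field_simp
    ring
  have hodd2 : 2 * ∑' k : ℕ, cotTerm (((2 * x : ℝ) : ℂ) * I) (2 * k + 1) =
      ∑' k, cotTerm ((x : ℂ) * I) k := by
    rw [← tsum_mul_left]; exact tsum_congr hodd
  have hw : (Real.pi : ℂ) * ((x : ℂ) * I) = ((Real.pi * x : ℝ) : ℂ) * I := by push_cast; ring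
  have hw2 : (Real.pi : ℂ) * (((2 * x : ℝ) : ℂ) * I) = 2 * (((Real.pi * x : ℝ) : ℂ) * I) := by
    push_cast; ring
  rw [hw] at c1
  rw [hw2] at c2
  have hpos : 0 < Real.pi * x := by positivity
  have hsin : Complex.sin (((Real.pi * x : ℝ) : ℂ) * I) ≠ 0 := by
    rw [Complex.sin_mul_I, ← ofReal_sinh]
    exact mul_ne_zero (ofReal_ne_zero.2 (Real.sinh_pos_iff.2 hpos).ne') I_ne_zero
  have hcos : Complex.cos (((Real.pi * x : ℝ) : ℂ) * I) ≠ 0 := by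
    rw [Complex.cos_mul_I, ← ofReal_cosh]
    exact ofReal_ne_zero.2 (Real.cosh_pos _).ne'
  have htan : Complex.tan (((Real.pi * x : ℝ) : ℂ) * I) =
      Complex.cot (((Real.pi * x : ℝ) : ℂ) * I) -
        2 * Complex.cot (2 * (((Real.pi * x : ℝ) : ℂ) * I)) := by
    rw [Complex.tan_eq_sin_div_cos, Complex.cot_eq_cos_div_sin, Complex.cot_eq_cos_div_sin,
      Complex.sin_two_mul, Complex.cos_two_mul]
    field_simp
    linear_combination Complex.sin_sq_add_cos_sq (((Real.pi * x : ℝ) : ℂ) * I)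
  rw [Complex.tan_mul_I, ← ofReal_tanh] at htan
  have hfin : -2 * ∑' k : ℕ, cotTerm (((2 * x : ℝ) : ℂ) * I) (2 * k) =
      ((Real.pi * Real.tanh (Real.pi * x) : ℝ) : ℂ) * I := by
    have hxi : (x : ℂ) ≠ 0 := ofReal_ne_zero.2 hx.ne'
    have e1 : 1 / (((2 * x : ℝ) : ℂ) * I) = 1 / 2 * (1 / ((x : ℂ) * I)) := by
      push_cast; field_simp
    rw [e1] at c2
    rw [← hsplit] at c2
    rw [← hodd2] at c1
    push_cast at htan ⊢
    push_cast at c1 c2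
    linear_combination (-(Real.pi : ℂ)) * htan - c1 + 2 * c2
  have hS : HasSum (fun k : ℕ => -2 * cotTerm (((2 * x : ℝ) : ℂ) * I) (2 * k))
      (((Real.pi * Real.tanh (Real.pi * x) : ℝ) : ℂ) * I) := by
    rw [← hfin]; exact se.hasSum.mul_left _
  have := Complex.hasSum_im hS
  simp only [im_ofReal_mul, I_im, mul_one] at this
  refine (congrArg (fun g => HasSum g _) (funext fun k => ?_)).mpr this
  rw [hval _ (by linarith)]
  have h5 : (-2 : ℂ) = ((-2 : ℝ) : ℂ) := by push_cast; rfl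
  rw [h5, im_ofReal_mul, im_ofReal_mul, I_im]
  push_cast
  have : (2 * (k : ℝ) + 1) ^ 2 + 4 * x ^ 2 ≠ 0 := by positivity
  rw [show (2 * x) ^ 2 = 4 * x ^ 2 by ring]
  field_simp
  ring

/-- The entire function `sinh u / u`. -/
def sinhc : ℝ → ℝ := dslope Real.sinh 0

theorem sinhc_of_ne {u : ℝ} (hu : u ≠ 0) : sinhc u = Real.sinh u / u := by
  rw [sinhc, dslope_of_ne _ hu, slope_def_field]; simp

theorem sinhc_zero : sinhc 0 = 1 := by
  rw [sinhc, dslope_same]; simp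

theorem continuous_sinhc : Continuous sinhc := by
  rw [← continuousOn_univ]
  exact (continuousOn_dslope Filter.univ_mem).2 ⟨Real.continuous_sinh.continuousOn,
    Real.differentiable_sinh.differentiableAt⟩

theorem sinhc_abs (u : ℝ) : sinhc |u| = sinhc u := by
  rcases abs_choice u with h | h
  · rw [h]
  · rw [h]
    by_cases hu : u = 0
    · rw [hu, neg_zero]
    · rw [sinhc_of_ne hu, sinhc_of_ne (neg_ne_zero.2 hu), Real.sinh_neg, neg_div_neg_eq]

theorem exp_le_sinhc (u : ℝ) : Real.exp (|u| / 2) ≤ 4 * sinhc u := by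
  rw [← sinhc_abs]
  by_cases hu : u = 0
  · rw [hu, abs_zero, sinhc_zero]; norm_num
  · have hp : 0 < |u| := abs_pos.2 hu
    generalize |u| = w at hp
    rw [sinhc_of_ne hp.ne', ← mul_div_assoc, le_div_iff₀ hp, Real.sinh_eq]
    have h1 : 1 + w / 2 ≤ Real.exp (w / 2) := by
      linarith [Real.add_one_le_exp (w / 2)]
    have h2 : 1 + 2 * w ≤ Real.exp (2 * w) := by
      linarith [Real.add_one_le_exp (2 * w)]
    have e1 : Real.exp w = Real.exp (w / 2) * Real.exp (w / 2) := by
      rw [← Real.exp_add]; congr 1; ring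
    have e2 : Real.exp (2 * w) * Real.exp (-w) = Real.exp w := by
      rw [← Real.exp_add]; congr 1; ring
    have p1 := Real.exp_pos (w / 2)
    have p2 := Real.exp_pos (-w)
    have h3 : (1 + 2 * w) * Real.exp (-w) ≤ Real.exp w := by
      rw [← e2]; exact mul_le_mul_of_nonneg_right h2 p2.le
    have h4 : Real.exp (-w) ≤ Real.exp w / (1 + 2 * w) := by
      rw [le_div_iff₀ (by linarith)]; linarith
    have h5 : Real.exp (w / 2) * w * (1 + 2 * w) ≤ 4 * w * Real.exp w := by
      rw [e1]
      have : 1 + 2 * w ≤ 4 * Real.exp (w / 2) := by linarith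
      nlinarith [mul_le_mul_of_nonneg_left this (mul_pos p1 hp).le]
    have h6 : Real.exp (w / 2) * w ≤ 4 * w * Real.exp w / (1 + 2 * w) := by
      rw [le_div_iff₀ (by linarith)]; exact h5
    have h7 : 4 * w * Real.exp w / (1 + 2 * w) =
        2 * (Real.exp w - Real.exp w / (1 + 2 * w)) := by
      have : 1 + 2 * w ≠ 0 := by linarith
      field_simp; ring
    linarith

theorem sinhc_pos (u : ℝ) : 0 < sinhc u := by
  have := exp_le_sinhc u
  have := Real.exp_pos (|u| / 2)
  linarith

/-- The continuous extension of `sin (2πωu) / sinh (πω)`. -/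
def sinKernel (u w : ℝ) : ℝ := 2 * u * Real.sinc (2 * Real.pi * w * u) / sinhc (Real.pi * w)

theorem sinKernel_of_ne {u w : ℝ} (hw : w ≠ 0) :
    sinKernel u w = Real.sin (2 * Real.pi * w * u) / Real.sinh (Real.pi * w) := by
  have hp := Real.pi_ne_zero
  unfold sinKernel
  rw [sinhc_of_ne (mul_ne_zero hp hw)]
  have hs : Real.sinh (Real.pi * w) ≠ 0 := by
    rw [Ne, Real.sinh_eq_zero]; exact mul_ne_zero hp hw
  by_cases hu : u = 0
  · simp [hu]
  · rw [Real.sinc_of_ne_zero (by positivity)]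
    field_simp

theorem sinKernel_zero (u : ℝ) : sinKernel u 0 = 2 * u := by
  simp [sinKernel, sinhc_zero]

theorem continuous_sinKernel : Continuous fun p : ℝ × ℝ => sinKernel p.1 p.2 := by
  unfold sinKernel
  refine Continuous.div ?_ ?_ (fun p => (sinhc_pos _).ne')
  · exact (continuous_const.mul continuous_fst).mul (Real.continuous_sinc.comp (by fun_prop))
  · exact continuous_sinhc.comp (by fun_prop)

theorem abs_sinKernel_le (u w : ℝ) :
    |sinKernel u w| ≤ 8 * |u| * Real.exp (-(Real.pi / 2) * |w|) := by
  unfold sinKernel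
  rw [abs_div, abs_of_pos (sinhc_pos _), div_le_iff₀ (sinhc_pos _), abs_mul, abs_mul,
    abs_of_pos (two_pos)]
  have h1 := exp_le_sinhc (Real.pi * w)
  have h2 := Real.abs_sinc_le_one (2 * Real.pi * w * u)
  rw [abs_mul, abs_of_pos Real.pi_pos] at h1
  have h3 : Real.exp (-(Real.pi / 2) * |w|) * Real.exp (Real.pi * |w| / 2) = 1 := by
    rw [← Real.exp_add, ← Real.exp_zero]; congr 1; ring
  have h4 := Real.exp_pos (-(Real.pi / 2) * |w|)
  have h5 : 1 ≤ 4 * (Real.exp (-(Real.pi / 2) * |w|) * sinhc (Real.pi * w)) := by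
    rw [← h3]; nlinarith
  have h6 := abs_nonneg u
  calc 2 * |u| * |Real.sinc (2 * Real.pi * w * u)| ≤ 2 * |u| * 1 := by gcongr
    _ ≤ 2 * |u| * (4 * (Real.exp (-(Real.pi / 2) * |w|) * sinhc (Real.pi * w))) := by gcongr
    _ = _ := by ring

theorem integrable_exp_neg_mul_abs {a : ℝ} (ha : 0 < a) :
    Integrable fun w : ℝ => Real.exp (-a * |w|) := by
  have h1 : IntegrableOn (fun w : ℝ => Real.exp (-a * |w|)) (Set.Ioi 0) :=
    (exp_neg_integrableOn_Ioi 0 ha).congr_fun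
      (fun w hw => by simp only [abs_of_pos (Set.mem_Ioi.1 hw)]) measurableSet_Ioi
  have h2 : IntegrableOn (fun w : ℝ => Real.exp (-a * |w|)) (Set.Iic 0) :=
    (integrableOn_exp_mul_Iic ha 0).congr_fun
      (fun w hw => by simp only [abs_of_nonpos (Set.mem_Iic.1 hw), neg_mul_neg]) measurableSet_Iic
  rw [← integrableOn_univ, ← Set.Iic_union_Ioi (a := (0 : ℝ))]
  exact h2.union h1

theorem integral_exp_mul_sin {a : ℝ} (ha : 0 < a) (b : ℝ) :
    ∫ w in Set.Ioi (0 : ℝ), Real.exp (-a * w) * Real.sin (b * w) = b / (a ^ 2 + b ^ 2) := by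
  have hre : ((-a : ℝ) + (b : ℝ) * I : ℂ).re < 0 := by simp [ha]
  have h := integral_exp_mul_complex_Ioi hre 0
  have hi := integrableOn_exp_mul_complex_Ioi hre 0
  have h2 := congrArg Complex.im h
  have h3 := integral_im (𝕜 := ℂ) hi
  simp only [RCLike.im_to_complex] at h3
  rw [← h3] at h2
  have h4 : ∀ w : ℝ, (Complex.exp (((-a : ℝ) + (b : ℝ) * I) * w)).im =
      Real.exp (-a * w) * Real.sin (b * w) := by
    intro w
    rw [Complex.exp_im]; simp
  simp only [h4] at h2
  rw [h2]
  have hne : (a ^ 2 + b ^ 2) ≠ 0 := by positivity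
  simp [Complex.inv_im, Complex.normSq, div_eq_mul_inv]
  left; ring

theorem integrableOn_exp_mul_sin {a : ℝ} (ha : 0 < a) (b : ℝ) :
    IntegrableOn (fun w : ℝ => Real.exp (-a * w) * Real.sin (b * w)) (Set.Ioi 0) := by
  refine (exp_neg_integrableOn_Ioi 0 ha).mono' (by fun_prop) (Filter.Eventually.of_forall ?_)
  intro w
  rw [Real.norm_eq_abs, abs_mul, abs_of_pos (Real.exp_pos _)]
  exact mul_le_of_le_one_right (Real.exp_pos _).le (Real.abs_sin_le_one _)

theorem integral_norm_exp_mul_sin_le {a : ℝ} (ha : 0 < a) {b : ℝ} (hb : 0 ≤ b) :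
    ∫ w in Set.Ioi (0 : ℝ), ‖Real.exp (-a * w) * Real.sin (b * w)‖ ≤ b / a ^ 2 := by
  have h1 := Real.integral_rpow_mul_exp_neg_mul_Ioi (a := 2) (by norm_num) ha
  have h2 := integrableOn_rpow_mul_exp_neg_mul_rpow (s := 1) (p := 1) (b := a)
    (by norm_num) (by norm_num) ha
  simp only [Real.rpow_one] at h2
  norm_num at h1
  calc _ ≤ ∫ w in Set.Ioi (0 : ℝ), b * (w * Real.exp (-a * w)) := by
        refine setIntegral_mono_on (integrableOn_exp_mul_sin ha b).norm (h2.const_mul b)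
          measurableSet_Ioi ?_
        intro w hw
        rw [Real.norm_eq_abs, abs_mul, abs_of_pos (Real.exp_pos _)]
        have h3 : |Real.sin (b * w)| ≤ b * w := by
          have := Real.abs_sin_le_abs (x := b * w)
          rwa [abs_of_nonneg (mul_nonneg hb (le_of_lt hw))] at this
        nlinarith [Real.exp_pos (-a * w)]
    _ = b * (a ^ 2)⁻¹ := by
        rw [integral_const_mul]; congr 1
        rw [← h1]
        refine setIntegral_congr_fun measurableSet_Ioi fun w _ => ?_
        simp only [neg_mul]
    _ = _ := by field_simp

theorem hasSum_inv_sinh {u : ℝ} (hu : 0 < u) :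
    HasSum (fun j : ℕ => 2 * Real.exp (-((2 * j + 1) * u))) (1 / Real.sinh u) := by
  have h1 : Real.exp (-(2 * u)) < 1 := by rw [Real.exp_lt_one_iff]; linarith
  have h := (hasSum_geometric_of_lt_one (Real.exp_pos _).le h1).mul_left (2 * Real.exp (-u))
  have e : 2 * Real.exp (-u) * (1 - Real.exp (-(2 * u)))⁻¹ = 1 / Real.sinh u := by
    have h2 : Real.sinh u = Real.exp u * (1 - Real.exp (-(2 * u))) / 2 := by
      rw [Real.sinh_eq, mul_sub, ← Real.exp_add]; congr 2; · ring
      congr 1; ring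
    rw [h2, Real.exp_neg]
    have h3 : 1 - Real.exp (-(2 * u)) ≠ 0 := by linarith
    have h4 := (Real.exp_pos u).ne'
    field_simp
  rw [e] at h
  refine (congrArg (fun g => HasSum g _) (funext fun j => ?_)).mpr h
  rw [mul_assoc, ← Real.exp_nat_mul, ← Real.exp_add]
  congr 2; ring

theorem summable_inv_odd_sq : Summable fun j : ℕ => 1 / (2 * (j : ℝ) + 1) ^ 2 := by
  have h := (Real.summable_one_div_nat_pow (p := 2)).2 (by norm_num)
  have := h.comp_injective (i := fun j : ℕ => 2 * j + 1) (fun a b hab => by simpa using hab)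
  refine this.congr fun j => ?_
  simp

theorem integral_sin_div_sinh {x : ℝ} (hx : 0 < x) :
    ∫ w in Set.Ioi (0 : ℝ), Real.sin (2 * Real.pi * w * x) / Real.sinh (Real.pi * w) =
      Real.tanh (Real.pi * x) / 2 := by
  have hp := Real.pi_pos
  have ha : ∀ j : ℕ, 0 < (2 * (j : ℝ) + 1) * Real.pi := fun j => by positivity
  let F : ℕ → ℝ → ℝ := fun j w =>
    2 * (Real.exp (-((2 * (j : ℝ) + 1) * Real.pi) * w) * Real.sin (2 * Real.pi * x * w))
  have hb : 0 ≤ 2 * Real.pi * x := by positivity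
  have hF : ∀ j, Integrable (F j) (volume.restrict (Set.Ioi 0)) := fun j =>
    (integrableOn_exp_mul_sin (ha j) _).const_mul 2
  have hs : Summable fun j => ∫ w in Set.Ioi (0 : ℝ), ‖F j w‖ := by
    refine Summable.of_nonneg_of_le (fun j => integral_nonneg fun w => norm_nonneg _) ?_
      (summable_inv_odd_sq.mul_left (2 * (2 * Real.pi * x) / Real.pi ^ 2))
    intro j
    have h1 := integral_norm_exp_mul_sin_le (ha j) hb
    have h2 : ∀ w, ‖F j w‖ = 2 * ‖Real.exp (-((2 * (j : ℝ) + 1) * Real.pi) * w) *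
        Real.sin (2 * Real.pi * x * w)‖ := fun w => by
      simp only [F]
      rw [norm_mul (2 : ℝ), Real.norm_ofNat]
    simp only [h2]
    rw [integral_const_mul]
    refine (mul_le_mul_of_nonneg_left h1 (by norm_num)).trans (le_of_eq ?_)
    field_simp
  have h := hasSum_integral_of_summable_integral_norm hF hs
  have h2 := (hasSum_tanh hx).mul_left (1 / (2 * Real.pi))
  have e1 : ∀ j, ∫ w in Set.Ioi (0 : ℝ), F j w =
      1 / (2 * Real.pi) * (8 * x / ((2 * (j : ℝ) + 1) ^ 2 + 4 * x ^ 2)) := by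
    intro j
    simp only [F]
    rw [integral_const_mul, integral_exp_mul_sin (ha j)]
    have : (2 * (j : ℝ) + 1) ^ 2 + 4 * x ^ 2 ≠ 0 := by positivity
    have : ((2 * (j : ℝ) + 1) * Real.pi) ^ 2 + (2 * Real.pi * x) ^ 2 ≠ 0 := by positivity
    field_simp
    ring
  simp only [e1] at h
  have h3 := h.unique h2
  have e2 : ∫ w in Set.Ioi (0 : ℝ), ∑' j, F j w =
      ∫ w in Set.Ioi (0 : ℝ), Real.sin (2 * Real.pi * w * x) / Real.sinh (Real.pi * w) := by
    refine setIntegral_congr_fun measurableSet_Ioi fun w hw => ?_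
    have h4 := (hasSum_inv_sinh (mul_pos hp hw)).mul_right (Real.sin (2 * Real.pi * w * x))
    rw [div_eq_mul_one_div, mul_comm, ← h4.tsum_eq]
    refine tsum_congr fun j => ?_
    simp only [F]
    rw [← mul_assoc, show 2 * Real.pi * x * w = 2 * Real.pi * w * x by ring]
    congr 3
    ring
  rw [← e2, h3]
  field_simp

theorem integrable_sinKernel (u : ℝ) : Integrable (sinKernel u) := by
  refine ((integrable_exp_neg_mul_abs (by positivity : 0 < Real.pi / 2)).const_mul
    (8 * |u|)).mono' ?_ (Filter.Eventually.of_forall fun w => abs_sinKernel_le u w)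
  exact (continuous_sinKernel.comp (Continuous.prodMk_right u)).aestronglyMeasurable

theorem sinKernel_abs (u w : ℝ) : sinKernel u |w| = sinKernel u w := by
  rcases abs_choice w with h | h
  · rw [h]
  · rw [h]; unfold sinKernel
    rw [mul_neg, mul_neg, neg_mul, Real.sinc_neg, ← sinhc_abs (-(Real.pi * w)), abs_neg, sinhc_abs]

theorem sinKernel_neg (u w : ℝ) : sinKernel (-u) w = -sinKernel u w := by
  unfold sinKernel
  rw [mul_neg, mul_neg, Real.sinc_neg]; ring

theorem integral_sinKernel (u : ℝ) : ∫ w, sinKernel u w = Real.tanh (Real.pi * u) := by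
  have hpos : ∀ u : ℝ, 0 < u → ∫ w, sinKernel u w = Real.tanh (Real.pi * u) := by
    intro u hu
    have h := integral_comp_abs (f := sinKernel u)
    simp only [sinKernel_abs] at h
    rw [h]
    have h2 : ∫ w in Set.Ioi (0 : ℝ), sinKernel u w =
        ∫ w in Set.Ioi (0 : ℝ), Real.sin (2 * Real.pi * w * u) / Real.sinh (Real.pi * w) :=
      setIntegral_congr_fun measurableSet_Ioi fun w hw => sinKernel_of_ne (ne_of_gt hw)
    rw [h2, integral_sin_div_sinh hu]; ring
  rcases lt_trichotomy u 0 with h | h | h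
  · have := hpos (-u) (by linarith)
    simp only [sinKernel_neg] at this
    rw [integral_neg, mul_neg, Real.tanh_neg] at this
    linarith
  · subst h
    simp [sinKernel]
  · exact hpos u h

theorem cos_mul_sinKernel (u v w : ℝ) :
    Real.cos (2 * Real.pi * w * v) * sinKernel u w =
      (sinKernel (u + v) w + sinKernel (u - v) w) / 2 := by
  by_cases hw : w = 0
  · subst hw
    simp only [sinKernel_zero]; simp; ring
  · rw [sinKernel_of_ne hw, sinKernel_of_ne hw, sinKernel_of_ne hw, mul_add, mul_sub,
      Real.sin_add, Real.sin_sub]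
    ring

theorem tanh_add_tanh (A B : ℝ) : Real.tanh (A + B) + Real.tanh (A - B) =
    2 * Real.sinh (2 * A) / (Real.cosh (2 * A) + Real.cosh (2 * B)) := by
  rw [Real.tanh_eq_sinh_div_cosh, Real.tanh_eq_sinh_div_cosh]
  have h1 := (Real.cosh_pos (A + B)).ne'
  have h2 := (Real.cosh_pos (A - B)).ne'
  have h3 : Real.cosh (2 * A) + Real.cosh (2 * B) = 2 * (Real.cosh (A + B) * Real.cosh (A - B)) := by
    have e1 : Real.cosh (2 * A) = Real.cosh (A + B) * Real.cosh (A - B) +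
        Real.sinh (A + B) * Real.sinh (A - B) := by
      rw [← Real.cosh_add]; congr 1; ring
    have e2 : Real.cosh (2 * B) = Real.cosh (A + B) * Real.cosh (A - B) -
        Real.sinh (A + B) * Real.sinh (A - B) := by
      rw [← Real.cosh_sub]; congr 1; ring
    rw [e1, e2]; ring
  have h4 : Real.sinh (2 * A) = Real.sinh (A + B) * Real.cosh (A - B) +
      Real.cosh (A + B) * Real.sinh (A - B) := by
    rw [show 2 * A = (A + B) + (A - B) by ring, Real.sinh_add]
  rw [h3, h4]
  field_simp

theorem inv_cosh_le (B : ℝ) : 1 / Real.cosh B ≤ 2 * Real.exp (-|B|) := by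
  rw [← Real.cosh_abs, div_le_iff₀ (Real.cosh_pos _), Real.cosh_eq]
  have : Real.exp (-|B|) * Real.exp |B| = 1 := by rw [← Real.exp_add]; simp
  nlinarith [sq_nonneg (Real.exp (-|B|))]

theorem abs_tanh_add_tanh_le (A B : ℝ) :
    |Real.tanh (A + B) + Real.tanh (A - B)| ≤
      4 * |Real.sinh (2 * A)| * Real.exp (-|2 * B|) := by
  rw [tanh_add_tanh, abs_div, abs_mul, abs_two, abs_of_pos
    (add_pos (Real.cosh_pos _) (Real.cosh_pos _))]
  have h1 := inv_cosh_le (2 * B)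
  have h2 : 1 / (Real.cosh (2 * A) + Real.cosh (2 * B)) ≤ 1 / Real.cosh (2 * B) :=
    one_div_le_one_div_of_le (Real.cosh_pos _) (by linarith [Real.cosh_pos (2 * A)])
  rw [div_eq_mul_one_div]
  calc _ ≤ 2 * |Real.sinh (2 * A)| * (2 * Real.exp (-|2 * B|)) := by
        gcongr; exact h2.trans h1
    _ = _ := by ring

theorem summable_exp_neg_abs_int {a : ℝ} (ha : 0 < a) :
    Summable fun k : ℤ => Real.exp (-(a * |(k : ℝ)|)) := by
  have h1 : Summable fun n : ℕ => Real.exp (-(a * n)) := by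
    have := summable_geometric_of_lt_one (Real.exp_pos (-a)).le (Real.exp_lt_one_iff.2 (by linarith))
    refine this.congr fun n => ?_
    rw [← Real.exp_nat_mul]; congr 1; ring
  refine Summable.of_nat_of_neg ?_ ?_
  · simpa using h1
  · simpa using h1

theorem poisson_sinKernel {y : ℝ} (hy : 0 < y) (t : ℝ) :
    ∑' n : ℤ, sinKernel (y * t) (n / y) / y =
      ∑' k : ℤ, (Real.tanh (Real.pi * (y * t) + Real.pi * (y * k)) +
        Real.tanh (Real.pi * (y * t) - Real.pi * (y * k))) / 2 := by
  have hp := Real.pi_pos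
  let g : ℝ → ℝ := fun x => sinKernel (y * t) (x / y) / y
  have hgc : Continuous g :=
    (continuous_sinKernel.comp (Continuous.prodMk continuous_const (by fun_prop))).div_const y
  have hgi : Integrable g := ((integrable_sinKernel (y * t)).comp_div hy.ne').div_const y
  let f : ℝ → ℂ := fun x => (g x : ℂ)
  have hfc : Continuous f := continuous_ofReal.comp hgc
  have hF : ∀ κ : ℝ, FourierTransform.fourier f κ = (((Real.tanh (Real.pi * (y * t) + Real.pi * (y * κ)) +
        Real.tanh (Real.pi * (y * t) - Real.pi * (y * κ))) / 2 : ℝ) : ℂ) := by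
    intro κ
    rw [Real.fourier_real_eq_integral_exp_smul]
    have hci : Integrable fun x => Real.cos (2 * Real.pi * x * κ) * g x := by
      refine hgi.norm.mono' (by fun_prop) (Filter.Eventually.of_forall fun x => ?_)
      rw [norm_mul]
      exact mul_le_of_le_one_left (norm_nonneg _) (Real.abs_cos_le_one _)
    have hsi : Integrable fun x => Real.sin (2 * Real.pi * x * κ) * g x := by
      refine hgi.norm.mono' (by fun_prop) (Filter.Eventually.of_forall fun x => ?_)
      rw [norm_mul]
      exact mul_le_of_le_one_left (norm_nonneg _) (Real.abs_sin_le_one _)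
    have hs0 : ∫ x, Real.sin (2 * Real.pi * x * κ) * g x = 0 := by
      have h1 := integral_neg_eq_self (fun x => Real.sin (2 * Real.pi * x * κ) * g x) volume
      have h2 : ∀ x, Real.sin (2 * Real.pi * (-x) * κ) * g (-x) =
          -(Real.sin (2 * Real.pi * x * κ) * g x) := by
        intro x
        have h3 : g (-x) = g x := by
          simp only [g]
          rw [← sinKernel_abs _ (-x / y), neg_div, abs_neg, sinKernel_abs]
        rw [h3, show 2 * Real.pi * (-x) * κ = -(2 * Real.pi * x * κ) by ring, Real.sin_neg]
        ring
      simp only [h2] at h1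
      rw [integral_neg] at h1
      linarith
    have hc : ∫ x, Real.cos (2 * Real.pi * x * κ) * g x =
        (Real.tanh (Real.pi * (y * t) + Real.pi * (y * κ)) +
        Real.tanh (Real.pi * (y * t) - Real.pi * (y * κ))) / 2 := by
      have h1 : ∀ x, Real.cos (2 * Real.pi * x * κ) * g x =
          (fun w => (sinKernel (y * t + y * κ) w + sinKernel (y * t - y * κ) w) / 2 / y) (x / y) := by
        intro x
        simp only [g]
        rw [← cos_mul_sinKernel, mul_div_assoc]
        congr 2
        field_simp
      rw [integral_congr_ae (Filter.Eventually.of_forall h1),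
        Measure.integral_comp_div
          (fun w => (sinKernel (y * t + y * κ) w + sinKernel (y * t - y * κ) w) / 2 / y),
        abs_of_pos hy, integral_div, integral_div,
        integral_add (integrable_sinKernel _) (integrable_sinKernel _),
        integral_sinKernel, integral_sinKernel, mul_add, mul_sub, smul_eq_mul]
      field_simp
    have h1 : ∀ x : ℝ, Complex.exp (((-2 * Real.pi * x * κ : ℝ) : ℂ) * I) • f x =
        ((Real.cos (2 * Real.pi * x * κ) * g x : ℝ) : ℂ) -
          I * ((Real.sin (2 * Real.pi * x * κ) * g x : ℝ) : ℂ) := by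
      intro x
      rw [Complex.exp_mul_I, ← ofReal_cos, ← ofReal_sin,
        show -2 * Real.pi * x * κ = -(2 * Real.pi * x * κ) by ring, Real.cos_neg, Real.sin_neg]
      simp only [f, smul_eq_mul]
      push_cast; ring
    have h2 := integral_sub (μ := volume) (hci.ofReal (𝕜 := ℂ))
      ((hsi.ofReal (𝕜 := ℂ)).const_mul I)
    rw [integral_congr_ae (Filter.Eventually.of_forall h1)]
    refine h2.trans ?_
    simp only [coe_algebraMap]
    rw [integral_const_mul, integral_complex_ofReal, integral_complex_ofReal, hs0, hc]
    simp
  have hsum : Summable fun n : ℤ => FourierTransform.fourier f n := by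
    simp only [hF]
    refine Summable.of_norm_bounded ((summable_exp_neg_abs_int
      (by positivity : 0 < 2 * (Real.pi * y))).mul_left
        (2 * |Real.sinh (2 * (Real.pi * (y * t)))|)) fun k => ?_
    rw [Complex.norm_real, Real.norm_eq_abs, abs_div, abs_two]
    have := abs_tanh_add_tanh_le (Real.pi * (y * t)) (Real.pi * (y * k))
    have h2 : |2 * (Real.pi * (y * (k : ℝ)))| = 2 * (Real.pi * y) * |(k : ℝ)| := by
      rw [show 2 * (Real.pi * (y * (k : ℝ))) = (2 * (Real.pi * y)) * k by ring, abs_mul,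
        abs_of_pos (by positivity : 0 < 2 * (Real.pi * y))]
    rw [h2] at this
    linarith
  have hdecay : Asymptotics.IsBigO (Filter.cocompact ℝ) f fun x : ℝ => |x| ^ (-(2 : ℝ)) := by
    have hlit : Filter.Tendsto (fun x : ℝ => |x|) (Filter.cocompact ℝ) Filter.atTop := by
      exact tendsto_norm_cocompact_atTop (E := ℝ)
    have h2 := (isLittleO_exp_neg_mul_rpow_atTop (a := Real.pi / (2 * y)) (by positivity)
      (-2)).isBigO.comp_tendsto hlit
    refine Asymptotics.IsBigO.trans ?_ h2
    refine Asymptotics.IsBigO.of_bound (8 * |y * t| / y) (Filter.Eventually.of_forall fun x => ?_)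
    simp only [f, g, Function.comp]
    rw [Complex.norm_real, Real.norm_eq_abs, abs_div, abs_of_pos hy, Real.norm_eq_abs,
      abs_of_pos (Real.exp_pos _), div_mul_eq_mul_div]
    gcongr
    refine (abs_sinKernel_le _ _).trans (le_of_eq ?_)
    rw [abs_div, abs_of_pos hy]
    congr 2
    field_simp
  have h := Real.tsum_eq_tsum_fourier_of_rpow_decay_of_summable hfc (by norm_num : (1 : ℝ) < 2)
    hdecay hsum 0
  simp only [zero_add, hF, f, g] at h
  have e0 : ∀ n : ℤ, (fourier n) ((0 : ℝ) : UnitAddCircle) = (1 : ℂ) := by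
    intro n; simp
  simp only [e0, mul_one] at h
  rw [← ofReal_tsum, ← ofReal_tsum] at h
  exact ofReal_injective h

theorem integral_gauss_mul_exp {b : ℝ} (hb : 0 < b) (c : ℝ) :
    ∫ t : ℝ, Real.exp (-b * t ^ 2) * Real.exp (c * t) =
      Real.sqrt (Real.pi / b) * Real.exp (c ^ 2 / (4 * b)) := by
  have h1 : ∀ t : ℝ, Real.exp (-b * t ^ 2) * Real.exp (c * t) =
      Real.exp (c ^ 2 / (4 * b)) * (fun s => Real.exp (-b * s ^ 2)) (t - c / (2 * b)) := by
    intro t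
    simp only
    rw [← Real.exp_add, ← Real.exp_add]; congr 1; field_simp; ring
  rw [integral_congr_ae (Filter.Eventually.of_forall h1), integral_const_mul,
    integral_sub_right_eq_self (fun s => Real.exp (-b * s ^ 2)), integral_gaussian, mul_comm]

theorem integrable_gauss_mul_exp {b : ℝ} (hb : 0 < b) (c : ℝ) :
    Integrable fun t : ℝ => Real.exp (-b * t ^ 2) * Real.exp (c * t) := by
  have h1 : ∀ t : ℝ, Real.exp (-b * t ^ 2) * Real.exp (c * t) =
      Real.exp (c ^ 2 / (4 * b)) * (fun s => Real.exp (-b * s ^ 2)) (t - c / (2 * b)) := by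
    intro t
    simp only
    rw [← Real.exp_add, ← Real.exp_add]; congr 1; field_simp; ring
  have := ((integrable_exp_neg_mul_sq hb).comp_sub_right (c / (2 * b))).const_mul
    (Real.exp (c ^ 2 / (4 * b)))
  exact this.congr (Filter.Eventually.of_forall fun t => (h1 t).symm)

theorem alternating_sum_eq (a : ℕ → ℝ) (n : ℕ) (hn : 0 < n) :
    ∑ i ∈ Finset.range n, (-1) ^ i * (a i - a (i + 1)) =
      ∑ m ∈ Finset.Ioo (-(n : ℤ)) n, (-1) ^ m.natAbs * a m.natAbs + (-1) ^ n * a n := by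
  induction n, hn using Nat.le_induction with
  | base =>
    have : Finset.Ioo (-((1 : ℕ) : ℤ)) ((1 : ℕ) : ℤ) = {0} := by decide
    simp only [Nat.succ_eq_add_one, Nat.zero_add]
    rw [this]; simp; ring
  | succ n hn ih =>
    have h1 : Finset.Ioo (-((n + 1 : ℕ) : ℤ)) ((n + 1 : ℕ) : ℤ) =
        insert (n : ℤ) (insert (-(n : ℤ)) (Finset.Ioo (-(n : ℤ)) n)) := by
      ext m; simp only [Finset.mem_Ioo, Finset.mem_insert]; push_cast; omega
    rw [Finset.sum_range_succ, ih, h1, Finset.sum_insert, Finset.sum_insert]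
    · simp only [Int.natAbs_neg, Int.natAbs_natCast, pow_succ]; ring
    · simp
    · simp; omega

theorem continuous_tanh : Continuous Real.tanh := by
  have : Real.tanh = fun x => Real.sinh x / Real.cosh x := funext Real.tanh_eq_sinh_div_cosh
  rw [this]
  exact Real.continuous_sinh.div Real.continuous_cosh fun x => (Real.cosh_pos x).ne'

theorem integrable_gauss_mul_bounded {b : ℝ} (hb : 0 < b) {f : ℝ → ℝ} (hf : Continuous f)
    (h1 : ∀ t, |f t| ≤ 1) : Integrable fun t : ℝ => Real.exp (-b * t ^ 2) * f t := by
  refine (integrable_exp_neg_mul_sq hb).mono' (by fun_prop) (Filter.Eventually.of_forall fun t => ?_)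
  rw [norm_mul, Real.norm_eq_abs, abs_of_pos (Real.exp_pos _)]
  exact mul_le_of_le_one_right (Real.exp_pos _).le (h1 t)

theorem integrable_gauss_mul_tanh {y : ℝ} (hy : 0 < y) (c : ℝ) :
    Integrable fun t : ℝ => Real.exp (-(2 * Real.pi * y) * t ^ 2) *
      Real.tanh (Real.pi * (y * t) + c) := by
  have := Real.pi_pos
  exact integrable_gauss_mul_bounded (by positivity) (continuous_tanh.comp (by fun_prop))
    fun t => (Real.abs_tanh_lt_one _).le

theorem integral_gauss_mul_tanh_neg (y : ℝ) (c : ℝ) :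
    ∫ t : ℝ, Real.exp (-(2 * Real.pi * y) * t ^ 2) * Real.tanh (Real.pi * (y * t) - c) =
      -∫ t : ℝ, Real.exp (-(2 * Real.pi * y) * t ^ 2) * Real.tanh (Real.pi * (y * t) + c) := by
  rw [← integral_neg_eq_self, ← integral_neg]
  congr 1; funext t
  rw [show Real.pi * (y * -t) - c = -(Real.pi * (y * t) + c) by ring, Real.tanh_neg, neg_sq]
  ring

theorem tanh_mul_exp_identity (E : ℝ) (hE : 0 < E) (n : ℕ) :
    (E - 1) / (E + 1) * E ^ (2 * n) = (E - 1) / (E + 1) +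
      ∑ i ∈ Finset.range (2 * n), (-1) ^ i * (E ^ i - E ^ (i + 1)) := by
  have h1 : ∑ i ∈ Finset.range (2 * n), (-1) ^ i * (E ^ i - E ^ (i + 1)) =
      (1 - E) * ∑ i ∈ Finset.range (2 * n), (-E) ^ i := by
    rw [Finset.mul_sum]
    refine Finset.sum_congr rfl fun i _ => ?_
    rw [neg_pow E, pow_succ]; ring
  have h2 := mul_neg_geom_sum (-E) (2 * n)
  rw [pow_mul, neg_sq, ← pow_mul] at h2
  rw [h1]
  have h3 : ∑ i ∈ Finset.range (2 * n), (-E) ^ i = (1 - E ^ (2 * n)) / (1 + E) := by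
    rw [eq_div_iff (by positivity), ← h2]; ring
  rw [h3]
  have : E + 1 ≠ 0 := by positivity
  have : 1 + E ≠ 0 := by positivity
  field_simp
  ring

theorem integral_gauss_tanh_shift {y : ℝ} (hy : 0 < y) (k : ℕ) :
    ∫ t : ℝ, Real.exp (-(2 * Real.pi * y) * t ^ 2) *
      Real.tanh (Real.pi * (y * t) + Real.pi * (y * ((k : ℝ) + 1))) =
    Real.sqrt (1 / (2 * y)) * (middleSum (-Real.exp (-(Real.pi * y / 2))) k + 1) := by
  have hp := Real.pi_pos
  have hb : 0 < 2 * Real.pi * y := by positivity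
  set K : ℝ := (k : ℝ) + 1 with hK
  set b := 2 * Real.pi * y with hbd
  have hI : ∀ m : ℕ, ∫ t : ℝ, Real.exp (-b * t ^ 2) * Real.exp (b * t) ^ m =
      Real.sqrt (1 / (2 * y)) * Real.exp (Real.pi * y * m ^ 2 / 2) := by
    intro m
    have := integral_gauss_mul_exp hb (m * b)
    simp only [← Real.exp_nat_mul, ← mul_assoc]
    rw [this, hbd]
    congr 2
    · field_simp
    · field_simp; norm_num
  have hIi : ∀ m : ℕ, Integrable fun t : ℝ => Real.exp (-b * t ^ 2) * Real.exp (b * t) ^ m := by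
    intro m
    have := integrable_gauss_mul_exp hb (m * b)
    simpa only [← Real.exp_nat_mul, ← mul_assoc] using this
  rw [← integral_sub_right_eq_self _ K]
  have h1 : ∀ t : ℝ, Real.exp (-b * (t - K) ^ 2) *
      Real.tanh (Real.pi * (y * (t - K)) + Real.pi * (y * K)) =
      Real.exp (-b * K ^ 2) * (Real.exp (-b * t ^ 2) * Real.tanh (Real.pi * (y * t) + 0) +
        ∑ i ∈ Finset.range (2 * (k + 1)), (-1) ^ i * (Real.exp (-b * t ^ 2) * Real.exp (b * t) ^ i
          - Real.exp (-b * t ^ 2) * Real.exp (b * t) ^ (i + 1))) := by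
    intro t
    have ht : Real.tanh (Real.pi * (y * t)) =
        (Real.exp (b * t) - 1) / (Real.exp (b * t) + 1) := by
      rw [Real.tanh_eq, Real.exp_neg, show b * t = Real.pi * (y * t) + Real.pi * (y * t) by
        rw [hbd]; ring, Real.exp_add]
      have := Real.exp_pos (Real.pi * (y * t))
      field_simp
    rw [show Real.pi * (y * (t - K)) + Real.pi * (y * K) = Real.pi * (y * t) by ring, add_zero, ht]
    have h2 := tanh_mul_exp_identity (Real.exp (b * t)) (Real.exp_pos _) (k + 1)
    have h3 : Real.exp (-b * (t - K) ^ 2) = Real.exp (-b * K ^ 2) * Real.exp (-b * t ^ 2) *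
        Real.exp (b * t) ^ (2 * (k + 1)) := by
      rw [← Real.exp_nat_mul, ← Real.exp_add, ← Real.exp_add, hK]; congr 1; push_cast; ring
    have h4 : ∑ i ∈ Finset.range (2 * (k + 1)), (-1) ^ i *
        (Real.exp (-b * t ^ 2) * Real.exp (b * t) ^ i
          - Real.exp (-b * t ^ 2) * Real.exp (b * t) ^ (i + 1)) = Real.exp (-b * t ^ 2) *
        ∑ i ∈ Finset.range (2 * (k + 1)), (-1) ^ i *
          (Real.exp (b * t) ^ i - Real.exp (b * t) ^ (i + 1)) := by
      rw [Finset.mul_sum]; refine Finset.sum_congr rfl fun i _ => ?_; ring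
    rw [h3, h4, mul_assoc, mul_assoc, mul_comm (Real.exp (b * t) ^ (2 * (k + 1))), h2]
    ring
  have h0 : ∫ t : ℝ, Real.exp (-b * t ^ 2) * Real.tanh (Real.pi * (y * t) + 0) = 0 := by
    have := integral_gauss_mul_tanh_neg y 0
    simp only [sub_zero, add_zero] at this ⊢
    linarith
  have hd : ∀ i : ℕ, Integrable fun t : ℝ => (-1) ^ i * (Real.exp (-b * t ^ 2) *
      Real.exp (b * t) ^ i - Real.exp (-b * t ^ 2) * Real.exp (b * t) ^ (i + 1)) :=
    fun i => ((hIi i).sub (hIi (i + 1))).const_mul _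
  have ht0 : Integrable fun t : ℝ => Real.exp (-b * t ^ 2) * Real.tanh (Real.pi * (y * t) + 0) :=
    integrable_gauss_mul_tanh hy 0
  rw [integral_congr_ae (Filter.Eventually.of_forall h1), integral_const_mul, integral_add
    ht0 (integrable_finsetSum _ fun i _ => hd i), h0, zero_add, integral_finsetSum _ fun i _ => hd i]
  have h5 : ∀ i : ℕ, ∫ t : ℝ, (-1) ^ i * (Real.exp (-b * t ^ 2) * Real.exp (b * t) ^ i
          - Real.exp (-b * t ^ 2) * Real.exp (b * t) ^ (i + 1)) =
      (-1) ^ i * ((fun m : ℕ => Real.sqrt (1 / (2 * y)) * Real.exp (Real.pi * y * m ^ 2 / 2)) i -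
        (fun m : ℕ => Real.sqrt (1 / (2 * y)) * Real.exp (Real.pi * y * m ^ 2 / 2)) (i + 1)) := by
    intro i
    rw [integral_const_mul, integral_sub (hIi i) (hIi (i + 1)), hI, hI]
  simp only [h5]
  rw [alternating_sum_eq (fun m : ℕ => Real.sqrt (1 / (2 * y)) *
    Real.exp (Real.pi * y * m ^ 2 / 2)) _ (by omega), mul_add (Real.exp (-b * K ^ 2)),
    mul_add (Real.sqrt (1 / (2 * y)))]
  congr 1
  · unfold middleSum
    rw [Finset.mul_sum, Finset.mul_sum]
    push_cast
    rw [show 2 * ((k : ℤ) + 1) = 2 * k + 2 by ring]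
    refine Finset.sum_congr rfl fun m hm => ?_
    rw [Finset.mem_Ioo] at hm
    have h2 : 0 ≤ 4 * ((k : ℤ) + 1) ^ 2 - m ^ 2 := by nlinarith
    have h3 := Int.toNat_of_nonneg h2
    set e := (4 * ((k : ℤ) + 1) ^ 2 - m ^ 2).toNat with he
    have hpar : (-1 : ℝ) ^ e = (-1) ^ m.natAbs := by
      rw [neg_one_pow_eq_pow_mod_two, neg_one_pow_eq_pow_mod_two m.natAbs]
      congr 1
      rcases Int.even_or_odd' m with ⟨j, hj | hj⟩
      · have : (e : ℤ) = 2 * (2 * ((k : ℤ) + 1) ^ 2 - 2 * j ^ 2) := by rw [h3, hj]; ring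
        omega
      · have : (e : ℤ) = 2 * (2 * ((k : ℤ) + 1) ^ 2 - 2 * j ^ 2 - 2 * j - 1) + 1 := by
          rw [h3, hj]; ring
        omega
    have he2 : (e : ℝ) = 4 * K ^ 2 - (m.natAbs : ℝ) ^ 2 := by
      have h4 : ((m.natAbs : ℕ) : ℝ) ^ 2 = (m : ℝ) ^ 2 := by
        have := congrArg (fun z : ℤ => (z : ℝ)) (Int.natAbs_sq m)
        push_cast at this
        simp
      rw [h4, hK]
      exact_mod_cast h3
    rw [neg_pow _ e, hpar, ← Real.exp_nat_mul, he2]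
    have : Real.exp (-b * K ^ 2) * Real.exp (Real.pi * y * (m.natAbs : ℝ) ^ 2 / 2) =
        Real.exp ((4 * K ^ 2 - (m.natAbs : ℝ) ^ 2) * -(Real.pi * y / 2)) := by
      rw [← Real.exp_add, hbd]; congr 1; ring
    rw [← this]; ring
  · rw [pow_mul, neg_one_sq, one_pow, one_mul, mul_one, mul_comm, mul_assoc, ← Real.exp_add]
    have : Real.pi * y * ((2 * (k + 1) : ℕ) : ℝ) ^ 2 / 2 + -b * K ^ 2 = 0 := by
      rw [hbd, hK]; push_cast; ring
    rw [this, Real.exp_zero, mul_one]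

theorem tanh_mul_tanh_add {A B : ℝ} (hB : 0 < B) :
    Real.tanh A * ((Real.tanh (A + B) + Real.tanh (A - B)) / 2) =
      1 - Real.cosh B / Real.sinh B * ((Real.tanh (A + B) - Real.tanh (A - B)) / 2) := by
  have hs : Real.sinh B ≠ 0 := (Real.sinh_pos_iff.2 hB).ne'
  have hA := (Real.cosh_pos A).ne'
  have h1 := (Real.cosh_pos (A + B)).ne'
  have h2 := (Real.cosh_pos (A - B)).ne'
  simp only [Real.tanh_eq_sinh_div_cosh]
  have e1 : Real.sinh (A + B) * Real.cosh (A - B) + Real.sinh (A - B) * Real.cosh (A + B) =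
      2 * Real.sinh A * Real.cosh A := by
    rw [← Real.sinh_two_mul, mul_comm (Real.sinh (A - B)), ← Real.sinh_add]; congr 1; ring
  have e2 : Real.sinh (A + B) * Real.cosh (A - B) - Real.sinh (A - B) * Real.cosh (A + B) =
      2 * Real.sinh B * Real.cosh B := by
    rw [← Real.sinh_two_mul, mul_comm (Real.sinh (A - B)), ← Real.sinh_sub]; congr 1; ring
  have e3 : Real.cosh (A + B) * Real.cosh (A - B) = Real.sinh A ^ 2 + Real.cosh B ^ 2 := by
    rw [Real.cosh_add, Real.cosh_sub]
    have := Real.cosh_sq A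
    have := Real.cosh_sq B
    nlinarith
  rw [div_add_div _ _ h1 h2, div_sub_div _ _ h1 h2, mul_comm (Real.cosh (A + B)) (Real.sinh (A - B)),
    e1, e2, e3]
  have : Real.sinh A ^ 2 + Real.cosh B ^ 2 ≠ 0 := by rw [← e3]; exact mul_ne_zero h1 h2
  field_simp
  ring

/-- The weighted integrals appearing on the dual side of Poisson summation. -/
def tanhMoment (y k : ℝ) : ℝ :=
  ∫ t : ℝ, Real.exp (-(2 * Real.pi * y) * t ^ 2) * Real.tanh (Real.pi * (y * t)) *
    ((Real.tanh (Real.pi * (y * t) + Real.pi * (y * k)) +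
      Real.tanh (Real.pi * (y * t) - Real.pi * (y * k))) / 2)

theorem tanhMoment_neg (y k : ℝ) : tanhMoment y (-k) = tanhMoment y k := by
  unfold tanhMoment
  congr 1; funext t
  rw [show Real.pi * (y * t) + Real.pi * (y * -k) = Real.pi * (y * t) - Real.pi * (y * k) by ring,
    show Real.pi * (y * t) - Real.pi * (y * -k) = Real.pi * (y * t) + Real.pi * (y * k) by ring,
    add_comm]

theorem tanhMoment_eq {y : ℝ} (hy : 0 < y) (k : ℕ) :
    tanhMoment y ((k : ℝ) + 1) = -(Real.sqrt (1 / (2 * y)) *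
      (geomFactor (-Real.exp (-(Real.pi * y / 2))) k *
        middleSum (-Real.exp (-(Real.pi * y / 2))) k +
          (geomFactor (-Real.exp (-(Real.pi * y / 2))) k - 1))) := by
  have hp := Real.pi_pos
  have hb : 0 < 2 * Real.pi * y := by positivity
  unfold tanhMoment
  set B := Real.pi * (y * ((k : ℝ) + 1)) with hB
  have hBp : 0 < B := by positivity
  have h1 : ∀ t : ℝ, Real.exp (-(2 * Real.pi * y) * t ^ 2) * Real.tanh (Real.pi * (y * t)) *
    ((Real.tanh (Real.pi * (y * t) + B) + Real.tanh (Real.pi * (y * t) - B)) / 2) =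
      Real.exp (-(2 * Real.pi * y) * t ^ 2) - Real.cosh B / Real.sinh B / 2 *
       (Real.exp (-(2 * Real.pi * y) * t ^ 2) * Real.tanh (Real.pi * (y * t) + B) -
        Real.exp (-(2 * Real.pi * y) * t ^ 2) * Real.tanh (Real.pi * (y * t) + (-B))) := by
    intro t
    rw [mul_assoc, tanh_mul_tanh_add hBp, ← sub_eq_add_neg]; ring
  have i1 := integrable_gauss_mul_tanh hy B
  have i2 := integrable_gauss_mul_tanh hy (-B)
  have i3 : Integrable fun t : ℝ => Real.cosh B / Real.sinh B / 2 *
       (Real.exp (-(2 * Real.pi * y) * t ^ 2) * Real.tanh (Real.pi * (y * t) + B) -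
        Real.exp (-(2 * Real.pi * y) * t ^ 2) * Real.tanh (Real.pi * (y * t) + (-B))) :=
    (i1.sub i2).const_mul _
  rw [integral_congr_ae (Filter.Eventually.of_forall h1), integral_sub
    (integrable_exp_neg_mul_sq hb) i3, integral_const_mul,
    integral_sub i1 i2, integral_gaussian]
  simp only [← sub_eq_add_neg]
  rw [integral_gauss_mul_tanh_neg, hB, integral_gauss_tanh_shift hy k, ← hB]
  have h2 : Real.pi / (2 * Real.pi * y) = 1 / (2 * y) := by field_simp
  have h3 : geomFactor (-Real.exp (-(Real.pi * y / 2))) k = Real.cosh B / Real.sinh B := by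
    unfold geomFactor
    have h4 : (-Real.exp (-(Real.pi * y / 2))) ^ (4 * (k + 1)) = Real.exp (-(2 * B)) := by
      rw [neg_pow, pow_mul, show (-1 : ℝ) ^ 4 = 1 by norm_num, one_pow, one_mul,
        ← Real.exp_nat_mul, hB]
      congr 1; push_cast; ring
    have h5 : Real.exp (-(2 * B)) = Real.exp (-B) * Real.exp (-B) := by
      rw [← Real.exp_add]; congr 1; ring
    have h6 : Real.exp B * Real.exp (-B) = 1 := by rw [← Real.exp_add]; simp
    have h7 : Real.exp (-B) < Real.exp B := Real.exp_lt_exp.2 (by linarith)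
    have h8 : Real.exp (-B) < 1 := Real.exp_lt_one_iff.2 (by linarith)
    rw [h4, h5, Real.cosh_eq, Real.sinh_eq]
    have p1 := Real.exp_pos (-B)
    have n1 : 1 - Real.exp (-B) * Real.exp (-B) ≠ 0 := by nlinarith
    have n2 : Real.exp B - Real.exp (-B) ≠ 0 := by linarith
    rw [div_div_div_cancel_right₀ (by norm_num), div_eq_div_iff n1 n2]
    nlinarith [h6]
  rw [h2, h3]
  ring

/-- The Gaussian weight times the hyperbolic tangent. -/
def gaussTanh (y t : ℝ) : ℝ := Real.exp (-(2 * Real.pi * y) * t ^ 2) * Real.tanh (Real.pi * (y * t))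

/-- First moment of `gaussTanh`. -/
def gaussTanhMoment (y : ℝ) : ℝ := ∫ t : ℝ, t * gaussTanh y t

theorem continuous_gaussTanh (y : ℝ) : Continuous (gaussTanh y) := by
  unfold gaussTanh
  exact Continuous.mul (by fun_prop) (continuous_tanh.comp (by fun_prop))

theorem abs_gaussTanh_le (y t : ℝ) :
    |gaussTanh y t| ≤ Real.exp (-(2 * Real.pi * y) * t ^ 2) := by
  unfold gaussTanh
  rw [abs_mul, abs_of_pos (Real.exp_pos _)]
  exact mul_le_of_le_one_right (Real.exp_pos _).le (Real.abs_tanh_lt_one _).le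

theorem hasSum_integral_of_le_mul {ι : Type*} [Countable ι] {F : ι → ℝ → ℝ} {g : ℝ → ℝ}
    {c : ι → ℝ} (hF : ∀ i, Continuous (F i)) (hg : Integrable g) (hc : Summable c)
    (h : ∀ i t, |F i t| ≤ c i * g t) :
    HasSum (fun i => ∫ t, F i t) (∫ t, ∑' i, F i t) := by
  have hi : ∀ i, Integrable (F i) := fun i => (hg.const_mul (c i)).mono'
    (hF i).aestronglyMeasurable (Filter.Eventually.of_forall (h i))
  refine hasSum_integral_of_summable_integral_norm hi ?_
  refine Summable.of_nonneg_of_le (fun i => integral_nonneg fun t => norm_nonneg _) (fun i => ?_)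
    (hc.mul_right (∫ t, g t))
  rw [← integral_const_mul]
  exact integral_mono (hi i).norm (hg.const_mul _) (h i)

theorem integrable_abs_mul_gauss {b : ℝ} (hb : 0 < b) :
    Integrable fun t : ℝ => |t| * Real.exp (-b * t ^ 2) := by
  refine (integrable_mul_exp_neg_mul_sq hb).norm.congr (Filter.Eventually.of_forall fun t => ?_)
  simp [abs_of_pos (Real.exp_pos _)]

theorem integrable_id_mul_gaussTanh {y : ℝ} (hy : 0 < y) :
    Integrable fun t : ℝ => t * gaussTanh y t := by
  have := Real.pi_pos
  refine (integrable_abs_mul_gauss (b := 2 * Real.pi * y) (by positivity)).mono'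
    (continuous_id.mul (continuous_gaussTanh y)).aestronglyMeasurable
    (Filter.Eventually.of_forall fun t => ?_)
  rw [norm_mul, Real.norm_eq_abs, Real.norm_eq_abs]
  exact mul_le_mul_of_nonneg_left (abs_gaussTanh_le y t) (abs_nonneg t)

theorem hasSum_tanhMoment {y : ℝ} (hy : 0 < y) :
    HasSum (fun k : ℤ => tanhMoment y k) (∫ t, ∑' k : ℤ, gaussTanh y t *
      ((Real.tanh (Real.pi * (y * t) + Real.pi * (y * k)) +
        Real.tanh (Real.pi * (y * t) - Real.pi * (y * k))) / 2)) := by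
  have hp := Real.pi_pos
  have hb : 0 < 2 * Real.pi * y := by positivity
  refine hasSum_integral_of_le_mul (F := fun (k : ℤ) t => gaussTanh y t *
      ((Real.tanh (Real.pi * (y * t) + Real.pi * (y * k)) +
        Real.tanh (Real.pi * (y * t) - Real.pi * (y * k))) / 2))
    (g := fun t => Real.exp (-(2 * Real.pi * y) * t ^ 2) * Real.exp ((2 * Real.pi * y) * t) +
      Real.exp (-(2 * Real.pi * y) * t ^ 2) * Real.exp (-(2 * Real.pi * y) * t))
    (c := fun k => Real.exp (-(2 * Real.pi * y * |(k : ℝ)|))) (fun k => ?_)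
    ((integrable_gauss_mul_exp hb _).add (integrable_gauss_mul_exp hb _))
    (summable_exp_neg_abs_int hb) (fun k t => ?_)
  · exact (continuous_gaussTanh y).mul (((continuous_tanh.comp (by fun_prop)).add
      (continuous_tanh.comp (by fun_prop))).div_const 2)
  · rw [abs_mul, abs_div, abs_two]
    have h1 := abs_tanh_add_tanh_le (Real.pi * (y * t)) (Real.pi * (y * k))
    have h2 : |2 * (Real.pi * (y * (k : ℝ)))| = 2 * Real.pi * y * |(k : ℝ)| := by
      rw [show 2 * (Real.pi * (y * (k : ℝ))) = (2 * Real.pi * y) * k by ring, abs_mul,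
        abs_of_pos hb]
    rw [h2] at h1
    have h3 : 2 * |Real.sinh (2 * (Real.pi * (y * t)))| ≤
        Real.exp ((2 * Real.pi * y) * t) + Real.exp (-(2 * Real.pi * y) * t) := by
      rw [show 2 * (Real.pi * (y * t)) = (2 * Real.pi * y) * t by ring, Real.sinh_eq, abs_div,
        abs_two, mul_div_cancel₀ _ (two_ne_zero), ← neg_mul]
      have p1 := Real.exp_pos ((2 * Real.pi * y) * t)
      have p2 := Real.exp_pos (-(2 * Real.pi * y) * t)
      rw [abs_le]; constructor <;> linarith
    have h4 := abs_gaussTanh_le y t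
    set E := Real.exp (-(2 * Real.pi * y) * t ^ 2)
    set D := Real.exp (-(2 * Real.pi * y * |(k : ℝ)|)) with hD
    have hD0 : 0 < D := Real.exp_pos _
    calc _ ≤ E * (D * (Real.exp ((2 * Real.pi * y) * t) + Real.exp (-(2 * Real.pi * y) * t))) := by
          refine mul_le_mul h4 ?_ (by positivity) (by positivity)
          rw [div_le_iff₀ two_pos]
          nlinarith
      _ = _ := by ring

theorem hasSum_gaussTanh_sinKernel {y : ℝ} (hy : 0 < y) :
    HasSum (fun n : ℤ => ∫ t, gaussTanh y t * (sinKernel (y * t) (n / y) / y))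
      (∫ t, ∑' n : ℤ, gaussTanh y t * (sinKernel (y * t) (n / y) / y)) := by
  have hp := Real.pi_pos
  have hb : 0 < 2 * Real.pi * y := by positivity
  refine hasSum_integral_of_le_mul
    (F := fun (n : ℤ) t => gaussTanh y t * (sinKernel (y * t) (n / y) / y))
    (g := fun t => 8 * (|t| * Real.exp (-(2 * Real.pi * y) * t ^ 2)))
    (c := fun n => Real.exp (-(Real.pi / (2 * y) * |(n : ℝ)|))) (fun n => ?_)
    ((integrable_abs_mul_gauss hb).const_mul 8)
    (summable_exp_neg_abs_int (by positivity)) (fun n t => ?_)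
  · exact (continuous_gaussTanh y).mul ((continuous_sinKernel.comp (by fun_prop :
      Continuous fun t : ℝ => (y * t, (n : ℝ) / y))).div_const y)
  · rw [abs_mul, abs_div, abs_of_pos hy]
    have h1 := abs_sinKernel_le (y * t) (n / y)
    rw [abs_div, abs_mul, abs_of_pos hy, show -(Real.pi / 2) * (|(n : ℝ)| / y) =
      -(Real.pi / (2 * y) * |(n : ℝ)|) by field_simp] at h1
    have h4 := abs_gaussTanh_le y t
    set E := Real.exp (-(2 * Real.pi * y) * t ^ 2)
    set D := Real.exp (-(Real.pi / (2 * y) * |(n : ℝ)|)) with hD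
    have hD0 : 0 < D := Real.exp_pos _
    calc _ ≤ E * (8 * |t| * D) := by
          refine mul_le_mul h4 ?_ (by positivity) (by positivity)
          rw [div_le_iff₀ hy]
          linarith
      _ = _ := by ring

theorem tanhMoment_zero {y : ℝ} (hy : 0 < y) :
    tanhMoment y 0 = Real.sqrt (1 / (2 * y)) - 4 * gaussTanhMoment y := by
  have hp := Real.pi_pos
  have hb : 0 < 2 * Real.pi * y := by positivity
  set f : ℝ → ℝ := fun t => Real.exp (-(2 * Real.pi * y) * t ^ 2) * Real.tanh (Real.pi * (y * t)) *
    Real.tanh (Real.pi * (y * t)) with hf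
  have if1 : Integrable f := by
    refine (integrable_exp_neg_mul_sq hb).mono' ?_ (Filter.Eventually.of_forall fun t => ?_)
    · exact ((continuous_gaussTanh y).mul (continuous_tanh.comp (by fun_prop))).aestronglyMeasurable
    · rw [hf, norm_mul, Real.norm_eq_abs, Real.norm_eq_abs]
      exact (mul_le_of_le_one_right (abs_nonneg _) (Real.abs_tanh_lt_one _).le).trans
        (abs_gaussTanh_le y t)
  have h0 : tanhMoment y 0 = ∫ t, f t := by
    unfold tanhMoment
    congr 1; funext t
    simp [hf]
  have ht : ∀ x : ℝ, HasDerivAt Real.tanh (1 - Real.tanh x ^ 2) x := by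
    intro x
    have h := (Real.hasDerivAt_sinh x).div (Real.hasDerivAt_cosh x) (Real.cosh_pos x).ne'
    have e : Real.sinh / Real.cosh = Real.tanh :=
      funext fun x => (Real.tanh_eq_sinh_div_cosh x).symm
    rw [e] at h
    refine h.congr_deriv ?_
    rw [Real.tanh_eq_sinh_div_cosh]
    have := (Real.cosh_pos x).ne'
    field_simp
  have hd : ∀ t : ℝ, HasDerivAt (gaussTanh y)
      (-(4 * Real.pi * y) * (t * gaussTanh y t) +
        (Real.pi * y) * (Real.exp (-(2 * Real.pi * y) * t ^ 2) - f t)) t := by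
    intro t
    have h1 : HasDerivAt (fun t : ℝ => Real.exp (-(2 * Real.pi * y) * t ^ 2))
        (Real.exp (-(2 * Real.pi * y) * t ^ 2) * (-(2 * Real.pi * y) * (2 * t))) t := by
      have := ((hasDerivAt_pow 2 t).const_mul (-(2 * Real.pi * y))).exp
      simpa using this
    have h2 : HasDerivAt (fun t : ℝ => Real.tanh (Real.pi * (y * t)))
        ((1 - Real.tanh (Real.pi * (y * t)) ^ 2) * (Real.pi * (y * 1))) t :=
      (ht _).comp t (((hasDerivAt_id t).const_mul y).const_mul Real.pi)
    have h3 := h1.mul h2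
    refine h3.congr_deriv ?_
    simp only [hf, gaussTanh]
    ring
  have ig := integrable_id_mul_gaussTanh hy
  have ie := integrable_exp_neg_mul_sq hb
  have i1 : Integrable fun t => -(4 * Real.pi * y) * (t * gaussTanh y t) := ig.const_mul _
  have i2' : Integrable fun t => Real.exp (-(2 * Real.pi * y) * t ^ 2) - f t := ie.sub if1
  have i2 : Integrable fun t =>
    (Real.pi * y) * (Real.exp (-(2 * Real.pi * y) * t ^ 2) - f t) := i2'.const_mul _
  have i3 : Integrable (gaussTanh y) := ie.mono' (continuous_gaussTanh y).aestronglyMeasurable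
    (Filter.Eventually.of_forall (abs_gaussTanh_le y))
  have key := integral_eq_zero_of_hasDerivAt_of_integrable hd (i1.add i2) i3
  rw [integral_add i1 i2, integral_const_mul, integral_const_mul, integral_sub ie if1,
    integral_gaussian, ← h0, show Real.pi / (2 * Real.pi * y) = 1 / (2 * y) by field_simp] at key
  have hpy : Real.pi * y ≠ 0 := by positivity
  apply mul_left_cancel₀ hpy
  unfold gaussTanhMoment
  linarith

theorem integral_gauss_mul_cos {b : ℝ} (hb : 0 < b) (c : ℝ) :
    ∫ t : ℝ, Real.exp (-b * t ^ 2) * Real.cos (c * t) =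
      Real.sqrt (Real.pi / b) * Real.exp (-(c ^ 2 / (4 * b))) := by
  have h := fourierIntegral_gaussian (b := b) (by simpa using hb) c
  have h1 : ∀ x : ℝ, (cexp (I * c * x) * cexp (-b * x ^ 2)).re =
      Real.exp (-b * x ^ 2) * Real.cos (c * x) := by
    intro x
    rw [show -(b : ℂ) * x ^ 2 = ((-b * x ^ 2 : ℝ) : ℂ) by push_cast; ring, ← ofReal_exp,
      show I * (c : ℂ) * x = ((c * x : ℝ) : ℂ) * I by push_cast; ring, re_mul_ofReal,
      exp_ofReal_mul_I_re, mul_comm]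
  have hi : Integrable fun x : ℝ => cexp (I * c * x) * cexp (-b * x ^ 2) := by
    refine (integrable_exp_neg_mul_sq hb).mono' (by fun_prop)
      (Filter.Eventually.of_forall fun x => ?_)
    rw [norm_mul, Complex.norm_exp, Complex.norm_exp]
    rw [show -(b : ℂ) * x ^ 2 = ((-b * x ^ 2 : ℝ) : ℂ) by push_cast; ring, ofReal_re,
      show I * (c : ℂ) * x = ((c * x : ℝ) : ℂ) * I by push_cast; ring]
    simp
  have h2 := congrArg Complex.re h
  rw [show ∀ z : ℂ, z.re = RCLike.re z from fun _ => rfl, ← integral_re hi] at h2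
  simp only [RCLike.re_eq_complex_re] at h2
  rw [integral_congr_ae (Filter.Eventually.of_forall h1)] at h2
  rw [h2]
  have h3 : (Real.pi / b : ℂ) ^ (1 / 2 : ℂ) = ((Real.sqrt (Real.pi / b) : ℝ) : ℂ) := by
    rw [Real.sqrt_eq_rpow, ofReal_cpow (by have := Real.pi_pos; positivity)]
    push_cast; rfl
  rw [h3, show -(c : ℂ) ^ 2 / (4 * b) = ((-(c ^ 2 / (4 * b)) : ℝ) : ℂ) by push_cast; ring,
    ← ofReal_exp, ← ofReal_mul, ofReal_re]

theorem integrable_gauss_mul_cos {b : ℝ} (hb : 0 < b) (c : ℝ) :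
    Integrable fun t : ℝ => Real.exp (-b * t ^ 2) * Real.cos (c * t) :=
  integrable_gauss_mul_bounded hb (by fun_prop) fun _ => Real.abs_cos_le_one _

theorem integral_gauss_mul_sin_mul_sin {b : ℝ} (hb : 0 < b) (c d : ℝ) :
    ∫ t : ℝ, Real.exp (-b * t ^ 2) * (Real.sin (c * t) * Real.sin (d * t)) =
      Real.sqrt (Real.pi / b) * Real.exp (-((c ^ 2 + d ^ 2) / (4 * b))) *
        Real.sinh (c * d / (2 * b)) := by
  have h1 : ∀ t : ℝ, Real.exp (-b * t ^ 2) * (Real.sin (c * t) * Real.sin (d * t)) =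
      1 / 2 * (Real.exp (-b * t ^ 2) * Real.cos ((c - d) * t) -
        Real.exp (-b * t ^ 2) * Real.cos ((c + d) * t)) := by
    intro t
    rw [sub_mul, add_mul, Real.cos_sub, Real.cos_add]; ring
  rw [integral_congr_ae (Filter.Eventually.of_forall h1), integral_const_mul,
    integral_sub (integrable_gauss_mul_cos hb _) (integrable_gauss_mul_cos hb _),
    integral_gauss_mul_cos hb, integral_gauss_mul_cos hb, Real.sinh_eq,
    show -((c - d) ^ 2 / (4 * b)) = -((c ^ 2 + d ^ 2) / (4 * b)) + c * d / (2 * b) by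
      field_simp; ring,
    show -((c + d) ^ 2 / (4 * b)) = -((c ^ 2 + d ^ 2) / (4 * b)) + -(c * d / (2 * b)) by
      field_simp; ring, Real.exp_add, Real.exp_add]
  ring

theorem sinh_nat_mul_div {X : ℝ} (hX : X ≠ 0) (n : ℕ) :
    Real.sinh (((n : ℝ) + 1) * X) / Real.sinh X =
      ∑ ij ∈ Finset.HasAntidiagonal.antidiagonal n, Real.exp (((ij.1 : ℝ) - ij.2) * X) := by
  have hs : Real.sinh X ≠ 0 := by rwa [Ne, Real.sinh_eq_zero]
  rw [div_eq_iff hs, Finset.Nat.sum_antidiagonal_eq_sum_range_succ_mk, Finset.sum_mul,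
    Nat.succ_eq_add_one]
  have h1 : ∀ k ∈ Finset.range (n + 1),
      Real.exp (((k : ℝ) - ((n - k : ℕ) : ℝ)) * X) * Real.sinh X =
      Real.exp ((2 * ((k + 1 : ℕ) : ℝ) - n - 1) * X) / 2 -
        Real.exp ((2 * (k : ℝ) - n - 1) * X) / 2 := by
    intro k hk
    rw [Finset.mem_range] at hk
    rw [Nat.cast_sub (by omega), Real.sinh_eq, mul_div_assoc', mul_sub, ← Real.exp_add,
      ← Real.exp_add, sub_div]
    push_cast
    congr 3 <;> ring
  rw [Finset.sum_congr rfl h1,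
    Finset.sum_range_sub (fun k : ℕ => Real.exp ((2 * (k : ℝ) - n - 1) * X) / 2), Real.sinh_eq,
    sub_div]
  push_cast
  congr 3 <;> ring

theorem integral_gaussTanh_mul_sin {y : ℝ} (hy : 0 < y) (n : ℕ) :
    ∫ t, gaussTanh y t * Real.sin (2 * Real.pi * ((n : ℝ) + 1) * t) =
      1 / y * ∑ ij ∈ Finset.HasAntidiagonal.antidiagonal n,
        Real.exp (-(Real.pi / (2 * y))) ^ ((2 * ij.1 + 1) * (2 * ij.2 + 1)) := by
  have hp := Real.pi_pos
  have hb : 0 < 2 * Real.pi * y := by positivity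
  set N : ℝ := (n : ℝ) + 1 with hN
  set F : ℝ → ℝ → ℝ := fun t w => Real.exp (-(2 * Real.pi * y) * t ^ 2) *
    Real.sin (2 * Real.pi * N * t) * sinKernel (y * t) w with hF
  have hFc : Continuous (Function.uncurry F) := by
    have : Continuous fun p : ℝ × ℝ => sinKernel (y * p.1) p.2 :=
      continuous_sinKernel.comp (by fun_prop : Continuous fun p : ℝ × ℝ => (y * p.1, p.2))
    exact Continuous.mul (by fun_prop) this
  have hFi : Integrable (Function.uncurry F) (volume.prod volume) := by
    refine (((integrable_abs_mul_gauss hb).mul_prod (integrable_exp_neg_mul_abs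
      (by positivity : 0 < Real.pi / 2))).const_mul (8 * y)).mono' hFc.aestronglyMeasurable
      (Filter.Eventually.of_forall fun p => ?_)
    simp only [Function.uncurry, hF]
    rw [norm_mul, norm_mul, Real.norm_eq_abs, Real.norm_eq_abs, Real.norm_eq_abs,
      abs_of_pos (Real.exp_pos _)]
    have h1 := abs_sinKernel_le (y * p.1) p.2
    rw [abs_mul, abs_of_pos hy] at h1
    have h2 := Real.abs_sin_le_one (2 * Real.pi * N * p.1)
    calc _ ≤ Real.exp (-(2 * Real.pi * y) * p.1 ^ 2) * 1 *
          (8 * (y * |p.1|) * Real.exp (-(Real.pi / 2) * |p.2|)) := by gcongr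
      _ = _ := by ring_nf
  have h1 : ∀ t, gaussTanh y t * Real.sin (2 * Real.pi * N * t) = ∫ w, F t w := by
    intro t
    simp only [hF]
    rw [integral_const_mul, integral_sinKernel, gaussTanh]
    ring
  rw [integral_congr_ae (Filter.Eventually.of_forall h1), integral_integral_swap hFi]
  have h2 : ∀ w : ℝ, w ≠ 0 → ∫ t, F t w = Real.sqrt (1 / (2 * y)) *
      ∑ ij ∈ Finset.HasAntidiagonal.antidiagonal n, Real.exp (-(Real.pi * N ^ 2 / (2 * y))) *
        (Real.exp (-(Real.pi * y / 2) * w ^ 2) *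
          Real.exp ((Real.pi * ((ij.1 : ℝ) - ij.2)) * w)) := by
    intro w hw
    have e1 : ∀ t, F t w = 1 / Real.sinh (Real.pi * w) * (Real.exp (-(2 * Real.pi * y) * t ^ 2) *
        (Real.sin ((2 * Real.pi * w * y) * t) * Real.sin ((2 * Real.pi * N) * t))) := by
      intro t
      simp only [hF]
      rw [sinKernel_of_ne hw, show 2 * Real.pi * w * (y * t) = (2 * Real.pi * w * y) * t by ring]
      ring
    rw [integral_congr_ae (Filter.Eventually.of_forall e1), integral_const_mul,
      integral_gauss_mul_sin_mul_sin hb,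
      show Real.pi / (2 * Real.pi * y) = 1 / (2 * y) by field_simp,
      show 2 * Real.pi * w * y * (2 * Real.pi * N) / (2 * (2 * Real.pi * y)) =
        ((n : ℝ) + 1) * (Real.pi * w) by rw [hN]; field_simp,
      show -(((2 * Real.pi * w * y) ^ 2 + (2 * Real.pi * N) ^ 2) / (4 * (2 * Real.pi * y))) =
        -(Real.pi * N ^ 2 / (2 * y)) + -(Real.pi * y / 2) * w ^ 2 by field_simp; ring, Real.exp_add,
      ← Finset.mul_sum, ← Finset.mul_sum]
    have e2 := sinh_nat_mul_div (mul_ne_zero hp.ne' hw) n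
    have e3 : ∑ ij ∈ Finset.HasAntidiagonal.antidiagonal n, Real.exp ((Real.pi * ((ij.1 : ℝ) - ij.2)) * w) =
        ∑ ij ∈ Finset.HasAntidiagonal.antidiagonal n, Real.exp (((ij.1 : ℝ) - ij.2) * (Real.pi * w)) :=
      Finset.sum_congr rfl fun ij _ => by congr 1; ring
    rw [e3, ← e2]
    ring
  have h3 : ∀ᵐ w : ℝ, ∫ t, F t w = Real.sqrt (1 / (2 * y)) *
      ∑ ij ∈ Finset.HasAntidiagonal.antidiagonal n, Real.exp (-(Real.pi * N ^ 2 / (2 * y))) *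
        (Real.exp (-(Real.pi * y / 2) * w ^ 2) *
          Real.exp ((Real.pi * ((ij.1 : ℝ) - ij.2)) * w)) := by
    filter_upwards [compl_mem_ae_iff.2 (measure_singleton (0 : ℝ))] with w hw
    exact h2 w hw
  have hb2 : 0 < Real.pi * y / 2 := by positivity
  rw [integral_congr_ae h3, integral_const_mul, integral_finsetSum _ fun ij _ =>
    (integrable_gauss_mul_exp hb2 _).const_mul _, Finset.mul_sum, Finset.mul_sum]
  refine Finset.sum_congr rfl fun ij hij => ?_
  rw [Finset.HasAntidiagonal.mem_antidiagonal] at hij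
  rw [integral_const_mul, integral_gauss_mul_exp hb2, ← Real.exp_nat_mul]
  have e4 : Real.sqrt (1 / (2 * y)) * Real.sqrt (Real.pi / (Real.pi * y / 2)) = 1 / y := by
    rw [← Real.sqrt_mul (by positivity)]
    rw [show 1 / (2 * y) * (Real.pi / (Real.pi * y / 2)) = (1 / y) ^ 2 by field_simp]
    exact Real.sqrt_sq (by positivity)
  rw [← e4]
  have e5 : Real.exp (-(Real.pi * N ^ 2 / (2 * y))) *
      Real.exp ((Real.pi * ((ij.1 : ℝ) - ij.2)) ^ 2 / (4 * (Real.pi * y / 2))) =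
      Real.exp (((2 * ij.1 + 1) * (2 * ij.2 + 1) : ℕ) * -(Real.pi / (2 * y))) := by
    rw [← Real.exp_add, hN, ← hij]
    congr 1
    push_cast
    field_simp
    ring
  rw [← e5]
  ring

/-- Half of the term of index `n + 1` in the Poisson sum, in Lambert form. -/
theorem integral_gaussTanh_mul_sinKernel {y : ℝ} (hy : 0 < y) (n : ℕ) :
    ∫ t, gaussTanh y t * (sinKernel (y * t) (((n : ℝ) + 1) / y) / y) =
      1 / y ^ 2 * (1 / Real.sinh (Real.pi * (((n : ℝ) + 1) / y)) *
        ∑ ij ∈ Finset.HasAntidiagonal.antidiagonal n,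
          Real.exp (-(Real.pi / (2 * y))) ^ ((2 * ij.1 + 1) * (2 * ij.2 + 1))) := by
  have h1 : ∀ t, gaussTanh y t * (sinKernel (y * t) (((n : ℝ) + 1) / y) / y) =
      1 / y * (1 / Real.sinh (Real.pi * (((n : ℝ) + 1) / y))) *
        (gaussTanh y t * Real.sin (2 * Real.pi * ((n : ℝ) + 1) * t)) := by
    intro t
    rw [sinKernel_of_ne (by positivity),
      show 2 * Real.pi * (((n : ℝ) + 1) / y) * (y * t) = 2 * Real.pi * ((n : ℝ) + 1) * t by
        field_simp]
    ring
  rw [integral_congr_ae (Filter.Eventually.of_forall h1), integral_const_mul,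
    integral_gaussTanh_mul_sin hy]
  ring

theorem hasSum_of_triple {x T : ℝ} {S : ℕ → ℝ}
    (h : HasSum (fun t : ℕ × ℕ × ℕ => x ^ ((2 * t.1 + 1) * (2 * t.2.1 + 1) +
        (2 * t.1 + 1) * (2 * t.2.2 + 1) + (2 * t.2.1 + 1) * (2 * t.2.2 + 1))) T)
    (hS : ∀ n, HasSum (fun l : ℕ => x ^ ((2 * n + 2) * (2 * l + 1))) (S n)) :
    HasSum (fun n => S n * ∑ ij ∈ Finset.HasAntidiagonal.antidiagonal n, x ^ ((2 * ij.1 + 1) * (2 * ij.2 + 1)))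
      T := by
  rw [← (Equiv.prodAssoc ℕ ℕ ℕ).hasSum_iff] at h
  have h1 : HasSum (fun p : ℕ × ℕ => x ^ ((2 * p.1 + 1) * (2 * p.2 + 1)) * S (p.1 + p.2)) T := by
    refine h.prod_fiberwise fun p => ?_
    refine (congrArg (fun g => HasSum g _) (funext fun l => ?_)).mpr
      ((hS (p.1 + p.2)).mul_left (x ^ ((2 * p.1 + 1) * (2 * p.2 + 1))))
    simp only [Function.comp, Equiv.prodAssoc_apply]
    rw [← pow_add]
    congr 1
    ring
  rw [← Finset.HasAntidiagonal.sigmaAntidiagonalEquivProd.hasSum_iff] at h1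
  refine h1.sigma fun n => ?_
  have h2 := (Finset.HasAntidiagonal.antidiagonal n).hasSum
    (fun p : ℕ × ℕ => x ^ ((2 * p.1 + 1) * (2 * p.2 + 1)) * S (p.1 + p.2))
  rw [Finset.mul_sum]
  refine (congrArg (fun a => HasSum _ a) (Finset.sum_congr rfl fun p hp => ?_)).mp h2
  rw [Finset.HasAntidiagonal.mem_antidiagonal.1 hp, mul_comm]

theorem hurwitz_tanh_identity {y : ℝ} (hy : 0 < y) :
    (∑' N, hurwitzOdd N * Real.exp (-(Real.pi / (2 * y))) ^ N) / y ^ 2 +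
      Real.sqrt (1 / (2 * y)) * (∑' N, hurwitzH N * (-Real.exp (-(Real.pi * y / 2))) ^ N) +
        gaussTanhMoment y / 2 = 0 := by
  have hp := Real.pi_pos
  set x' := Real.exp (-(Real.pi / (2 * y))) with hx'
  have hx0 : 0 < x' := Real.exp_pos _
  have hx1 : x' < 1 := Real.exp_lt_one_iff.2 (by have : 0 < Real.pi / (2 * y) := by positivity
                                                 linarith)
  obtain ⟨T, hT1, hT2⟩ := hasSum_hurwitzOdd hx0.le hx1
  set x := Real.exp (-(Real.pi * y / 2)) with hx
  have hxa : |-x| < 1 := by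
    rw [abs_neg, abs_of_pos (Real.exp_pos _), Real.exp_lt_one_iff]
    have : 0 < Real.pi * y / 2 := by positivity
    linarith
  obtain ⟨S, hS1, hS2⟩ := hasSum_hurwitzH_lambert hxa
  have hS3 : ∑' N, hurwitzH N * (-x) ^ N = S / 6 := by
    have := hS1.mul_left (1 / 6)
    rw [show S / 6 = 1 / 6 * S by ring]
    refine ((congrArg (fun g => HasSum g _) (funext fun N => ?_)).mpr this).tsum_eq
    ring
  rw [hT1.tsum_eq, hS3]
  have hsinh : ∀ n : ℕ, HasSum (fun l : ℕ => x' ^ ((2 * n + 2) * (2 * l + 1)))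
      (1 / Real.sinh (Real.pi * (((n : ℝ) + 1) / y)) / 2) := by
    intro n
    have := (hasSum_inv_sinh (u := Real.pi * (((n : ℝ) + 1) / y)) (by positivity)).div_const 2
    refine (congrArg (fun g => HasSum g _) (funext fun l => ?_)).mpr this
    rw [hx', ← Real.exp_nat_mul, mul_div_cancel_left₀ _ two_ne_zero]
    congr 1
    push_cast
    field_simp
  have hn := hasSum_of_triple hT2 hsinh
  have hn1 : HasSum (fun n : ℕ => ∫ t, gaussTanh y t * (sinKernel (y * t) (((n : ℝ) + 1) / y) / y))
      (2 / y ^ 2 * (3 * T)) := by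
    refine (congrArg (fun g => HasSum g _) (funext fun n => ?_)).mpr (hn.mul_left (2 / y ^ 2))
    rw [integral_gaussTanh_mul_sinKernel hy]
    ring
  have hneg : ∀ n w : ℝ, sinKernel n (-w) = sinKernel n w := fun u w => by
    rw [← sinKernel_abs u (-w), abs_neg, sinKernel_abs]
  have hn2 : HasSum (fun n : ℤ => ∫ t, gaussTanh y t * (sinKernel (y * t) (n / y) / y))
      (2 / y ^ 2 * (3 * T) + 2 * gaussTanhMoment y + 2 / y ^ 2 * (3 * T)) := by
    have h0 : ∫ t, gaussTanh y t * (sinKernel (y * t) (((0 : ℤ) : ℝ) / y) / y) =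
        2 * gaussTanhMoment y := by
      unfold gaussTanhMoment
      rw [← integral_const_mul]
      congr 1; funext t
      rw [Int.cast_zero, zero_div, sinKernel_zero]
      field_simp
    rw [← h0]
    refine HasSum.of_add_one_of_neg_add_one
      (f := fun n : ℤ => ∫ t, gaussTanh y t * (sinKernel (y * t) (n / y) / y)) ?_ ?_
    · refine (congrArg (fun g => HasSum g _) (funext fun n => ?_)).mpr hn1
      push_cast; rfl
    · refine (congrArg (fun g => HasSum g _) (funext fun n => ?_)).mpr hn1
      push_cast
      simp only [neg_div, hneg]
  have hk1 : HasSum (fun k : ℕ => tanhMoment y ((k : ℝ) + 1))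
      (-(Real.sqrt (1 / (2 * y)) * (S + 1 / 2))) := by
    refine (congrArg (fun g => HasSum g _) (funext fun k => ?_)).mpr
      (hS2.mul_left (Real.sqrt (1 / (2 * y)))).neg
    rw [tanhMoment_eq hy]
  have hk2 : HasSum (fun k : ℤ => tanhMoment y k)
      (-(Real.sqrt (1 / (2 * y)) * (S + 1 / 2)) + tanhMoment y ((0 : ℤ) : ℝ) +
        -(Real.sqrt (1 / (2 * y)) * (S + 1 / 2))) := by
    refine HasSum.of_add_one_of_neg_add_one (f := fun k : ℤ => tanhMoment y k) ?_ ?_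
    · refine (congrArg (fun g => HasSum g _) (funext fun n => ?_)).mpr hk1
      push_cast; rfl
    · refine (congrArg (fun g => HasSum g _) (funext fun n => ?_)).mpr hk1
      push_cast
      rw [tanhMoment_neg]
  have e1 := hn2.unique (hasSum_gaussTanh_sinKernel hy)
  have e2 := hk2.unique (hasSum_tanhMoment hy)
  have e3 : (∫ t, ∑' n : ℤ, gaussTanh y t * (sinKernel (y * t) (n / y) / y)) =
      ∫ t, ∑' k : ℤ, gaussTanh y t *
      ((Real.tanh (Real.pi * (y * t) + Real.pi * (y * k)) +
        Real.tanh (Real.pi * (y * t) - Real.pi * (y * k))) / 2) := by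
    congr 1; funext t
    rw [tsum_mul_left, tsum_mul_left, poisson_sinKernel hy]
  rw [e3, ← e2, Int.cast_zero, tanhMoment_zero hy] at e1
  have : T / y ^ 2 = 1 / y ^ 2 * T := by ring
  rw [this]
  linear_combination e1 / 12

/-- The theta function `∑ exp (-π B (j + 1/2) ^ 2)` over all integers `j`. -/
def thetaTwo (B : ℂ) : ℂ := cexp (-(Real.pi * B / 4)) * jacobiTheta₂ (I * B / 2) (I * B)

theorem hasSum_thetaTwo {B : ℂ} (hB : 0 < B.re) :
    HasSum (fun j : ℕ => 2 * cexp (-(Real.pi * B * ((j : ℂ) + 1 / 2) ^ 2))) (thetaTwo B) := by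
  have h := (hasSum_jacobiTheta₂_term (I * B / 2) (τ := I * B) (by simpa using hB)).nat_add_neg_add_one
  refine (congrArg (fun g => HasSum g _) (funext fun j => ?_)).mpr
    (h.mul_left (cexp (-(Real.pi * B / 4))))
  simp only [jacobiTheta₂_term]
  rw [mul_add, ← Complex.exp_add, ← Complex.exp_add, two_mul]
  congr 1 <;> congr 1 <;> push_cast
  · linear_combination (-(Real.pi : ℂ) * B * (j + j ^ 2)) * I_sq
  · linear_combination (-(Real.pi : ℂ) * B * (j + j ^ 2)) * I_sq

/-- Real values of `thetaTwo`. -/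
def thetaR (B : ℝ) : ℝ := ∑' j : ℕ, 2 * Real.exp (-(Real.pi * B * ((j : ℝ) + 1 / 2) ^ 2))

theorem norm_thetaTwo_term (B : ℂ) (j : ℕ) :
    ‖2 * cexp (-(Real.pi * B * ((j : ℂ) + 1 / 2) ^ 2))‖ =
      2 * Real.exp (-(Real.pi * B.re * ((j : ℝ) + 1 / 2) ^ 2)) := by
  rw [norm_mul, Complex.norm_exp, RCLike.norm_ofNat]
  congr 3
  rw [show -((Real.pi : ℂ) * B * ((j : ℂ) + 1 / 2) ^ 2) =
    ((-(Real.pi * ((j : ℝ) + 1 / 2) ^ 2) : ℝ) : ℂ) * B by push_cast; ring, re_ofReal_mul]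
  ring

theorem summable_thetaR {B : ℝ} (hB : 0 < B) :
    Summable fun j : ℕ => 2 * Real.exp (-(Real.pi * B * ((j : ℝ) + 1 / 2) ^ 2)) := by
  have := (hasSum_thetaTwo (B := B) (by simpa using hB)).summable.norm
  simpa only [norm_thetaTwo_term, ofReal_re] using this

theorem thetaTwo_ofReal {B : ℝ} (hB : 0 < B) : thetaTwo B = thetaR B := by
  refine (hasSum_thetaTwo (B := B) (by simpa using hB)).unique ?_
  have := Complex.hasSum_ofReal.2 (summable_thetaR hB).hasSum
  refine (congrArg (fun g => HasSum g _) (funext fun j => ?_)).mpr this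
  push_cast; rfl

theorem norm_thetaTwo_le {B : ℂ} (hB : 0 < B.re) : ‖thetaTwo B‖ ≤ thetaR B.re := by
  rw [← (hasSum_thetaTwo hB).tsum_eq]
  refine (norm_tsum_le_tsum_norm (hasSum_thetaTwo hB).summable.norm).trans_eq ?_
  simp only [norm_thetaTwo_term]
  rfl

theorem thetaR_nonneg (B : ℝ) : 0 ≤ thetaR B := tsum_nonneg fun _ => by positivity

theorem thetaR_add_le {a x : ℝ} (ha : 0 < a) (hx : 0 ≤ x) :
    thetaR (a + x) ≤ thetaR a * Real.exp (-(Real.pi / 4) * x) := by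
  have hp := Real.pi_pos
  unfold thetaR
  rw [← tsum_mul_right]
  refine (summable_thetaR (by linarith : 0 < a + x)).tsum_le_tsum (fun j => ?_)
    ((summable_thetaR ha).mul_right _)
  rw [mul_assoc 2, ← Real.exp_add]
  refine mul_le_mul_of_nonneg_left (Real.exp_le_exp.2 ?_) two_pos.le
  have h1 : (1 : ℝ) / 4 ≤ ((j : ℝ) + 1 / 2) ^ 2 := by
    have : (0 : ℝ) ≤ j := Nat.cast_nonneg j
    nlinarith
  have : Real.pi * x * (1 / 4) ≤ Real.pi * x * ((j : ℝ) + 1 / 2) ^ 2 :=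
    mul_le_mul_of_nonneg_left h1 (by positivity)
  nlinarith

theorem thetaR_le_of_le {a b : ℝ} (ha : 0 < a) (hab : a ≤ b) : thetaR b ≤ thetaR a := by
  have := thetaR_add_le ha (sub_nonneg.2 hab)
  rw [add_sub_cancel] at this
  refine this.trans (mul_le_of_le_one_right (thetaR_nonneg a) (Real.exp_le_one_iff.2 ?_))
  have := mul_nonneg (div_nonneg Real.pi_pos.le zero_le_four) (sub_nonneg.2 hab)
  linarith

theorem differentiableAt_thetaTwo {B : ℂ} (hB : 0 < B.re) : DifferentiableAt ℂ thetaTwo B := by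
  unfold thetaTwo
  refine DifferentiableAt.mul (by fun_prop) ?_
  have h := (hasFDerivAt_jacobiTheta₂ (I * B / 2) (τ := I * B) (by simpa using hB)).differentiableAt
  exact h.comp (f := fun B : ℂ => (I * B / 2, I * B)) B (by fun_prop)

theorem continuousOn_thetaTwo : ContinuousOn thetaTwo {B : ℂ | 0 < B.re} :=
  fun _ hB => (differentiableAt_thetaTwo hB).continuousAt.continuousWithinAt

theorem continuousOn_thetaR : ContinuousOn thetaR (Set.Ioi 0) := by
  have h : ContinuousOn (fun B : ℝ => (thetaTwo B).re) (Set.Ioi 0) :=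
    continuous_re.comp_continuousOn (continuousOn_thetaTwo.comp continuous_ofReal.continuousOn
      fun B hB => by simpa using hB)
  refine h.congr fun B hB => ?_
  simp only
  rw [thetaTwo_ofReal hB, ofReal_re]

theorem thetaTwo_add_two_I {B : ℂ} (hB : 0 < B.re) : thetaTwo (B + 2 * I) = -I * thetaTwo B := by
  refine (hasSum_thetaTwo (B := B + 2 * I) (by simpa using hB)).unique ?_
  refine (congrArg (fun g => HasSum g _) (funext fun j => ?_)).mpr
    ((hasSum_thetaTwo hB).mul_left (-I))
  obtain ⟨m, hm⟩ := Nat.even_mul_succ_self j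
  have hm' : (j : ℂ) * (j + 1) = m + m := by exact_mod_cast hm
  have e : -(Real.pi * (B + 2 * I) * ((j : ℂ) + 1 / 2) ^ 2) =
      -(Real.pi * B * ((j : ℂ) + 1 / 2) ^ 2) + -(Real.pi / 2 * I) + ((-(2 * m : ℤ) : ℤ) : ℂ) *
        (2 * Real.pi * I) := by
    push_cast
    linear_combination (-2 * Real.pi * I) * hm'
  rw [e, Complex.exp_add, Complex.exp_add, Complex.exp_int_mul_two_pi_mul_I, Complex.exp_neg (_ * I),
    Complex.exp_pi_div_two_mul_I]
  simp
  ring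

theorem integrableOn_thetaR_mul_exp {v : ℝ} (hv : 0 ≤ v) :
    IntegrableOn (fun B => thetaR B * Real.exp (-(Real.pi * v) * B)) (Set.Ioi 0) ∧
    HasSum (fun j : ℕ => 2 / (Real.pi * (((j : ℝ) + 1 / 2) ^ 2 + v)))
      (∫ B in Set.Ioi 0, thetaR B * Real.exp (-(Real.pi * v) * B)) := by
  have hp := Real.pi_pos
  have hc : ∀ j : ℕ, -(Real.pi * (((j : ℝ) + 1 / 2) ^ 2 + v)) < 0 := fun j => by
    have : 0 < Real.pi * (((j : ℝ) + 1 / 2) ^ 2 + v) := by positivity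
    linarith
  set F : ℕ → ℝ → ℝ := fun j B =>
    2 * Real.exp (-(Real.pi * (((j : ℝ) + 1 / 2) ^ 2 + v)) * B) with hF
  have hFi : ∀ j, IntegrableOn (F j) (Set.Ioi 0) := fun j =>
    (integrableOn_exp_mul_Ioi (hc j) 0).const_mul 2
  have hFn : ∀ j, ∫ B in Set.Ioi 0, F j B = 2 / (Real.pi * (((j : ℝ) + 1 / 2) ^ 2 + v)) := by
    intro j
    rw [hF, integral_const_mul, integral_exp_mul_Ioi (hc j)]
    rw [mul_zero, Real.exp_zero, neg_div_neg_eq, mul_one_div]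
  have hFp : ∀ j B, ‖F j B‖ = F j B := fun j B => by
    rw [Real.norm_eq_abs, abs_of_pos]; positivity
  have hs : Summable fun j : ℕ => 2 / (Real.pi * (((j : ℝ) + 1 / 2) ^ 2 + v)) := by
    refine Summable.of_nonneg_of_le (fun j => by positivity) (fun j => ?_)
      (summable_inv_odd_sq.mul_left (8 / Real.pi))
    rw [div_mul_div_comm, div_le_div_iff₀ (by positivity) (by positivity)]
    nlinarith
  have hs' : Summable fun j => ∫ B in Set.Ioi 0, ‖F j B‖ := by
    simpa only [hFp, hFn] using hs
  have hsum : ∀ B, ∑' j, F j B = thetaR B * Real.exp (-(Real.pi * v) * B) := by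
    intro B
    unfold thetaR
    rw [← tsum_mul_right]
    refine tsum_congr fun j => ?_
    rw [hF, mul_assoc, ← Real.exp_add]
    ring_nf
  have h1 := hasSum_integral_of_summable_integral_norm hFi hs'
  simp only [hFn, hsum] at h1
  refine ⟨⟨?_, ?_⟩, h1⟩
  · exact (continuousOn_thetaR.mul (by fun_prop)).aestronglyMeasurable measurableSet_Ioi
  · rw [HasFiniteIntegral]
    calc ∫⁻ B in Set.Ioi 0, ‖thetaR B * Real.exp (-(Real.pi * v) * B)‖ₑ
        ≤ ∫⁻ B in Set.Ioi 0, ∑' j, ‖F j B‖ₑ := by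
          refine lintegral_mono fun B => ?_
          rw [← hsum]
          exact enorm_tsum_le_tsum_enorm
      _ = ∑' j, ∫⁻ B in Set.Ioi 0, ‖F j B‖ₑ :=
          lintegral_tsum fun j => (hFi j).aestronglyMeasurable.enorm
      _ = ∑' j, ENNReal.ofReal (∫ B in Set.Ioi 0, ‖F j B‖) := by
          simp only [fun j => ofReal_integral_norm_eq_lintegral_enorm (hFi j)]
      _ < ⊤ := by
          rw [← ENNReal.ofReal_tsum_of_nonneg
            (fun j => integral_nonneg fun _ => norm_nonneg _) hs']
          exact ENNReal.ofReal_lt_top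

theorem integrableOn_thetaR : IntegrableOn thetaR (Set.Ioi 0) := by
  have := (integrableOn_thetaR_mul_exp le_rfl).1
  simpa using this

theorem mul_integral_thetaR (u : ℝ) :
    u * ∫ B in Set.Ioi 0, thetaR B * Real.exp (-(Real.pi * u ^ 2) * B) =
      Real.tanh (Real.pi * u) := by
  have hpos : ∀ u : ℝ, 0 < u →
      u * ∫ B in Set.Ioi 0, thetaR B * Real.exp (-(Real.pi * u ^ 2) * B) =
      Real.tanh (Real.pi * u) := by
    intro u hu
    have hp := Real.pi_pos
    have h1 := ((integrableOn_thetaR_mul_exp (sq_nonneg u)).2.mul_left (Real.pi * u))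
    have h2 : HasSum (fun j : ℕ => Real.pi * u * (2 / (Real.pi * (((j : ℝ) + 1 / 2) ^ 2 + u ^ 2))))
        (Real.pi * Real.tanh (Real.pi * u)) := by
      refine (congrArg (fun g => HasSum g _) (funext fun j => ?_)).mpr (hasSum_tanh hu)
      field_simp
      ring
    have h3 := h1.unique h2
    rw [mul_assoc] at h3
    exact mul_left_cancel₀ hp.ne' h3
  rcases lt_trichotomy u 0 with h | h | h
  · have := hpos (-u) (by linarith)
    rw [mul_neg, Real.tanh_neg, neg_sq] at this
    linarith
  · simp [h]
  · exact hpos u h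

/-- The power series with real coefficients `a`. -/
def powSeries (a : ℕ → ℝ) (q : ℂ) : ℂ := ∑' N, (a N : ℂ) * q ^ N

theorem differentiableAt_powSeries {a : ℕ → ℝ}
    (ha : ∀ r : ℝ, |r| < 1 → Summable fun N => a N * r ^ N) {q : ℂ} (hq : ‖q‖ < 1) :
    DifferentiableAt ℂ (powSeries a) q := by
  obtain ⟨r, hr1, hr2⟩ := exists_between hq
  have hr0 : 0 ≤ r := (norm_nonneg q).trans hr1.le
  have h : DifferentiableOn ℂ (powSeries a) (Metric.ball 0 r) := by
    refine differentiableOn_tsum_of_summable_norm (u := fun N => ‖a N * r ^ N‖)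
      (ha r (by rwa [abs_of_nonneg hr0])).norm (fun N => by fun_prop) Metric.isOpen_ball
      fun N w hw => ?_
    rw [mem_ball_zero_iff] at hw
    rw [norm_mul, norm_pow, norm_mul, norm_pow, Complex.norm_real, Real.norm_of_nonneg hr0]
    gcongr
  exact h.differentiableAt (Metric.isOpen_ball.mem_nhds (mem_ball_zero_iff.2 hr1))

theorem powSeries_ofReal (a : ℕ → ℝ) (r : ℝ) : powSeries a r = ((∑' N, a N * r ^ N : ℝ) : ℂ) := by
  rw [powSeries, ofReal_tsum]
  push_cast; rfl

theorem summable_hurwitzOdd {r : ℝ} (hr : |r| < 1) : Summable fun N => hurwitzOdd N * r ^ N := by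
  refine Summable.of_norm_bounded (summable_hurwitzH hr).norm fun N => ?_
  unfold hurwitzOdd
  split_ifs
  · exact le_rfl
  · rw [zero_mul, norm_zero]; exact norm_nonneg _

/-- Complex version of the first moment of `gaussTanh`, rescaled. -/
def tanhLaplace (s : ℂ) : ℂ := ∫ u : ℝ, ((u * Real.tanh (Real.pi * u) : ℝ) : ℂ) *
  cexp (-(2 * Real.pi * s) * u ^ 2)

theorem norm_cexp_mul_sq (s : ℂ) (u : ℝ) :
    ‖cexp (-(2 * Real.pi * s) * u ^ 2)‖ = Real.exp (-(2 * Real.pi * s.re) * u ^ 2) := by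
  rw [Complex.norm_exp]
  congr 1
  rw [show -(2 * (Real.pi : ℂ) * s) * (u : ℂ) ^ 2 = ((-(2 * Real.pi) * u ^ 2 : ℝ) : ℂ) * s by
    push_cast; ring, re_ofReal_mul]
  ring

theorem integrable_abs_pow_mul_gauss {b : ℝ} (hb : 0 < b) (n : ℕ) :
    Integrable fun t : ℝ => |t| ^ n * Real.exp (-b * t ^ 2) := by
  have h := (integrable_rpow_mul_exp_neg_mul_sq hb (s := n)
    (by have : (0 : ℝ) ≤ n := n.cast_nonneg
        linarith)).norm
  refine h.congr (Filter.Eventually.of_forall fun t => ?_)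
  simp [abs_of_pos (Real.exp_pos _)]

theorem continuous_tanhLaplace_integrand (s : ℂ) : Continuous fun u : ℝ =>
    ((u * Real.tanh (Real.pi * u) : ℝ) : ℂ) * cexp (-(2 * Real.pi * s) * u ^ 2) := by
  have := continuous_tanh
  fun_prop

theorem norm_tanhLaplace_integrand_le (s : ℂ) (u : ℝ) :
    ‖((u * Real.tanh (Real.pi * u) : ℝ) : ℂ) * cexp (-(2 * Real.pi * s) * u ^ 2)‖ ≤
      |u| * Real.exp (-(2 * Real.pi * s.re) * u ^ 2) := by
  rw [norm_mul, norm_cexp_mul_sq, Complex.norm_real, norm_mul, Real.norm_eq_abs, Real.norm_eq_abs]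
  exact mul_le_mul_of_nonneg_right (mul_le_of_le_one_right (abs_nonneg u)
    (Real.abs_tanh_lt_one _).le) (Real.exp_pos _).le

theorem differentiableAt_tanhLaplace {s : ℂ} (hs : 0 < s.re) :
    DifferentiableAt ℂ tanhLaplace s := by
  have hp := Real.pi_pos
  set V : Set ℂ := {z : ℂ | s.re / 2 < z.re} with hV
  have hVo : V ∈ nhds s := (isOpen_lt continuous_const continuous_re).mem_nhds (by
    simp only [Set.mem_ofPred_eq]; linarith)
  have h := hasDerivAt_integral_of_dominated_loc_of_deriv_le (μ := volume) (x₀ := s) (s := V)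
    (bound := fun u : ℝ => 2 * Real.pi * (|u| ^ 3 * Real.exp (-(Real.pi * s.re) * u ^ 2)))
    (F := fun (z : ℂ) (u : ℝ) => ((u * Real.tanh (Real.pi * u) : ℝ) : ℂ) *
      cexp (-(2 * Real.pi * z) * u ^ 2))
    (F' := fun (z : ℂ) (u : ℝ) => ((u * Real.tanh (Real.pi * u) : ℝ) : ℂ) *
      cexp (-(2 * Real.pi * z) * u ^ 2) * (-(2 * Real.pi) * u ^ 2)) hVo
    (Filter.Eventually.of_forall fun z => (continuous_tanhLaplace_integrand z).aestronglyMeasurable)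
    ?_ ?_ ?_ ?_ ?_
  · exact h.2.differentiableAt
  · exact (integrable_abs_mul_gauss (by positivity)).mono'
      (continuous_tanhLaplace_integrand s).aestronglyMeasurable
      (Filter.Eventually.of_forall (norm_tanhLaplace_integrand_le s))
  · exact ((continuous_tanhLaplace_integrand s).mul (by fun_prop)).aestronglyMeasurable
  · refine Filter.Eventually.of_forall fun u z hz => ?_
    rw [hV, Set.mem_ofPred_eq] at hz
    rw [norm_mul]
    have h1 := norm_tanhLaplace_integrand_le z u
    have h2 : ‖-(2 * (Real.pi : ℂ)) * (u : ℂ) ^ 2‖ = 2 * Real.pi * |u| ^ 2 := by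
      simp [abs_of_pos hp]
    have h3 : Real.exp (-(2 * Real.pi * z.re) * u ^ 2) ≤ Real.exp (-(Real.pi * s.re) * u ^ 2) := by
      refine Real.exp_le_exp.2 (mul_le_mul_of_nonneg_right ?_ (sq_nonneg u))
      nlinarith
    rw [h2]
    calc _ ≤ |u| * Real.exp (-(Real.pi * s.re) * u ^ 2) * (2 * Real.pi * |u| ^ 2) := by
          refine mul_le_mul_of_nonneg_right (h1.trans ?_) (by positivity)
          exact mul_le_mul_of_nonneg_left h3 (abs_nonneg u)
      _ = _ := by ring
  · exact (integrable_abs_pow_mul_gauss (by positivity) 3).const_mul _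
  · refine Filter.Eventually.of_forall fun u z _ => ?_
    have h1 : HasDerivAt (fun z : ℂ => -(2 * Real.pi * z) * (u : ℂ) ^ 2)
        (-(2 * Real.pi) * (u : ℂ) ^ 2) z := by
      have := (((hasDerivAt_id z).const_mul (2 * (Real.pi : ℂ))).neg).mul_const ((u : ℂ) ^ 2)
      simpa using this
    have h2 := h1.cexp.const_mul (((u * Real.tanh (Real.pi * u) : ℝ) : ℂ))
    rw [← mul_assoc] at h2
    exact h2

theorem tanhLaplace_ofReal {s : ℝ} (hs : 0 < s) :
    tanhLaplace s = ((gaussTanhMoment (1 / s) / s ^ 2 : ℝ) : ℂ) := by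
  have h1 : tanhLaplace s = ((∫ u : ℝ, u * Real.tanh (Real.pi * u) *
      Real.exp (-(2 * Real.pi * s) * u ^ 2) : ℝ) : ℂ) := by
    rw [← integral_complex_ofReal, tanhLaplace]
    congr 1; funext u
    push_cast; rfl
  rw [h1]
  congr 1
  have h2 := Measure.integral_comp_mul_left (fun t => t * gaussTanh (1 / s) t) s
  rw [gaussTanhMoment, eq_div_iff (by positivity)]
  have h3 : ∀ u : ℝ, s * u * gaussTanh (1 / s) (s * u) =
      s * (u * Real.tanh (Real.pi * u) * Real.exp (-(2 * Real.pi * s) * u ^ 2)) := by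
    intro u
    rw [gaussTanh, show Real.pi * (1 / s * (s * u)) = Real.pi * u by field_simp,
      show -(2 * Real.pi * (1 / s)) * (s * u) ^ 2 = -(2 * Real.pi * s) * u ^ 2 by field_simp]
    ring
  rw [integral_congr_ae (Filter.Eventually.of_forall h3), integral_const_mul, smul_eq_mul,
    abs_of_pos (inv_pos.2 hs)] at h2
  have h4 := congrArg (fun x => s * x) h2
  simp only [mul_inv_cancel_left₀ hs.ne'] at h4
  rw [← h4]
  ring

theorem re_inv_pos {s : ℂ} (hs : 0 < s.re) : 0 < (s⁻¹).re := by
  rw [inv_re]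
  exact div_pos hs (normSq_pos.2 fun h => by simp [h] at hs)

theorem norm_cexp_lt_one {c : ℂ} (hc : c.re < 0) : ‖cexp c‖ < 1 := by
  rw [Complex.norm_exp]; exact Real.exp_lt_one_iff.2 hc

theorem hurwitz_tanh_identity_complex {s : ℂ} (hs : 0 < s.re) :
    powSeries hurwitzOdd (cexp (-(Real.pi / 2 : ℝ) * s)) +
      (s⁻¹) ^ ((3 : ℂ) / 2) / (Real.sqrt 2 : ℝ) *
        powSeries hurwitzH (-cexp (-(Real.pi / 2 : ℝ) * s⁻¹)) + 1 / 2 * tanhLaplace s = 0 := by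
  have hp := Real.pi_pos
  set U : Set ℂ := {z : ℂ | 0 < z.re} with hU
  set f : ℂ → ℂ := fun s => powSeries hurwitzOdd (cexp (-(Real.pi / 2 : ℝ) * s)) +
      (s⁻¹) ^ ((3 : ℂ) / 2) / (Real.sqrt 2 : ℝ) *
        powSeries hurwitzH (-cexp (-(Real.pi / 2 : ℝ) * s⁻¹)) + 1 / 2 * tanhLaplace s with hf
  have hUo : IsOpen U := isOpen_lt continuous_const continuous_re
  have hneg : ∀ z : ℂ, 0 < z.re → ((-(Real.pi / 2 : ℝ) : ℂ) * z).re < 0 := by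
    intro z hz
    rw [← ofReal_neg, re_ofReal_mul]
    exact mul_neg_of_neg_of_pos (by linarith) hz
  have hd : DifferentiableOn ℂ f U := by
    intro z hz
    rw [hU, Set.mem_ofPred_eq] at hz
    have hz0 : z ≠ 0 := fun h => by simp [h] at hz
    have hinv : DifferentiableAt ℂ (fun z : ℂ => z⁻¹) z := differentiableAt_id.inv hz0
    refine DifferentiableAt.differentiableWithinAt (DifferentiableAt.add (DifferentiableAt.add ?_
      (DifferentiableAt.mul ?_ ?_)) ((differentiableAt_tanhLaplace hz).const_mul _))
    · exact (differentiableAt_powSeries (fun r => summable_hurwitzOdd)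
        (norm_cexp_lt_one (hneg z hz))).comp (f := fun z : ℂ => cexp (-(Real.pi / 2 : ℝ) * z))
        z (by fun_prop)
    · exact (hinv.cpow_const (Or.inl (re_inv_pos hz))).div_const _
    · refine (differentiableAt_powSeries (fun r => summable_hurwitzH) ?_).comp
        (f := fun z : ℂ => -cexp (-(Real.pi / 2 : ℝ) * z⁻¹)) z ?_
      · rw [norm_neg]; exact norm_cexp_lt_one (hneg _ (re_inv_pos hz))
      · exact ((hinv.const_mul _).cexp).neg
  have hreal : ∀ t : ℝ, 0 < t → f t = 0 := by
    intro t ht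
    have h := hurwitz_tanh_identity (y := 1 / t) (by positivity)
    have e1 : Real.exp (-(Real.pi / (2 * (1 / t)))) = Real.exp (-(Real.pi / 2) * t) := by
      congr 1; field_simp
    have e2 : Real.exp (-(Real.pi * (1 / t) / 2)) = Real.exp (-(Real.pi / 2) * t⁻¹) := by
      congr 1; field_simp
    have e3 : Real.sqrt (1 / (2 * (1 / t))) = t ^ 2 * ((t⁻¹) ^ ((3 : ℝ) / 2) / Real.sqrt 2) := by
      rw [show 1 / (2 * (1 / t)) = t / 2 by field_simp, Real.sqrt_div ht.le, mul_div_assoc',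
        Real.sqrt_eq_rpow, Real.inv_rpow ht.le, ← Real.rpow_neg ht.le, ← Real.rpow_natCast,
        ← Real.rpow_add ht]
      norm_num
    rw [e1, e2, e3] at h
    have e4 : ((t : ℂ)⁻¹) ^ ((3 : ℂ) / 2) = (((t⁻¹) ^ ((3 : ℝ) / 2) : ℝ) : ℂ) := by
      rw [ofReal_cpow (inv_pos.2 ht).le]; push_cast; rfl
    have e5 : cexp (-(Real.pi / 2 : ℝ) * (t : ℂ)) = ((Real.exp (-(Real.pi / 2) * t) : ℝ) : ℂ) := by
      push_cast; rfl
    have e6 : -cexp (-(Real.pi / 2 : ℝ) * (t : ℂ)⁻¹) =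
        ((-Real.exp (-(Real.pi / 2) * t⁻¹) : ℝ) : ℂ) := by
      push_cast; rfl
    simp only [hf]
    rw [e4, e5, e6, powSeries_ofReal, powSeries_ofReal, tanhLaplace_ofReal ht]
    have ht2 : t ^ 2 ≠ 0 := by positivity
    have hr : (∑' N, hurwitzOdd N * Real.exp (-(Real.pi / 2) * t) ^ N) +
        (t⁻¹) ^ ((3 : ℝ) / 2) / Real.sqrt 2 *
          (∑' N, hurwitzH N * (-Real.exp (-(Real.pi / 2) * t⁻¹)) ^ N) +
        1 / 2 * (gaussTanhMoment (1 / t) / t ^ 2) = 0 := by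
      apply mul_left_cancel₀ ht2
      rw [mul_zero, ← h]
      generalize (∑' N, hurwitzOdd N * Real.exp (-(Real.pi / 2) * t) ^ N) = X
      generalize (∑' N, hurwitzH N * (-Real.exp (-(Real.pi / 2) * t⁻¹)) ^ N) = Y
      field_simp
    have hc := congrArg Complex.ofReal hr
    simp only [ofReal_add, ofReal_mul, ofReal_div, ofReal_one, ofReal_ofNat, ofReal_zero] at hc ⊢
    exact hc
  have han := hd.analyticOnNhd hUo
  have hpre : IsPreconnected U := (convex_halfSpace_re_gt 0).isPreconnected
  have hfreq : ∃ᶠ z in nhdsWithin (1 : ℂ) {1}ᶜ, f z = 0 := by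
    have h1 : Filter.Tendsto (fun t : ℝ => (t : ℂ)) (nhdsWithin (1 : ℝ) {1}ᶜ)
        (nhdsWithin (1 : ℂ) {1}ᶜ) := by
      refine tendsto_nhdsWithin_iff.2 ⟨?_, ?_⟩
      · exact (continuous_ofReal.tendsto' 1 1 (by simp)).mono_left nhdsWithin_le_nhds
      · filter_upwards [self_mem_nhdsWithin] with t ht
        simpa using ht
    refine h1.frequently (Filter.Eventually.frequently ?_)
    filter_upwards [nhdsWithin_le_nhds (Ioi_mem_nhds (zero_lt_one' ℝ))] with t ht
    exact hreal t ht
  exact han.eqOn_zero_of_preconnected_of_frequently_eq_zero hpre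
    (by simp [hU]) hfreq hs

theorem integrable_pow_mul_gauss_complex {b : ℂ} (hb : 0 < b.re) (n : ℕ) :
    Integrable fun u : ℝ => (u : ℂ) ^ n * cexp (-b * u ^ 2) := by
  refine (integrable_abs_pow_mul_gauss hb n).mono' (by fun_prop)
    (Filter.Eventually.of_forall fun u => le_of_eq ?_)
  rw [norm_mul, norm_pow, Complex.norm_real, Real.norm_eq_abs, norm_cexp_neg_mul_sq]

theorem integral_sq_mul_gauss {a : ℂ} (ha : 0 < a.re) :
    ∫ u : ℝ, (u : ℂ) ^ 2 * cexp (-(Real.pi * a) * u ^ 2) =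
      1 / (2 * Real.pi) * a ^ (-(3 : ℂ) / 2) := by
  have hp := Real.pi_pos
  have hpc : (Real.pi : ℂ) ≠ 0 := ofReal_ne_zero.2 hp.ne'
  have ha0 : a ≠ 0 := fun h => by simp [h] at ha
  have hb : 0 < ((Real.pi : ℂ) * a).re := by rw [re_ofReal_mul]; positivity
  have i0 : Integrable fun u : ℝ => cexp (-(Real.pi * a) * u ^ 2) := by
    simpa using integrable_pow_mul_gauss_complex hb 0
  have i1 : Integrable fun u : ℝ => (u : ℂ) * cexp (-(Real.pi * a) * u ^ 2) := by
    simpa using integrable_pow_mul_gauss_complex hb 1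
  have i2 := (integrable_pow_mul_gauss_complex hb 2).const_mul (2 * (Real.pi * a))
  have hder : ∀ u : ℝ, HasDerivAt (fun u : ℝ => (u : ℂ) * cexp (-(Real.pi * a) * u ^ 2))
      (cexp (-(Real.pi * a) * u ^ 2) -
        2 * (Real.pi * a) * ((u : ℂ) ^ 2 * cexp (-(Real.pi * a) * u ^ 2))) u := by
    intro u
    have h1 : HasDerivAt (fun z : ℂ => z * cexp (-(Real.pi * a) * z ^ 2))
        (cexp (-(Real.pi * a) * u ^ 2) -
        2 * (Real.pi * a) * ((u : ℂ) ^ 2 * cexp (-(Real.pi * a) * u ^ 2))) (u : ℂ) := by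
      have h2 := (hasDerivAt_id (u : ℂ)).mul
        (((hasDerivAt_pow 2 (u : ℂ)).const_mul (-(Real.pi * a))).cexp)
      refine h2.congr_deriv ?_
      simp only [id_eq]
      push_cast
      ring
    exact h1.comp_ofReal
  have h := integral_eq_zero_of_hasDerivAt_of_integrable hder (i0.sub i2) i1
  rw [integral_sub i0 i2, integral_const_mul, integral_gaussian_complex hb,
    show (Real.pi : ℂ) / (Real.pi * a) = a⁻¹ by field_simp,
    inv_cpow _ _ (fun h => by
      have := arg_lt_pi_div_two_iff.2 (Or.inl ha); rw [h] at this; linarith),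
    ← cpow_neg] at h
  have h3 : a ^ (-(3 : ℂ) / 2) = a⁻¹ * a ^ (-(1 / 2 : ℂ)) := by
    rw [← cpow_neg_one, ← cpow_add _ _ ha0]; norm_num
  rw [h3, sub_eq_zero.1 h]
  generalize (∫ u : ℝ, (u : ℂ) ^ 2 * cexp (-(Real.pi * a) * u ^ 2)) = J
  field_simp

theorem tanhLaplace_eq {s : ℂ} (hs : 0 < s.re) :
    tanhLaplace s = 1 / (2 * Real.pi) *
      ∫ B in Set.Ioi (0 : ℝ), thetaTwo B * (B + 2 * s) ^ (-(3 : ℂ) / 2) := by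
  have hp := Real.pi_pos
  set f : ℝ → ℝ → ℂ := fun u B => ((thetaR B : ℝ) : ℂ) *
    ((u : ℂ) ^ 2 * cexp (-(Real.pi * (B + 2 * s)) * u ^ 2)) with hf
  have hmeas : AEStronglyMeasurable (Function.uncurry f)
      (volume.prod (volume.restrict (Set.Ioi 0))) := by
    have h1 : AEStronglyMeasurable (fun x : ℝ × ℝ => ((thetaR x.2 : ℝ) : ℂ))
        (volume.prod (volume.restrict (Set.Ioi 0))) :=
      (continuous_ofReal.comp_aestronglyMeasurable
        (integrableOn_thetaR.aestronglyMeasurable)).comp_snd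
    refine h1.mul ?_
    exact Continuous.aestronglyMeasurable (by fun_prop)
  have h_integrable : Integrable (Function.uncurry f) (volume.prod (volume.restrict (Set.Ioi 0))) := by
    have hg := (integrable_abs_pow_mul_gauss (b := 2 * Real.pi * s.re) (by positivity) 2).mul_prod
      integrableOn_thetaR
    have hae : ∀ᵐ x : ℝ × ℝ ∂(volume.prod (volume.restrict (Set.Ioi 0))), 0 < x.2 := by
      have := Measure.quasiMeasurePreserving_snd (μ := (volume : Measure ℝ))
        (ν := volume.restrict (Set.Ioi (0 : ℝ)))
      exact this.ae (ae_restrict_mem measurableSet_Ioi)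
    refine hg.mono' hmeas ?_
    filter_upwards [hae] with x hx
    obtain ⟨u, B⟩ := x
    simp only at hx
    simp only [Function.uncurry, hf]
    rw [norm_mul, Complex.norm_real, Real.norm_of_nonneg (thetaR_nonneg B), norm_mul, norm_pow,
      Complex.norm_real, Real.norm_eq_abs, norm_cexp_neg_mul_sq, mul_comm]
    refine mul_le_mul_of_nonneg_right (mul_le_mul_of_nonneg_left (Real.exp_le_exp.2 ?_)
      (by positivity)) (thetaR_nonneg B)
    refine mul_le_mul_of_nonneg_right ?_ (sq_nonneg u)
    rw [re_ofReal_mul]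
    have : ((B : ℂ) + 2 * s).re = B + 2 * s.re := by simp
    rw [this]
    nlinarith
  have hswap := integral_integral_swap h_integrable
  have hL : ∀ u : ℝ, ∫ B in Set.Ioi (0 : ℝ), f u B =
      ((u * Real.tanh (Real.pi * u) : ℝ) : ℂ) * cexp (-(2 * Real.pi * s) * u ^ 2) := by
    intro u
    have h1 : ∀ B : ℝ, f u B = ((u * u * (thetaR B * Real.exp (-(Real.pi * u ^ 2) * B)) : ℝ) : ℂ) *
        cexp (-(2 * Real.pi * s) * u ^ 2) := by
      intro B
      simp only [hf]
      rw [show -(Real.pi * ((B : ℂ) + 2 * s)) * u ^ 2 =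
        -(Real.pi * u ^ 2) * B + -(2 * Real.pi * s) * u ^ 2 by ring, Complex.exp_add]
      push_cast
      ring
    rw [integral_congr_ae (Filter.Eventually.of_forall h1), integral_mul_const,
      integral_complex_ofReal, integral_const_mul, mul_assoc, mul_integral_thetaR]
  have hR : ∀ B ∈ Set.Ioi (0 : ℝ), ∫ u : ℝ, f u B =
      1 / (2 * Real.pi) * (thetaTwo B * (B + 2 * s) ^ (-(3 : ℂ) / 2)) := by
    intro B hB
    have hB : 0 < B := hB
    simp only [hf]
    rw [integral_const_mul, integral_sq_mul_gauss (by simp; positivity), thetaTwo_ofReal hB]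
    ring
  rw [← integral_const_mul, ← setIntegral_congr_fun measurableSet_Ioi hR, ← hswap, tanhLaplace]
  exact integral_congr_ae (Filter.Eventually.of_forall fun u => (hL u).symm)

theorem hurwitz_theta_identity {s : ℂ} (hs : 0 < s.re) :
    powSeries hurwitzOdd (cexp (-(Real.pi / 2 : ℝ) * s)) +
      (s⁻¹) ^ ((3 : ℂ) / 2) / (Real.sqrt 2 : ℝ) *
        powSeries hurwitzH (-cexp (-(Real.pi / 2 : ℝ) * s⁻¹)) +
      1 / (4 * Real.pi) * ∫ B in Set.Ioi (0 : ℝ), thetaTwo B * (B + 2 * s) ^ (-(3 : ℂ) / 2) =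
      0 := by
  rw [← hurwitz_tanh_identity_complex hs, tanhLaplace_eq hs]
  ring

/-- The integrand `ϑ₂(z) (z + 2 s)^(-3/2)` of the Eichler integral of `ϑ₂`. -/
def thetaKernel (s z : ℂ) : ℂ := thetaTwo z * (z + 2 * s) ^ (-(3 : ℂ) / 2)

/-- The integral of `thetaKernel s` along the horizontal ray starting at `z`. -/
def thetaIntegral (s z : ℂ) : ℂ := ∫ x in Set.Ioi (0 : ℝ), thetaKernel s (z + x)

theorem norm_thetaKernel_le {s z : ℂ} (hs : 0 < s.re) (hz : 0 < z.re) :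
    ‖thetaKernel s z‖ ≤ thetaR z.re * (2 * s.re) ^ (-(3 : ℝ) / 2) := by
  rw [thetaKernel, norm_mul]
  have h1 : (2 * s.re) ≤ ‖z + 2 * s‖ := by
    refine le_trans ?_ (re_le_norm _)
    simp [hz.le]
  have h2 : ‖(z + 2 * s) ^ (-(3 : ℂ) / 2)‖ = ‖z + 2 * s‖ ^ (-(3 : ℝ) / 2) := by
    rw [← norm_cpow_real]; push_cast; rfl
  rw [h2]
  exact mul_le_mul (norm_thetaTwo_le hz)
    (Real.rpow_le_rpow_of_nonpos (by positivity) h1 (by norm_num)) (by positivity)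
    (thetaR_nonneg _)

theorem differentiableAt_thetaKernel {s z : ℂ} (hs : 0 < s.re) (hz : 0 < z.re) :
    DifferentiableAt ℂ (thetaKernel s) z := by
  refine (differentiableAt_thetaTwo hz).mul (DifferentiableAt.cpow_const (by fun_prop) ?_)
  left
  simp
  positivity

theorem continuousOn_thetaKernel_add {s z : ℂ} (hs : 0 < s.re) (hz : 0 ≤ z.re) :
    ContinuousOn (fun x : ℝ => thetaKernel s (z + x)) (Set.Ioi 0) := by
  intro x hx
  have hx : 0 < x := hx
  have h : 0 < (z + x).re := by simp; positivity
  have h1 : ContinuousAt (fun x : ℝ => thetaKernel s (z + x)) x :=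
    ContinuousAt.comp (f := fun x : ℝ => z + (x : ℂ)) (x := x)
      (differentiableAt_thetaKernel hs h).continuousAt (by fun_prop)
  exact h1.continuousWithinAt

theorem norm_thetaKernel_add_le {s z : ℂ} (hs : 0 < s.re) (hz : 0 ≤ z.re) {x : ℝ} (hx : 0 < x) :
    ‖thetaKernel s (z + x)‖ ≤ thetaR x * (2 * s.re) ^ (-(3 : ℝ) / 2) := by
  have h : (z + x).re = z.re + x := by simp
  have h' : 0 < (z + x).re := by rw [h]; positivity
  refine (norm_thetaKernel_le hs h').trans (mul_le_mul_of_nonneg_right ?_ (by positivity))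
  rw [h]
  exact thetaR_le_of_le hx (by linarith)

theorem integrableOn_thetaKernel_add {s z : ℂ} (hs : 0 < s.re) (hz : 0 ≤ z.re) :
    IntegrableOn (fun x : ℝ => thetaKernel s (z + x)) (Set.Ioi 0) := by
  refine (integrableOn_thetaR.mul_const ((2 * s.re) ^ (-(3 : ℝ) / 2))).mono'
    ((continuousOn_thetaKernel_add hs hz).aestronglyMeasurable measurableSet_Ioi) ?_
  filter_upwards [ae_restrict_mem measurableSet_Ioi] with x hx
  exact norm_thetaKernel_add_le hs hz hx

theorem norm_deriv_thetaKernel_le {s z : ℂ} (hs : 0 < s.re) {b : ℝ} (hb : 0 < b) {x : ℝ}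
    (hx : 0 ≤ x) (hz : 2 * b + x ≤ z.re) :
    ‖deriv (thetaKernel s) z‖ ≤
      thetaR b * (2 * s.re) ^ (-(3 : ℝ) / 2) / b * Real.exp (-(Real.pi / 4) * x) := by
  have hre : ∀ w ∈ Metric.closedBall z b, b + x ≤ w.re := by
    intro w hw
    have h1 := abs_re_le_norm (w - z)
    rw [mem_closedBall_iff_norm] at hw
    rw [sub_re] at h1
    have := neg_le_of_abs_le (h1.trans hw)
    linarith
  have h := norm_deriv_le_of_forall_mem_sphere_norm_le (f := thetaKernel s) (c := z)
    (C := thetaR b * Real.exp (-(Real.pi / 4) * x) * (2 * s.re) ^ (-(3 : ℝ) / 2)) hb ?_ ?_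
  · refine h.trans (le_of_eq ?_)
    ring
  · refine DifferentiableOn.diffContOnCl fun w hw => ?_
    rw [closure_ball _ hb.ne'] at hw
    exact (differentiableAt_thetaKernel hs
      (by linarith [hre w hw])).differentiableWithinAt
  · intro w hw
    have h1 := hre w (Metric.sphere_subset_closedBall hw)
    refine (norm_thetaKernel_le hs (by linarith)).trans
      (mul_le_mul_of_nonneg_right ?_ (by positivity))
    exact (thetaR_le_of_le (by positivity) h1).trans (thetaR_add_le hb hx)

theorem hasDerivAt_thetaIntegral {s z : ℂ} (hs : 0 < s.re) (hz : 0 < z.re) :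
    HasDerivAt (thetaIntegral s) (-thetaKernel s z) z := by
  have hp := Real.pi_pos
  have hder : ∀ w : ℂ, 0 ≤ w.re → ∀ x : ℝ, 0 < x + w.re →
      HasDerivAt (thetaKernel s) (deriv (thetaKernel s) (w + x)) (w + x) := fun w _ x hx =>
    (differentiableAt_thetaKernel hs (by simp; linarith)).hasDerivAt
  have hnhds : Metric.ball z (z.re / 4) ∈ nhds z := Metric.ball_mem_nhds _ (by positivity)
  have hre : ∀ w ∈ Metric.ball z (z.re / 4), 3 * (z.re / 4) ≤ w.re := by
    intro w hw
    have h1 := abs_re_le_norm (w - z)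
    rw [mem_ball_iff_norm] at hw
    rw [sub_re] at h1
    have := neg_le_of_abs_le (h1.trans hw.le)
    linarith
  have h := hasDerivAt_integral_of_dominated_loc_of_deriv_le
    (μ := volume.restrict (Set.Ioi (0 : ℝ))) (x₀ := z) (s := Metric.ball z (z.re / 4))
    (bound := fun x : ℝ => thetaR (z.re / 4) * (2 * s.re) ^ (-(3 : ℝ) / 2) / (z.re / 4) *
      Real.exp (-(Real.pi / 4) * x))
    (F := fun (w : ℂ) (x : ℝ) => thetaKernel s (w + x))
    (F' := fun (w : ℂ) (x : ℝ) => deriv (thetaKernel s) (w + x)) hnhds ?_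
    (integrableOn_thetaKernel_add hs hz.le) ?_ ?_ ?_ ?_
  · refine h.2.congr_deriv ?_
    have h0 : Filter.Tendsto (fun x : ℝ => thetaKernel s (z + x)) Filter.atTop (nhds 0) := by
      refine squeeze_zero_norm' (a := fun x => thetaR z.re * Real.exp (-(Real.pi / 4) * x) *
        (2 * s.re) ^ (-(3 : ℝ) / 2)) ?_ ?_
      · filter_upwards [Filter.eventually_ge_atTop 0] with x hx
        have e : (z + x).re = z.re + x := by simp
        refine (norm_thetaKernel_le hs (by rw [e]; positivity)).trans
          (mul_le_mul_of_nonneg_right ?_ (by positivity))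
        rw [e]
        exact thetaR_add_le hz hx
      · have h1 : Filter.Tendsto (fun x : ℝ => Real.exp (-(Real.pi / 4) * x)) Filter.atTop
            (nhds 0) := Real.tendsto_exp_atBot.comp
          (Filter.tendsto_id.const_mul_atTop_of_neg (by linarith))
        simpa using (h1.const_mul (thetaR z.re)).mul_const ((2 * s.re) ^ (-(3 : ℝ) / 2))
    have h1 := integral_Ioi_of_hasDerivAt_of_tendsto (a := (0 : ℝ))
      (f := fun x : ℝ => thetaKernel s (z + x))
      (f' := fun x : ℝ => deriv (thetaKernel s) (z + x)) ?_ ?_ h.1 h0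
    · rw [h1]; simp
    · exact ((hder z hz.le 0 (by simpa using hz)).continuousAt.comp
        (f := fun x : ℝ => z + (x : ℂ)) (x := (0 : ℝ)) (by fun_prop)).continuousWithinAt
    · intro x hx
      have hx : 0 < x := hx
      have := (hder z hz.le x (by positivity)).comp_const_add z (x : ℂ)
      exact this.comp_ofReal
  · filter_upwards [hnhds] with w hw
    exact (integrableOn_thetaKernel_add hs (by linarith [hre w hw])).aestronglyMeasurable
  · refine ContinuousOn.aestronglyMeasurable (fun x hx => ?_) measurableSet_Ioi
    have hx : 0 < x := hx
    have h1 : 0 < (z + x).re := by simp; positivity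
    have hopen : IsOpen {w : ℂ | 0 < w.re} := isOpen_lt continuous_const continuous_re
    have hdo : DifferentiableOn ℂ (thetaKernel s) {w : ℂ | 0 < w.re} := fun w hw =>
      (differentiableAt_thetaKernel hs hw).differentiableWithinAt
    have h2 : ContinuousAt (deriv (thetaKernel s)) (z + x) :=
      (((hdo.deriv hopen).differentiableAt (hopen.mem_nhds h1))).continuousAt
    exact (h2.comp (f := fun x : ℝ => z + (x : ℂ)) (x := x) (by fun_prop)).continuousWithinAt
  · filter_upwards [ae_restrict_mem measurableSet_Ioi] with x hx w hw
    have hx : 0 < x := hx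
    refine norm_deriv_thetaKernel_le hs (by positivity) hx.le ?_
    have := hre w hw
    simp
    linarith
  · refine Integrable.const_mul ?_ _
    exact integrableOn_exp_mul_Ioi (by linarith) 0
  · filter_upwards [ae_restrict_mem measurableSet_Ioi] with x hx w hw
    have hx : 0 < x := hx
    have := hre w hw
    exact (hder w (by linarith) x (by linarith)).comp_add_const w (x : ℂ)

theorem tendsto_thetaIntegral {s : ℂ} (hs : 0 < s.re) :
    Filter.Tendsto (thetaIntegral s) (nhdsWithin 0 {z | 0 < z.re}) (nhds (thetaIntegral s 0)) := by
  refine tendsto_integral_filter_of_dominated_convergence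
    (fun x => thetaR x * (2 * s.re) ^ (-(3 : ℝ) / 2)) ?_ ?_ (integrableOn_thetaR.mul_const _) ?_
  · filter_upwards [self_mem_nhdsWithin] with z hz
    exact (integrableOn_thetaKernel_add hs (le_of_lt hz)).aestronglyMeasurable
  · filter_upwards [self_mem_nhdsWithin] with z hz
    filter_upwards [ae_restrict_mem measurableSet_Ioi] with x hx
    exact norm_thetaKernel_add_le hs (le_of_lt hz) hx
  · filter_upwards [ae_restrict_mem measurableSet_Ioi] with x hx
    have hx : 0 < x := hx
    have h1 : ContinuousAt (fun z : ℂ => thetaKernel s (z + x)) 0 :=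
      ContinuousAt.comp (f := fun z : ℂ => z + (x : ℂ)) (x := (0 : ℂ))
        (differentiableAt_thetaKernel hs (by simpa using hx)).continuousAt (by fun_prop)
    exact h1.tendsto.mono_left nhdsWithin_le_nhds

theorem cpow_mul_of_re_pos {x y : ℂ} (hx : 0 < x.re) (hy : 0 < y.re) (r : ℂ) :
    (x * y) ^ r = x ^ r * y ^ r := by
  have hx0 : x ≠ 0 := fun h => by simp [h] at hx
  have hy0 : y ≠ 0 := fun h => by simp [h] at hy
  have h1 := abs_lt.1 (abs_arg_lt_pi_div_two_iff.2 (Or.inl hx))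
  have h2 := abs_lt.1 (abs_arg_lt_pi_div_two_iff.2 (Or.inl hy))
  rw [cpow_def_of_ne_zero (mul_ne_zero hx0 hy0), cpow_def_of_ne_zero hx0, cpow_def_of_ne_zero hy0,
    Complex.log_mul hx0 hy0 ⟨by linarith [h1.1, h2.1], by linarith [h1.2, h2.2]⟩, add_mul,
    Complex.exp_add]

/-- The theta function `∑ (-1)^n exp(-π n² A)` over all integers `n`. -/
def thetaFour (A : ℂ) : ℂ := jacobiTheta₂ (1 / 2) (I * A)

theorem thetaFour_eq {A : ℂ} (hA : A ≠ 0) :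
    thetaFour A = 1 / A ^ ((1 : ℂ) / 2) * thetaTwo A⁻¹ := by
  rw [thetaFour, jacobiTheta₂_functional_equation, thetaTwo, ← jacobiTheta₂_neg_left,
    show -I * (I * A) = A by linear_combination (-A) * I_mul_I,
    show -(1 / 2 / (I * A)) = I * A⁻¹ / 2 by
      field_simp; rw [I_sq],
    show -1 / (I * A) = I * A⁻¹ by field_simp; rw [I_sq],
    show -Real.pi * I * (1 / 2) ^ 2 / (I * A) = -(Real.pi * A⁻¹ / 4) by field_simp; norm_num]
  ring

theorem hasSum_thetaFour {A : ℂ} (hA : 0 < A.re) :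
    HasSum (fun n : ℕ => 2 * ((-1) ^ (n + 1) * cexp (-(Real.pi * A * ((n : ℂ) + 1) ^ 2))))
      (thetaFour A - 1) := by
  have h1 := (hasSum_jacobiTheta₂_term (1 / 2) (τ := I * A) (by simpa using hA)).nat_add_neg
  have h2 := (hasSum_nat_add_iff' 1).2 h1
  have h0 : jacobiTheta₂_term 0 (1 / 2) (I * A) = 1 := by simp [jacobiTheta₂_term]
  have hval : ∀ n : ℤ, jacobiTheta₂_term n (1 / 2) (I * A) =
      cexp (Real.pi * I * n) * cexp (-(Real.pi * A * (n : ℂ) ^ 2)) := by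
    intro n
    rw [jacobiTheta₂_term, ← Complex.exp_add]
    congr 1
    linear_combination (Real.pi * n ^ 2 * A : ℂ) * I_mul_I
  have hexp : ∀ n : ℕ, cexp (Real.pi * I * n) = (-1) ^ n := by
    intro n
    rw [mul_comm, Complex.exp_nat_mul, exp_pi_mul_I]
  have hexp' : ∀ n : ℕ, cexp (Real.pi * I * -n) = (-1) ^ n := by
    intro n
    rw [mul_neg, Complex.exp_neg, hexp, ← inv_pow]
    norm_num
  simp only [Finset.sum_range_one, Nat.cast_zero, neg_zero, h0, hval] at h2
  refine (congrArg₂ (fun g x => HasSum g x) (funext fun n => ?_) ?_).mp h2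
  · push_cast
    have e1 := hexp (n + 1)
    have e2 := hexp' (n + 1)
    push_cast at e1 e2
    rw [e1, e2, neg_sq]
    ring
  · simp [thetaFour]

theorem incGammaNegHalf_eq {x : ℝ} (hx : 0 < x) :
    incGammaNegHalf x =
      (Real.sqrt x)⁻¹ * ∫ u in Set.Ioi (1 : ℝ), Real.exp (-(x * u)) * u ^ (-(3 : ℝ) / 2) := by
  have h := integral_comp_mul_left_Ioi' (fun t => Real.exp (-t) * t ^ (-(3 : ℝ) / 2)) 1 hx
  rw [mul_one] at h
  rw [incGammaNegHalf, ← h, smul_eq_mul, ← integral_const_mul, ← integral_const_mul]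
  refine setIntegral_congr_fun measurableSet_Ioi fun u hu => ?_
  have hu : 0 < u := zero_lt_one.trans hu
  have h3 : x * x ^ (-(3 : ℝ) / 2) = (Real.sqrt x)⁻¹ := by
    rw [Real.sqrt_eq_rpow, ← Real.rpow_neg hx.le, ← Real.rpow_one_add' hx.le (by norm_num)]
    norm_num
  rw [Real.mul_rpow hx.le hu.le, ← h3]
  ring

theorem integral_one_rpow : ∫ u in Set.Ioi (1 : ℝ), u ^ (-(3 : ℝ) / 2) = 2 := by
  rw [integral_Ioi_rpow_of_lt (by norm_num) one_pos]
  norm_num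

theorem integrableOn_one_rpow : IntegrableOn (fun u : ℝ => u ^ (-(3 : ℝ) / 2)) (Set.Ioi 1) :=
  integrableOn_Ioi_rpow_of_lt (by norm_num) one_pos

/-- The complex line `u ↦ u Re σ - σ/2`. -/
def thetaLine (σ : ℂ) (u : ℝ) : ℂ := u * σ.re - σ / 2

theorem thetaLine_re (σ : ℂ) (u : ℝ) : (thetaLine σ u).re = (u - 1 / 2) * σ.re := by
  rw [thetaLine, sub_re, ← ofReal_mul, ofReal_re, div_ofNat_re]
  ring

theorem thetaLine_re_ge {σ : ℂ} (hσ : 0 < σ.re) {u : ℝ} (hu : 1 ≤ u) :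
    σ.re / 2 ≤ (thetaLine σ u).re := by
  rw [thetaLine_re]
  nlinarith

theorem hasSum_integral_thetaFour {σ : ℂ} (hσ : 0 < σ.re) :
    HasSum (fun n : ℕ => ∫ u in Set.Ioi (1 : ℝ), ((u ^ (-(3 : ℝ) / 2) : ℝ) : ℂ) *
        (2 * ((-1) ^ (n + 1) * cexp (-(Real.pi * thetaLine σ u * ((n : ℂ) + 1) ^ 2)))))
      (∫ u in Set.Ioi (1 : ℝ), ((u ^ (-(3 : ℝ) / 2) : ℝ) : ℂ) * (thetaFour (thetaLine σ u) - 1)) := by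
  have hp := Real.pi_pos
  set F : ℕ → ℝ → ℂ := fun n u => ((u ^ (-(3 : ℝ) / 2) : ℝ) : ℂ) *
        (2 * ((-1) ^ (n + 1) * cexp (-(Real.pi * thetaLine σ u * ((n : ℂ) + 1) ^ 2)))) with hF
  have hb : ∀ n : ℕ, ∀ u ∈ Set.Ioi (1 : ℝ), ‖F n u‖ ≤
      2 * Real.exp (-(Real.pi * (σ.re / 2) * (n + 1))) * u ^ (-(3 : ℝ) / 2) := by
    intro n u hu
    have hu1 : 1 < u := hu
    simp only [hF]
    rw [norm_mul, Complex.norm_real, Real.norm_of_nonneg (by positivity), norm_mul, norm_mul,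
      norm_pow, norm_neg, norm_one, one_pow, one_mul, Complex.norm_ofNat, Complex.norm_exp, mul_comm]
    refine mul_le_mul_of_nonneg_right (mul_le_mul_of_nonneg_left (Real.exp_le_exp.2 ?_)
      (by norm_num)) (by positivity)
    rw [show -(Real.pi * thetaLine σ u * ((n : ℂ) + 1) ^ 2) =
      ((-(Real.pi * ((n : ℝ) + 1) ^ 2) : ℝ) : ℂ) * thetaLine σ u by push_cast; ring,
      re_ofReal_mul]
    have h1 := thetaLine_re_ge hσ hu1.le
    have h2 : (n : ℝ) + 1 ≤ ((n : ℝ) + 1) ^ 2 := by nlinarith [(Nat.cast_nonneg n : (0 : ℝ) ≤ n)]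
    have h3 : Real.pi * (σ.re / 2) * (n + 1) ≤ Real.pi * (σ.re / 2) * ((n : ℝ) + 1) ^ 2 :=
      mul_le_mul_of_nonneg_left h2 (by positivity)
    have h4 : Real.pi * ((n : ℝ) + 1) ^ 2 * (σ.re / 2) ≤
        Real.pi * ((n : ℝ) + 1) ^ 2 * (thetaLine σ u).re :=
      mul_le_mul_of_nonneg_left h1 (by positivity)
    linarith
  have hi : ∀ n, Integrable (F n) (volume.restrict (Set.Ioi 1)) := by
    intro n
    refine (integrableOn_one_rpow.const_mul _).mono' ?_
      ((ae_restrict_mem measurableSet_Ioi).mono (hb n))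
    refine ((continuous_ofReal.comp_aestronglyMeasurable
      integrableOn_one_rpow.aestronglyMeasurable)).mul ?_
    refine Continuous.aestronglyMeasurable ?_
    unfold thetaLine
    fun_prop
  have hs : Summable fun n => ∫ u in Set.Ioi (1 : ℝ), ‖F n u‖ := by
    have hg : Summable fun n : ℕ => 2 * Real.exp (-(Real.pi * (σ.re / 2) * (n + 1))) * 2 := by
      have h1 : Summable fun n : ℕ => Real.exp (-(Real.pi * (σ.re / 2))) ^ n :=
        summable_geometric_of_lt_one (Real.exp_pos _).le
          (Real.exp_lt_one_iff.2 (by have := mul_pos hp (half_pos hσ); linarith))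
      refine (((summable_nat_add_iff 1).2 h1).mul_left 4).congr fun n => ?_
      rw [← Real.exp_nat_mul]
      push_cast
      rw [show ((n : ℝ) + 1) * -(Real.pi * (σ.re / 2)) = -(Real.pi * (σ.re / 2) * (n + 1)) by ring]
      ring
    refine Summable.of_nonneg_of_le (fun n => integral_nonneg fun u => norm_nonneg _)
      (fun n => ?_) hg
    refine (setIntegral_mono_on (hi n).norm (integrableOn_one_rpow.const_mul _) measurableSet_Ioi
      (hb n)).trans (le_of_eq ?_)
    rw [integral_const_mul, integral_one_rpow]
  have h := hasSum_integral_of_summable_integral_norm hi hs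
  refine (congrArg (HasSum _) ?_).mp h
  refine setIntegral_congr_fun measurableSet_Ioi fun u hu => ?_
  have hu1 : 1 < u := hu
  have := thetaLine_re_ge hσ hu1.le
  exact ((hasSum_thetaFour (by linarith)).mul_left _).tsum_eq

theorem exists_norm_thetaFour_le {c : ℝ} (hc : 0 < c) :
    ∃ C : ℝ, ∀ A : ℂ, c ≤ A.re → ‖thetaFour A‖ ≤ C := by
  have hp := Real.pi_pos
  have h1 : Summable fun n : ℕ => Real.exp (-(Real.pi * c)) ^ n :=
    summable_geometric_of_lt_one (Real.exp_pos _).le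
      (Real.exp_lt_one_iff.2 (by have := mul_pos hp hc; linarith))
  have hg : Summable fun n : ℕ => 2 * Real.exp (-(Real.pi * c)) ^ (n + 1) :=
    ((summable_nat_add_iff 1).2 h1).mul_left 2
  refine ⟨(∑' n : ℕ, 2 * Real.exp (-(Real.pi * c)) ^ (n + 1)) + 1, fun A hA => ?_⟩
  have h2 := (hasSum_thetaFour (hc.trans_le hA)).norm_le_of_bounded hg.hasSum fun n => ?_
  · have h3 := norm_add_le (thetaFour A - 1) 1
    rw [sub_add_cancel, norm_one] at h3
    linarith
  · rw [norm_mul, norm_mul, norm_pow, norm_neg, norm_one, one_pow, one_mul, Complex.norm_ofNat,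
      Complex.norm_exp, ← Real.exp_nat_mul]
    refine mul_le_mul_of_nonneg_left (Real.exp_le_exp.2 ?_) (by norm_num)
    rw [show -(Real.pi * A * ((n : ℂ) + 1) ^ 2) =
      ((-(Real.pi * ((n : ℝ) + 1) ^ 2) : ℝ) : ℂ) * A by push_cast; ring, re_ofReal_mul]
    push_cast
    have h2 : (n : ℝ) + 1 ≤ ((n : ℝ) + 1) ^ 2 := by nlinarith [(Nat.cast_nonneg n : (0 : ℝ) ≤ n)]
    have h3 : Real.pi * c * (n + 1) ≤ Real.pi * c * ((n : ℝ) + 1) ^ 2 :=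
      mul_le_mul_of_nonneg_left h2 (by positivity)
    have h4 : Real.pi * ((n : ℝ) + 1) ^ 2 * c ≤ Real.pi * ((n : ℝ) + 1) ^ 2 * A.re :=
      mul_le_mul_of_nonneg_left hA (by positivity)
    linarith

theorem integrableOn_thetaFour {σ : ℂ} (hσ : 0 < σ.re) :
    IntegrableOn (fun u : ℝ => ((u ^ (-(3 : ℝ) / 2) : ℝ) : ℂ) * thetaFour (thetaLine σ u))
      (Set.Ioi 1) := by
  obtain ⟨C, hC⟩ := exists_norm_thetaFour_le (half_pos hσ)
  refine Integrable.mul_bdd (c := C) ?_ ?_ ?_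
  · exact integrableOn_one_rpow.ofReal
  · refine ContinuousOn.aestronglyMeasurable (fun u hu => ?_) measurableSet_Ioi
    have hu1 : 1 < u := hu
    have h1 := thetaLine_re_ge hσ hu1.le
    have h2 : ContinuousAt thetaFour (thetaLine σ u) :=
      ((differentiableAt_jacobiTheta₂_snd (1 / 2) (τ := I * thetaLine σ u)
        (by simp; linarith)).comp (f := fun A : ℂ => I * A) _ (by fun_prop)).continuousAt
    exact (ContinuousAt.comp (f := fun u => thetaLine σ u) h2
      (by unfold thetaLine; fun_prop)).continuousWithinAt
  · filter_upwards [ae_restrict_mem measurableSet_Ioi] with u hu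
    exact hC _ (thetaLine_re_ge hσ (le_of_lt hu))

theorem zagierH_eq {σ : ℂ} (hσ : 0 < σ.re) :
    zagierH (I * σ / 4 + 1 / 2) = powSeries hurwitzH (-cexp (-(Real.pi / 2 : ℝ) * σ)) +
      1 / (8 * Real.pi * Real.sqrt σ.re) * ∫ u in Set.Ioi (1 : ℝ),
        ((u ^ (-(3 : ℝ) / 2) : ℝ) : ℂ) * thetaFour (thetaLine σ u) := by
  have hp := Real.pi_pos
  have him : (I * σ / 4 + 1 / 2).im = σ.re / 4 := by
    simp
  have hone : ∫ u in Set.Ioi (1 : ℝ), ((u ^ (-(3 : ℝ) / 2) : ℝ) : ℂ) = 2 := by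
    rw [integral_complex_ofReal, integral_one_rpow]; norm_num
  have hJ : ∫ u in Set.Ioi (1 : ℝ), ((u ^ (-(3 : ℝ) / 2) : ℝ) : ℂ) *
      (thetaFour (thetaLine σ u) - 1) = (∫ u in Set.Ioi (1 : ℝ),
        ((u ^ (-(3 : ℝ) / 2) : ℝ) : ℂ) * thetaFour (thetaLine σ u)) - 2 := by
    have hi : Integrable (fun u : ℝ => ((u ^ (-(3 : ℝ) / 2) : ℝ) : ℂ))
        (volume.restrict (Set.Ioi 1)) := integrableOn_one_rpow.ofReal
    rw [← hone, ← integral_sub (integrableOn_thetaFour hσ) hi]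
    simp only [mul_sub, mul_one]
  have hs : (0 : ℝ) < Real.sqrt σ.re := Real.sqrt_pos.2 hσ
  have hsp : (0 : ℝ) < Real.sqrt Real.pi := Real.sqrt_pos.2 hp
  have hterm : ∀ n : ℕ, ((n : ℂ) + 1) *
      (incGammaNegHalf (4 * Real.pi * ((n : ℝ) + 1) ^ 2 * (σ.re / 4)) : ℂ) *
        cexp (-2 * Real.pi * I * ((n : ℂ) + 1) ^ 2 * (I * σ / 4 + 1 / 2)) =
      1 / (2 * Real.sqrt Real.pi * Real.sqrt σ.re) *
        ∫ u in Set.Ioi (1 : ℝ), ((u ^ (-(3 : ℝ) / 2) : ℝ) : ℂ) *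
        (2 * ((-1) ^ (n + 1) * cexp (-(Real.pi * thetaLine σ u * ((n : ℂ) + 1) ^ 2)))) := by
    intro n
    have hn : (0 : ℝ) < (n : ℝ) + 1 := by positivity
    have hx : 4 * Real.pi * ((n : ℝ) + 1) ^ 2 * (σ.re / 4) = Real.pi * σ.re * ((n : ℝ) + 1) ^ 2 := by
      ring
    have hsq : Real.sqrt (Real.pi * σ.re * ((n : ℝ) + 1) ^ 2) =
        Real.sqrt Real.pi * Real.sqrt σ.re * (n + 1) := by
      rw [Real.sqrt_mul (by positivity), Real.sqrt_mul hp.le, Real.sqrt_sq hn.le]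
    have hsign : cexp (-(Real.pi * I * ((n : ℂ) + 1) ^ 2)) = (-1) ^ (n + 1) := by
      rw [Complex.exp_neg, mul_comm, show ((n : ℂ) + 1) ^ 2 = (((n + 1) ^ 2 : ℕ) : ℂ) by push_cast; rfl,
        Complex.exp_nat_mul, exp_pi_mul_I, ← inv_pow, sq, pow_mul]
      rcases Nat.even_or_odd (n + 1) with h | h
      · rw [show (-1 : ℂ)⁻¹ = -1 by norm_num, h.neg_one_pow, one_pow]
      · rw [show (-1 : ℂ)⁻¹ = -1 by norm_num, h.neg_one_pow, h.neg_one_pow]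
    have h_integrable : ∀ u : ℝ, ((u ^ (-(3 : ℝ) / 2) : ℝ) : ℂ) *
        (2 * ((-1) ^ (n + 1) * cexp (-(Real.pi * thetaLine σ u * ((n : ℂ) + 1) ^ 2)))) =
        ((Real.exp (-(Real.pi * σ.re * ((n : ℝ) + 1) ^ 2 * u)) * u ^ (-(3 : ℝ) / 2) : ℝ) : ℂ) *
          (2 * cexp (-2 * Real.pi * I * ((n : ℂ) + 1) ^ 2 * (I * σ / 4 + 1 / 2))) := by
      intro u
      rw [← hsign, ← Complex.exp_add, ofReal_mul, ofReal_exp,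
        show -2 * Real.pi * I * ((n : ℂ) + 1) ^ 2 * (I * σ / 4 + 1 / 2) =
          -(Real.pi * I * ((n : ℂ) + 1) ^ 2) + Real.pi * ((n : ℂ) + 1) ^ 2 * σ / 2 by
            linear_combination (-2 * Real.pi * ((n : ℂ) + 1) ^ 2 * σ / 4) * I_mul_I,
        show -(Real.pi * I * ((n : ℂ) + 1) ^ 2) + -(Real.pi * thetaLine σ u * ((n : ℂ) + 1) ^ 2) =
          ((-(Real.pi * σ.re * ((n : ℝ) + 1) ^ 2 * u) : ℝ) : ℂ) +
          (-(Real.pi * I * ((n : ℂ) + 1) ^ 2) + Real.pi * ((n : ℂ) + 1) ^ 2 * σ / 2) by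
            rw [thetaLine]; push_cast; ring, Complex.exp_add ((_ : ℝ) : ℂ)]
      ring
    simp only [h_integrable]
    rw [integral_mul_const, integral_complex_ofReal, hx, incGammaNegHalf_eq (by positivity), hsq]
    have hn' : ((n : ℂ) + 1) ≠ 0 := by exact_mod_cast hn.ne'
    have hs' : ((Real.sqrt σ.re : ℝ) : ℂ) ≠ 0 := ofReal_ne_zero.2 hs.ne'
    have hsp' : ((Real.sqrt Real.pi : ℝ) : ℂ) ≠ 0 := ofReal_ne_zero.2 hsp.ne'
    push_cast
    generalize ((∫ u in Set.Ioi (1 : ℝ), Real.exp (-(Real.pi * σ.re * ((n : ℝ) + 1) ^ 2 * u)) *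
      u ^ (-(3 : ℝ) / 2) : ℝ) : ℂ) = J
    generalize cexp (-2 * Real.pi * I * ((n : ℂ) + 1) ^ 2 * (I * σ / 4 + 1 / 2)) = E
    field_simp
  have hsum := ((hasSum_integral_thetaFour hσ).mul_left
    (1 / (2 * (Real.sqrt Real.pi : ℂ) * Real.sqrt σ.re))).tsum_eq
  have hq : ∀ n : ℕ, (hurwitzH n : ℂ) * cexp (2 * Real.pi * I * n * (I * σ / 4 + 1 / 2)) =
      (hurwitzH n : ℂ) * (-cexp (-(Real.pi / 2 : ℝ) * σ)) ^ n := by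
    intro n
    rw [show -cexp (-(Real.pi / 2 : ℝ) * σ) = cexp (Real.pi * I + -(Real.pi / 2 : ℝ) * σ) by
      rw [Complex.exp_add, exp_pi_mul_I]; ring, ← Complex.exp_nat_mul]
    congr 2
    push_cast
    linear_combination (Real.pi * n * σ / 2 : ℂ) * I_mul_I
  rw [zagierH, him]
  simp only [hterm, hq]
  rw [hsum, hJ, powSeries, Real.sqrt_div hσ.le, show Real.sqrt 4 = 2 by
    rw [show (4 : ℝ) = 2 ^ 2 by norm_num]; exact Real.sqrt_sq (by norm_num)]
  have hs' : ((Real.sqrt σ.re : ℝ) : ℂ) ≠ 0 := ofReal_ne_zero.2 hs.ne'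
  have hpp : ((Real.sqrt Real.pi : ℝ) : ℂ) * Real.sqrt Real.pi = Real.pi := by
    rw [← ofReal_mul, Real.mul_self_sqrt hp.le]
  have hsp' : ((Real.sqrt Real.pi : ℝ) : ℂ) ≠ 0 := ofReal_ne_zero.2 hsp.ne'
  rw [← hpp]
  generalize (∫ u in Set.Ioi (1 : ℝ),
        ((u ^ (-(3 : ℝ) / 2) : ℝ) : ℂ) * thetaFour (thetaLine σ u)) = J
  push_cast
  rw [add_assoc]
  congr 1
  field_simp
  ring

theorem inv_cpow_neg_of_re_pos {x : ℂ} (hx : 0 < x.re) (r : ℂ) : (x⁻¹) ^ (-r) = x ^ r := by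
  rw [inv_cpow, cpow_neg, inv_inv]
  intro h
  have := arg_lt_pi_div_two_iff.2 (Or.inl hx)
  rw [h] at this
  linarith [Real.pi_pos]

theorem thetaLine_one (s : ℂ) : (thetaLine s⁻¹ 1)⁻¹ = 2 * (starRingEnd ℂ) s := by
  have h : thetaLine s⁻¹ 1 = ((starRingEnd ℂ) s)⁻¹ / 2 := by
    rw [thetaLine, ← map_inv₀]
    have := Complex.add_conj s⁻¹
    push_cast at this ⊢
    linear_combination (-1 / 2 : ℂ) * this
  rw [h, inv_div, div_inv_eq_mul]

theorem cpow_inv_thetaLine_add {s : ℂ} (hs : 0 < s.re) {u : ℝ} (hu : 1 ≤ u) :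
    ((thetaLine s⁻¹ u)⁻¹ + 2 * s) ^ (-(3 : ℂ) / 2) * (s⁻¹).re / thetaLine s⁻¹ u ^ 2 =
      (s⁻¹) ^ ((3 : ℂ) / 2) * ((2 ^ (-(3 : ℝ) / 2) * (s⁻¹).re ^ (-(1 : ℝ) / 2) : ℝ) : ℂ) *
        ((u ^ (-(3 : ℝ) / 2) : ℝ) : ℂ) / thetaLine s⁻¹ u ^ ((1 : ℂ) / 2) := by
  have hσ := re_inv_pos hs
  have hs0 : s ≠ 0 := fun h => by simp [h] at hs
  have hA : 0 < (thetaLine s⁻¹ u).re := (half_pos hσ).trans_le (thetaLine_re_ge hσ hu)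
  have hA0 : thetaLine s⁻¹ u ≠ 0 := fun h => by simp [h] at hA
  have hu0 : 0 < u := zero_lt_one.trans_le hu
  set A := thetaLine s⁻¹ u with hAdef
  set r := (s⁻¹).re with hr
  have hsplit : A⁻¹ + 2 * s = ((2 * u * r : ℝ) : ℂ) * A⁻¹ * s := by
    field_simp
    rw [hAdef, thetaLine, ← hr]
    push_cast
    field_simp
    ring
  have h2ur : 0 < 2 * u * r := by positivity
  have h1 : (A⁻¹ + 2 * s) ^ (-(3 : ℂ) / 2) =
      (((2 * u * r) ^ (-(3 : ℝ) / 2) : ℝ) : ℂ) * A ^ ((3 : ℂ) / 2) * (s⁻¹) ^ ((3 : ℂ) / 2) := by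
    rw [hsplit, cpow_mul_of_re_pos (by rw [re_ofReal_mul]; exact mul_pos h2ur (re_inv_pos hA)) hs,
      cpow_mul_of_re_pos (by simpa using h2ur) (re_inv_pos hA), ← inv_cpow_neg_of_re_pos hA,
      ← inv_cpow_neg_of_re_pos hσ, inv_inv, ofReal_cpow h2ur.le, neg_div]
    push_cast
    rw [neg_div]
  have h2 : A ^ ((3 : ℂ) / 2) = A * A ^ ((1 : ℂ) / 2) := by
    rw [show (3 : ℂ) / 2 = 1 + 1 / 2 by norm_num, cpow_add _ _ hA0, cpow_one]
  have h3 : A ^ ((1 : ℂ) / 2) * A ^ ((1 : ℂ) / 2) = A := by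
    rw [← cpow_add _ _ hA0]; norm_num
  have h4 : A ^ ((1 : ℂ) / 2) ≠ 0 := fun h => hA0 (by rw [← h3, h, mul_zero])
  have h5 : (2 * u * r) ^ (-(3 : ℝ) / 2) * r =
      2 ^ (-(3 : ℝ) / 2) * r ^ (-(1 : ℝ) / 2) * u ^ (-(3 : ℝ) / 2) := by
    rw [Real.mul_rpow (by positivity) hσ.le, Real.mul_rpow (by norm_num) hu0.le, mul_assoc,
      ← Real.rpow_add_one' hσ.le (by norm_num)]
    norm_num
    ring
  have h6 := congrArg Complex.ofReal h5
  rw [ofReal_mul, ofReal_mul] at h6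
  rw [h1, h2, div_eq_div_iff (pow_ne_zero 2 hA0) h4]
  linear_combination A ^ 2 * (s⁻¹) ^ ((3 : ℂ) / 2) * h6 +
    A * (s⁻¹) ^ ((3 : ℂ) / 2) * (((2 * u * r) ^ (-(3 : ℝ) / 2) : ℝ) : ℂ) * r * h3

theorem integral_thetaFour_eq {s : ℂ} (hs : 0 < s.re) :
    (s⁻¹) ^ ((3 : ℂ) / 2) * ((2 ^ (-(3 : ℝ) / 2) * (s⁻¹).re ^ (-(1 : ℝ) / 2) : ℝ) : ℂ) *
      ∫ u in Set.Ioi (1 : ℝ), ((u ^ (-(3 : ℝ) / 2) : ℝ) : ℂ) * thetaFour (thetaLine s⁻¹ u) =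
      thetaIntegral s 0 - thetaIntegral s (2 * (starRingEnd ℂ) s) := by
  have hσ := re_inv_pos hs
  have hre : ∀ u : ℝ, 1 ≤ u → 0 < (thetaLine s⁻¹ u).re := fun u hu =>
    (half_pos hσ).trans_le (thetaLine_re_ge hσ hu)
  have hder : ∀ u : ℝ, 1 ≤ u → HasDerivAt (fun u : ℝ => thetaIntegral s (thetaLine s⁻¹ u)⁻¹)
      ((s⁻¹) ^ ((3 : ℂ) / 2) * ((2 ^ (-(3 : ℝ) / 2) * (s⁻¹).re ^ (-(1 : ℝ) / 2) : ℝ) : ℂ) *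
        (((u ^ (-(3 : ℝ) / 2) : ℝ) : ℂ) * thetaFour (thetaLine s⁻¹ u))) u := by
    intro u hu
    have hA := hre u hu
    have hA0 : thetaLine s⁻¹ u ≠ 0 := fun h => by simp [h] at hA
    have h1 : HasDerivAt (fun z : ℂ => z * (s⁻¹).re - s⁻¹ / 2) ((s⁻¹).re : ℂ) (u : ℂ) := by
      simpa using ((hasDerivAt_id (u : ℂ)).mul_const ((s⁻¹).re : ℂ)).sub_const (s⁻¹ / 2)
    have h2 : HasDerivAt (fun u : ℝ => (thetaLine s⁻¹ u)⁻¹)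
        (-((s⁻¹).re : ℂ) / thetaLine s⁻¹ u ^ 2) u := (h1.comp_ofReal).fun_inv hA0
    have h3 := (hasDerivAt_thetaIntegral hs (re_inv_pos hA)).comp u h2
    refine h3.congr_deriv ?_
    rw [thetaKernel, thetaFour_eq hA0]
    linear_combination thetaTwo (thetaLine s⁻¹ u)⁻¹ * cpow_inv_thetaLine_add hs hu
  have hlim : Filter.Tendsto (fun u : ℝ => thetaIntegral s (thetaLine s⁻¹ u)⁻¹) Filter.atTop
      (nhds (thetaIntegral s 0)) := by
    refine (tendsto_thetaIntegral hs).comp (tendsto_nhdsWithin_iff.2 ⟨?_, ?_⟩)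
    · refine squeeze_zero_norm' (a := fun u : ℝ => ((u - 1 / 2) * (s⁻¹).re)⁻¹) ?_ ?_
      · filter_upwards [Filter.eventually_ge_atTop 1] with u hu
        rw [norm_inv, ← thetaLine_re]
        exact inv_anti₀ (hre u hu) (re_le_norm _)
      · refine Filter.Tendsto.inv_tendsto_atTop (Filter.Tendsto.atTop_mul_const hσ ?_)
        exact Filter.tendsto_atTop_add_const_right _ _ Filter.tendsto_id
    · filter_upwards [Filter.eventually_ge_atTop 1] with u hu
      exact re_inv_pos (hre u hu)
  have h := integral_Ioi_of_hasDerivAt_of_tendsto (hder 1 le_rfl).continuousAt.continuousWithinAt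
    (fun u hu => hder u (le_of_lt hu)) ((integrableOn_thetaFour hσ).const_mul _) hlim
  rw [integral_const_mul, thetaLine_one] at h
  exact h

theorem zagierH_inversion {s : ℂ} (hs : 0 < s.re) :
    (s⁻¹) ^ ((3 : ℂ) / 2) / (Real.sqrt 2 : ℝ) * zagierH (I * s⁻¹ / 4 + 1 / 2) =
      -(powSeries hurwitzOdd (cexp (-(Real.pi / 2 : ℝ) * s)) +
        1 / (4 * Real.pi) * thetaIntegral s (2 * (starRingEnd ℂ) s)) := by
  have hp := Real.pi_pos
  have hσ := re_inv_pos hs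
  have h1 := hurwitz_theta_identity hs
  have h2 := integral_thetaFour_eq hs
  have h3 : thetaIntegral s 0 =
      ∫ B in Set.Ioi (0 : ℝ), thetaTwo B * (B + 2 * s) ^ (-(3 : ℂ) / 2) := by
    simp only [thetaIntegral, thetaKernel, zero_add]
  have h4 : (2 : ℝ) ^ (-(3 : ℝ) / 2) * (s⁻¹).re ^ (-(1 : ℝ) / 2) =
      1 / (2 * Real.sqrt 2 * Real.sqrt (s⁻¹).re) := by
    have e1 : (2 : ℝ) ^ (-(3 : ℝ) / 2) = (2 * Real.sqrt 2)⁻¹ := by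
      rw [Real.sqrt_eq_rpow, ← Real.rpow_one_add' (by norm_num) (by norm_num),
        ← Real.rpow_neg (by norm_num)]
      norm_num
    rw [e1, Real.sqrt_eq_rpow (s⁻¹).re, neg_div, Real.rpow_neg hσ.le, ← mul_inv, one_div, one_div]
  rw [h4] at h2
  rw [← h3] at h1
  rw [zagierH_eq hσ]
  have hs2 : ((Real.sqrt 2 : ℝ) : ℂ) ≠ 0 := ofReal_ne_zero.2 (by positivity)
  have hsr : ((Real.sqrt (s⁻¹).re : ℝ) : ℂ) ≠ 0 := ofReal_ne_zero.2 (Real.sqrt_pos.2 hσ).ne'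
  have hpc : (Real.pi : ℂ) ≠ 0 := ofReal_ne_zero.2 hp.ne'
  have h5 : (s⁻¹) ^ ((3 : ℂ) / 2) / (Real.sqrt 2 : ℝ) * (1 / (8 * Real.pi * Real.sqrt (s⁻¹).re) *
      ∫ u in Set.Ioi (1 : ℝ), ((u ^ (-(3 : ℝ) / 2) : ℝ) : ℂ) * thetaFour (thetaLine s⁻¹ u)) =
      1 / (4 * Real.pi) * (thetaIntegral s 0 - thetaIntegral s (2 * (starRingEnd ℂ) s)) := by
    rw [← h2]
    generalize (∫ u in Set.Ioi (1 : ℝ),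
      ((u ^ (-(3 : ℝ) / 2) : ℝ) : ℂ) * thetaFour (thetaLine s⁻¹ u)) = J
    generalize Real.sqrt (s⁻¹).re = q at hsr ⊢
    push_cast
    field_simp
    ring
  linear_combination h1 + h5

theorem powSeries_hurwitzOdd_mul_I (q : ℂ) :
    powSeries hurwitzOdd (I * q) = -I * powSeries hurwitzOdd q := by
  rw [powSeries, powSeries, ← tsum_mul_left]
  refine tsum_congr fun N => ?_
  by_cases h : N % 4 = 3
  · have : I ^ N = -I := by
      rw [← Nat.div_add_mod N 4, h, pow_add, pow_mul, I_pow_four, one_pow, one_mul, I_pow_three]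
    rw [mul_pow, this]
    ring
  · simp [hurwitzOdd, h]

theorem thetaIntegral_sub_I {s : ℂ} (hs : 0 < s.re) :
    thetaIntegral (s - I) (2 * (starRingEnd ℂ) (s - I)) =
      -I * thetaIntegral s (2 * (starRingEnd ℂ) s) := by
  rw [thetaIntegral, thetaIntegral, ← integral_const_mul]
  refine setIntegral_congr_fun measurableSet_Ioi fun x hx => ?_
  have hx : 0 < x := hx
  have h : 0 < (2 * (starRingEnd ℂ) s + x).re := by simp; positivity
  simp only [thetaKernel]
  rw [map_sub, conj_I, show 2 * ((starRingEnd ℂ) s - -I) + (x : ℂ) =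
    2 * (starRingEnd ℂ) s + x + 2 * I by ring, thetaTwo_add_two_I h,
    show 2 * (starRingEnd ℂ) s + x + 2 * I + 2 * (s - I) = 2 * (starRingEnd ℂ) s + x + 2 * s by ring]
  ring

theorem zagierH_shift {s : ℂ} (hs : 0 < s.re) :
    ((s - I)⁻¹) ^ ((3 : ℂ) / 2) * zagierH (I * (s - I)⁻¹ / 4 + 1 / 2) =
      -I * ((s⁻¹) ^ ((3 : ℂ) / 2) * zagierH (I * s⁻¹ / 4 + 1 / 2)) := by
  have hs' : 0 < (s - I).re := by simpa using hs
  have h1 := zagierH_inversion hs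
  have h2 := zagierH_inversion hs'
  have hq : cexp (-(Real.pi / 2 : ℝ) * (s - I)) = I * cexp (-(Real.pi / 2 : ℝ) * s) := by
    rw [show -(Real.pi / 2 : ℝ) * (s - I) = (Real.pi : ℂ) / 2 * I + -(Real.pi / 2 : ℝ) * s by
      push_cast; ring, Complex.exp_add, exp_pi_div_two_mul_I]
  rw [thetaIntegral_sub_I hs, hq, powSeries_hurwitzOdd_mul_I] at h2
  have hs2 : ((Real.sqrt 2 : ℝ) : ℂ) ≠ 0 := ofReal_ne_zero.2 (by positivity)
  rw [div_mul_eq_mul_div, div_eq_iff hs2] at h1 h2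
  rw [h1, h2]
  ring

theorem zagierH_add_one (z : ℂ) : zagierH (z + 1) = zagierH z := by
  have him : (z + 1).im = z.im := by simp
  have h1 : ∀ n : ℕ, cexp (2 * Real.pi * I * n * (z + 1)) = cexp (2 * Real.pi * I * n * z) := by
    intro n
    rw [show 2 * Real.pi * I * n * (z + 1) = 2 * Real.pi * I * n * z + (n : ℤ) * (2 * Real.pi * I) by
      push_cast; ring]
    exact Complex.exp_periodic.int_mul _ _
  have h2 : ∀ n : ℕ, cexp (-2 * Real.pi * I * ((n : ℂ) + 1) ^ 2 * (z + 1)) =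
      cexp (-2 * Real.pi * I * ((n : ℂ) + 1) ^ 2 * z) := by
    intro n
    rw [show -2 * Real.pi * I * ((n : ℂ) + 1) ^ 2 * (z + 1) =
      -2 * Real.pi * I * ((n : ℂ) + 1) ^ 2 * z + (-((n : ℤ) + 1) ^ 2 : ℤ) * (2 * Real.pi * I) by
      push_cast; ring]
    exact Complex.exp_periodic.int_mul _ _
  simp only [zagierH, him, h1, h2]

theorem zagierH_div_four_mul_add_one {z : ℂ} (hz : 0 < z.im) :
    zagierH (z / (4 * z + 1)) = (4 * z + 1) ^ ((3 : ℂ) / 2) * zagierH z := by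
  have hw : 0 < (4 * z + 1).im := by simpa using hz
  set w := 4 * z + 1 with hwdef
  have hw0 : w ≠ 0 := fun h => by simp [h] at hw
  set σ := -I * (w + 1) with hσdef
  have hσ : 0 < σ.re := by rw [hσdef]; simpa using hw
  have hσ0 : σ ≠ 0 := fun h => by simp [h] at hσ
  have h := zagierH_shift (re_inv_pos hσ)
  have hs' : 0 < (σ⁻¹ - I).re := by simpa using re_inv_pos hσ
  have hs0 : σ⁻¹ - I ≠ 0 := fun h => by simp [h] at hs'
  have hprod : σ * (σ⁻¹ - I) = -w := by
    rw [mul_sub, mul_inv_cancel₀ hσ0]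
    linear_combination (w + 1) * I_mul_I
  have e1 : I * σ / 4 + 1 / 2 = z + 1 := by
    linear_combination (-(w + 1) / 4) * I_mul_I + hwdef / 4
  have e2 : I * (σ⁻¹ - I)⁻¹ / 4 + 1 / 2 = z / w := by
    have h1 : (σ⁻¹ - I)⁻¹ = -σ / w := by
      rw [inv_eq_iff_eq_inv, inv_div, eq_div_iff (neg_ne_zero.2 hσ0)]
      linear_combination -hprod
    rw [h1, eq_div_iff hw0, add_mul, mul_div_right_comm, mul_div_assoc']
    field_simp
    linear_combination 2 * (w + 1) * I_mul_I + hwdef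
  rw [e2, inv_inv, e1, zagierH_add_one] at h
  have h2 := cpow_mul_of_re_pos hσ hs' ((3 : ℂ) / 2)
  rw [hprod, neg_cpow_three_half hw] at h2
  have h3 := cpow_mul_of_re_pos (re_inv_pos hs') hs' ((3 : ℂ) / 2)
  rw [inv_mul_cancel₀ hs0, one_cpow] at h3
  linear_combination (σ⁻¹ - I) ^ ((3 : ℂ) / 2) * h + zagierH (z / w) * h3 + I * zagierH z * h2 -
    w ^ ((3 : ℂ) / 2) * zagierH z * I_mul_I

/-- Zagier's theorem: ℋ transforms like a modular form of weight 3/2 on Γ₀(4). -/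
theorem zagierH_transform (a b c d : ℤ) (hdet : a * d - b * c = 1) (hc : (4 : ℤ) ∣ c)
    (z : ℂ) (hz : 0 < z.im) :
    zagierH (((a : ℂ) * z + b) / ((c : ℂ) * z + d)) =
      (kron c d : ℂ) * (eps d) ^ (-3 : ℤ) * ((c : ℂ) * z + d) ^ ((3 : ℂ) / 2) * zagierH z := by
  exact transform_of_generators zagierH (fun z _ => zagierH_add_one z)
    (fun z hz => zagierH_div_four_mul_add_one hz) a b c d hdet hc z hz |>.trans (by rw [autFactor])

end
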